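/- Let n ≥ 2, let A(D) be a homogeneous linear differential operator of order k on ℝⁿ from V to E, and let λ ∈ [0, 1). Then there exists a constant C > 0 such that the Hardy–Sobolev inequality (∫_{ℝⁿ} |D^{k−1}u(x)|^{(n−λ)/(n−1)} / |x|^λ dx)^{(n−1)/(n−λ)} ≤ C ∫_{ℝⁿ} |A(D)u(x)| dx holds for every u ∈ C_c^∞(ℝⁿ; V) if and only if A(D) is elliptic and canceling. -/

import Mathlib

open MeasureTheory ENNReal
open scoped NNReal RealInnerProductSpace

noncomputable section

/-- A homogeneous linear differential operator `A(D)` of order `k` from `V` to `E` on a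
Euclidean space `X`, represented through its action `u ↦ A (D^k u)` on the `k`-th
iterated (Fréchet) derivative; this is equivalent to the data of a family of coefficients
`(A_α)_{|α| = k}`, `A_α ∈ 𝓛(V; E)`, acting by `A(D)u = ∑_{|α|=k} A_α (∂^α u)`. -/
abbrev DiffOperator (X : Type*) [NormedAddCommGroup X] [InnerProductSpace ℝ X]
    (k : ℕ) (V E : Type*) [NormedAddCommGroup V] [NormedSpace ℝ V]
    [NormedAddCommGroup E] [NormedSpace ℝ E] :=
  ContinuousMultilinearMap ℝ (fun _ : Fin k => X) V →L[ℝ] E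

namespace DiffOperator

variable {X : Type*} [NormedAddCommGroup X] [InnerProductSpace ℝ X]
  {k : ℕ} {V E : Type*} [NormedAddCommGroup V] [NormedSpace ℝ V]
  [NormedAddCommGroup E] [NormedSpace ℝ E]

/-- The action `A(D)u` of the differential operator on a function `u : X → V`. -/
noncomputable def app (A : DiffOperator X k V E) (u : X → V) (x : X) : E :=
  A (iteratedFDeriv ℝ k u x)

/-- The symbol `A(ξ) = ∑_{|α|=k} ξ^α A_α ∈ 𝓛(V; E)` of the operator: it sends `v : V` to
`A` applied to the `k`-linear map `(w₁, …, w_k) ↦ (⟪ξ,w₁⟫ ⋯ ⟪ξ,w_k⟫) • v`. -/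
noncomputable def symbol (A : DiffOperator X k V E) (ξ : X) : V →L[ℝ] E :=
  A.comp (((ContinuousMultilinearMap.compContinuousLinearMapL
      (fun _ : Fin k => innerSL ℝ ξ)).comp
    (ContinuousMultilinearMap.piFieldEquiv ℝ (Fin k)
      V).toContinuousLinearEquiv.toContinuousLinearMap))

/-- `A(D)` is elliptic if its symbol `A(ξ)` is injective for every `ξ ≠ 0`. -/
def IsElliptic (A : DiffOperator X k V E) : Prop :=
  ∀ ξ : X, ξ ≠ 0 → Function.Injective (A.symbol ξ)

/-- `A(D)` is canceling if `⋂_{ξ ≠ 0} A(ξ)[V] = {0}`. -/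
def IsCanceling (A : DiffOperator X k V E) : Prop :=
  (⋂ (ξ : X) (_ : ξ ≠ 0), Set.range (A.symbol ξ)) = {0}

end DiffOperator

/-- `u ∈ C_c^∞`: a smooth compactly supported function. -/
def IsTestFun {X V : Type*} [NormedAddCommGroup X] [NormedSpace ℝ X]
    [NormedAddCommGroup V] [NormedSpace ℝ V] (u : X → V) : Prop :=
  ContDiff ℝ (⊤ : ℕ∞) u ∧ HasCompactSupport u



section radial
variable {Y : Type*} [NormedAddCommGroup Y] [InnerProductSpace ℝ Y] [FiniteDimensional ℝ Y]
  [MeasurableSpace Y] [BorelSpace Y]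

theorem hs_lintegral_comp_smul (f : Y → ℝ≥0∞) {R : ℝ} (hR : 0 < R) :
    ∫⁻ y : Y, f (R • y) = ENNReal.ofReal ((R ^ Module.finrank ℝ Y)⁻¹) * ∫⁻ y, f y := by
  have h1 := Measure.map_addHaar_smul (volume : Measure Y) hR.ne'
  have h2 : ∫⁻ y, f y ∂(Measure.map (fun y : Y => R • y) volume) = ∫⁻ y : Y, f (R • y) :=
    ((Homeomorph.smulOfNeZero R hR.ne').isClosedEmbedding.measurableEmbedding).lintegral_map f
  rw [← h2]
  have h1' : Measure.map (fun y : Y => R • y) volume =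
    ENNReal.ofReal |(R ^ Module.finrank ℝ Y)⁻¹| • (volume : Measure Y) := h1
  rw [h1', lintegral_smul_measure, abs_of_pos (by positivity)]
  rfl

/-- radial profile -/
def hsProf (a b : ℝ) (x : ℝ≥0∞) : ℝ≥0∞ := min (x ^ (-a)) (x ^ (-b))

theorem hsProf_measurable (a b : ℝ) : Measurable (hsProf a b) := by
  unfold hsProf; fun_prop

theorem hsProf_lintegral_ne_top [Nontrivial Y] {a b : ℝ} (ha : a < Module.finrank ℝ Y)
    (hb : (Module.finrank ℝ Y : ℝ) < b) :
    ∫⁻ y : Y, hsProf a b ‖y‖ₑ ≠ ⊤ := by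
  have hd : 1 ≤ Module.finrank ℝ Y := Module.finrank_pos
  have key : Integrable (fun y : Y => (fun t : ℝ => min (t ^ (-a)) (t ^ (-b))) ‖y‖) volume := by
    rw [integrable_fun_norm_addHaar volume (f := fun t : ℝ => min (t ^ (-a)) (t ^ (-b)))]
    have hU : Set.Ioi (0:ℝ) = Set.Ioc 0 1 ∪ Set.Ioi 1 := by
      rw [Set.Ioc_union_Ioi_eq_Ioi zero_le_one]
    have hm : Measurable (fun y : ℝ => y ^ (Module.finrank ℝ Y - 1) • min (y ^ (-a)) (y ^ (-b))) := by
      fun_prop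
    have hcast : ((Module.finrank ℝ Y - 1 : ℕ) : ℝ) = (Module.finrank ℝ Y : ℝ) - 1 := by
      push_cast [hd]; ring
    rw [hU]
    refine IntegrableOn.union ?_ ?_
    · have h1 : IntegrableOn (fun y : ℝ => y ^ ((Module.finrank ℝ Y : ℝ) - 1 - a)) (Set.Ioc 0 1) := by
        have := intervalIntegral.intervalIntegrable_rpow' (a := 0) (b := 1) (r := (Module.finrank ℝ Y : ℝ) - 1 - a) (by linarith)
        rwa [intervalIntegrable_iff_integrableOn_Ioc_of_le zero_le_one] at this
      refine Integrable.mono' h1 hm.aestronglyMeasurable ?_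
      filter_upwards [ae_restrict_mem measurableSet_Ioc] with y hy
      have hy0 : 0 < y := hy.1
      have e1 : y ^ ((Module.finrank ℝ Y : ℝ) - 1 - a) = y ^ (Module.finrank ℝ Y - 1) * y ^ (-a) := by
        rw [← Real.rpow_natCast, hcast, ← Real.rpow_add hy0]; ring_nf
      rw [e1, smul_eq_mul, Real.norm_of_nonneg (by positivity)]
      gcongr; exact min_le_left _ _
    · have h1 : IntegrableOn (fun y : ℝ => y ^ ((Module.finrank ℝ Y : ℝ) - 1 - b)) (Set.Ioi 1) :=
        integrableOn_Ioi_rpow_of_lt (by linarith) zero_lt_one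
      refine Integrable.mono' h1 hm.aestronglyMeasurable ?_
      filter_upwards [ae_restrict_mem measurableSet_Ioi] with y hy
      have hy0 : 0 < y := zero_lt_one.trans hy
      have e1 : y ^ ((Module.finrank ℝ Y : ℝ) - 1 - b) = y ^ (Module.finrank ℝ Y - 1) * y ^ (-b) := by
        rw [← Real.rpow_natCast, hcast, ← Real.rpow_add hy0]; ring_nf
      rw [e1, smul_eq_mul, Real.norm_of_nonneg (by positivity)]
      gcongr; exact min_le_right _ _
  have h2 := key.lintegral_lt_top
  have h3 : ∫⁻ y : Y, hsProf a b ‖y‖ₑ = ∫⁻ y : Y, ENNReal.ofReal (min (‖y‖ ^ (-a)) (‖y‖ ^ (-b))) := by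
    refine lintegral_congr_ae ?_
    have : ∀ᵐ y : Y, y ≠ 0 := by
      simp [ae_iff]
    filter_upwards [this] with y hy
    have hy0 : 0 < ‖y‖ := norm_pos_iff.2 hy
    rw [hsProf, ENNReal.ofReal_min, ← ofReal_norm, ENNReal.ofReal_rpow_of_pos hy0,
      ENNReal.ofReal_rpow_of_pos hy0]
  rw [h3]; exact h2.ne

theorem hsProf_scale (a b : ℝ) {R : ℝ} (hR : 0 < R) :
    ∫⁻ y : Y, hsProf a b (‖y‖ₑ / ENNReal.ofReal R) =
      ENNReal.ofReal (R ^ Module.finrank ℝ Y) * ∫⁻ y : Y, hsProf a b ‖y‖ₑ := by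
  have := hs_lintegral_comp_smul (Y := Y) (fun y => hsProf a b ‖y‖ₑ) (R := R⁻¹) (by positivity)
  rw [inv_pow, inv_inv] at this
  rw [← this]
  congr 1; ext y
  rw [enorm_smul, div_eq_mul_inv, mul_comm, ← ENNReal.ofReal_inv_of_pos hR, Real.enorm_of_nonneg (by positivity)]

end radial

theorem hs_prof_identity {β : ℝ} {c r : ℝ≥0∞} (hc0 : c ≠ 0) (hc : c ≠ ⊤) (hr0 : r ≠ 0) (hr : r ≠ ⊤) :
    c ^ β * min c (r⁻¹) * r ^ (β - 1) = c ^ (2:ℝ) * hsProf (1 - β) (2 - β) (r * c) := by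
  unfold hsProf
  have e1 : -(1 - β) = β - 1 := by ring
  have e2 : -(2 - β) = β - 2 := by ring
  rw [e1, e2]
  rw [mul_min, mul_min, min_mul]
  have h1 : c ^ β * c * r ^ (β - 1) = c ^ (2:ℝ) * (r * c) ^ (β - 1) := by
    rw [ENNReal.mul_rpow_of_ne_top hr hc]
    have : c ^ β * c = c ^ (2:ℝ) * c ^ (β - 1) := by
      nth_rewrite 2 [← ENNReal.rpow_one c]
      rw [← ENNReal.rpow_add _ _ hc0 hc, ← ENNReal.rpow_add _ _ hc0 hc]; ring_nf
    rw [this]; ring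
  have h2 : c ^ β * r⁻¹ * r ^ (β - 1) = c ^ (2:ℝ) * (r * c) ^ (β - 2) := by
    rw [ENNReal.mul_rpow_of_ne_top hr hc]
    have h3 : c ^ β = c ^ (2:ℝ) * c ^ (β - 2) := by
      rw [← ENNReal.rpow_add _ _ hc0 hc]; ring_nf
    have h4 : r⁻¹ * r ^ (β - 1) = r ^ (β - 2) := by
      rw [← ENNReal.rpow_neg_one, ← ENNReal.rpow_add _ _ hr0 hr]; ring_nf
    rw [mul_assoc, h4, h3]; ring
  rw [h1, h2]

theorem hs_oneD_inner {β : ℝ} (h0 : 0 < β) (h1 : β < 1) :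
    ∃ C : ℝ≥0∞, C ≠ ⊤ ∧ ∀ c : ℝ≥0∞,
      ∫⁻ r : ℝ, c ^ β * min c (‖r‖ₑ⁻¹) * ‖r‖ₑ ^ (β - 1) ≤ C * c := by
  refine ⟨(∫⁻ y : ℝ, hsProf (1 - β) (2 - β) ‖y‖ₑ) + 1, ?_, ?_⟩
  · exact ENNReal.add_ne_top.2 ⟨hsProf_lintegral_ne_top (by simp; linarith) (by simp; linarith), by simp⟩
  intro c
  rcases eq_or_ne c 0 with rfl | hc0
  · simp [ENNReal.zero_rpow_of_pos h0]
  rcases eq_or_ne c ⊤ with rfl | hc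
  · rw [ENNReal.mul_top (by simp)]; exact le_top
  have hcpos : 0 < c.toReal := ENNReal.toReal_pos hc0 hc
  have hs := hsProf_scale (Y := ℝ) (1 - β) (2 - β) (R := c.toReal⁻¹) (by positivity)
  have e : ∫⁻ r : ℝ, c ^ β * min c (‖r‖ₑ⁻¹) * ‖r‖ₑ ^ (β - 1) =
      ∫⁻ r : ℝ, c ^ (2:ℝ) * hsProf (1 - β) (2 - β) (‖r‖ₑ / ENNReal.ofReal (c.toReal⁻¹)) := by
    refine lintegral_congr_ae ?_
    have : ∀ᵐ y : ℝ, y ≠ 0 := by simp [ae_iff]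
    filter_upwards [this] with r hr
    rw [hs_prof_identity hc0 hc (by simpa using hr) (by simp), ENNReal.ofReal_inv_of_pos hcpos,
      ENNReal.ofReal_toReal hc, div_eq_mul_inv, inv_inv]
  rw [e, lintegral_const_mul' _ _ (ENNReal.rpow_ne_top_of_nonneg (by norm_num) hc), hs]
  simp only [Module.finrank_self, pow_one]
  rw [ENNReal.ofReal_inv_of_pos hcpos, ENNReal.ofReal_toReal hc, ← mul_assoc]
  have : c ^ (2:ℝ) * c⁻¹ = c := by
    rw [← ENNReal.rpow_neg_one, ← ENNReal.rpow_add _ _ hc0 hc]; norm_num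
  rw [this, mul_comm]
  gcongr; exact le_self_add

theorem hs_oneD {β : ℝ} (h0 : 0 < β) (h1 : β < 1) :
    ∃ C : ℝ≥0∞, C ≠ ⊤ ∧ ∀ Φ a : ℝ → ℝ≥0∞, Measurable Φ → Measurable a →
      ∫⁻ s : ℝ, ∫⁻ t : ℝ, Φ s * min (a t) (‖s - t‖ₑ⁻¹) * ‖s - t‖ₑ ^ (β - 1) ≤
        C * ((∫⁻ s, Φ s ^ (1 / β)) + ∫⁻ t, a t) := by
  obtain ⟨C, hC, hCc⟩ := hs_oneD_inner h0 h1
  refine ⟨C, hC, fun Φ a hΦ ha => ?_⟩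
  have hm : ∀ (g : ℝ → ℝ≥0∞), Measurable g → Measurable (fun p : ℝ × ℝ =>
      g p.1 ^ β * min (g p.1) (‖p.1 - p.2‖ₑ⁻¹) * ‖p.1 - p.2‖ₑ ^ (β - 1)) := by
    intro g hg
    have : Measurable (fun p : ℝ × ℝ => g p.1) := hg.comp measurable_fst
    fun_prop
  have hm2 : ∀ (g : ℝ → ℝ≥0∞), Measurable g → Measurable (fun p : ℝ × ℝ =>
      g p.2 ^ β * min (g p.2) (‖p.1 - p.2‖ₑ⁻¹) * ‖p.1 - p.2‖ₑ ^ (β - 1)) := by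
    intro g hg
    have : Measurable (fun p : ℝ × ℝ => g p.2) := hg.comp measurable_snd
    fun_prop
  have hbd : ∀ s t, Φ s * min (a t) (‖s - t‖ₑ⁻¹) * ‖s - t‖ₑ ^ (β - 1) ≤
      (Φ s ^ (1 / β)) ^ β * min (Φ s ^ (1 / β)) (‖s - t‖ₑ⁻¹) * ‖s - t‖ₑ ^ (β - 1) +
      (a t) ^ β * min (a t) (‖s - t‖ₑ⁻¹) * ‖s - t‖ₑ ^ (β - 1) := by
    intro s t
    have hX : Φ s = (Φ s ^ (1 / β)) ^ β := by
      rw [← ENNReal.rpow_mul, one_div, inv_mul_cancel₀ h0.ne', ENNReal.rpow_one]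
    rcases le_total (Φ s ^ (1 / β)) (a t) with h | h
    · refine le_trans ?_ le_add_self
      gcongr
      calc Φ s = (Φ s ^ (1 / β)) ^ β := hX
        _ ≤ _ := by gcongr
    · refine le_trans ?_ le_self_add
      rw [← hX]; gcongr
  calc _ ≤ ∫⁻ s : ℝ, ∫⁻ t : ℝ, ((Φ s ^ (1 / β)) ^ β * min (Φ s ^ (1 / β)) (‖s - t‖ₑ⁻¹) * ‖s - t‖ₑ ^ (β - 1) +
      (a t) ^ β * min (a t) (‖s - t‖ₑ⁻¹) * ‖s - t‖ₑ ^ (β - 1)) := by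
        gcongr with s t; exact hbd s t
    _ = (∫⁻ s : ℝ, ∫⁻ t : ℝ, ((Φ s ^ (1 / β)) ^ β * min (Φ s ^ (1 / β)) (‖s - t‖ₑ⁻¹) * ‖s - t‖ₑ ^ (β - 1))) +
      ∫⁻ s : ℝ, ∫⁻ t : ℝ, (a t) ^ β * min (a t) (‖s - t‖ₑ⁻¹) * ‖s - t‖ₑ ^ (β - 1) := by
        have hmm := hm (fun s => Φ s ^ (1 / β)) (by fun_prop)
        rw [← lintegral_add_left hmm.lintegral_prod_right']
        refine lintegral_congr fun s => ?_
        exact lintegral_add_left (hmm.comp measurable_prodMk_left) _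
    _ ≤ (∫⁻ s, C * Φ s ^ (1 / β)) + ∫⁻ t, C * a t := by
        refine add_le_add ?_ ?_
        · refine lintegral_mono fun s => ?_
          refine le_trans (le_of_eq ?_) (hCc (Φ s ^ (1 / β)))
          exact lintegral_sub_left_eq_self (fun r : ℝ => (Φ s ^ (1 / β)) ^ β * min (Φ s ^ (1 / β)) (‖r‖ₑ⁻¹) * ‖r‖ₑ ^ (β - 1)) s
        · rw [lintegral_lintegral_swap (hm2 a ha).aemeasurable]
          refine lintegral_mono fun t => ?_
          refine le_trans (le_of_eq ?_) (hCc (a t))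
          exact lintegral_sub_right_eq_self (fun r : ℝ => (a t) ^ β * min (a t) (‖r‖ₑ⁻¹) * ‖r‖ₑ ^ (β - 1)) t
    _ = _ := by
        rw [lintegral_const_mul' _ _ hC, lintegral_const_mul' _ _ hC, mul_add]


section slice
variable {Y : Type*} [NormedAddCommGroup Y] [InnerProductSpace ℝ Y] [FiniteDimensional ℝ Y]
  [MeasurableSpace Y] [BorelSpace Y]

theorem hs_ennreal_rpow_le_neg {x y : ℝ≥0∞} {a : ℝ} (h : x ≤ y) (ha : a ≤ 0) : y ^ a ≤ x ^ a := by
  have e : ∀ w : ℝ≥0∞, w ^ a = (w ^ (-a))⁻¹ := fun w => by rw [← ENNReal.rpow_neg, neg_neg]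
  rw [e, e]
  exact ENNReal.inv_le_inv.2 (ENNReal.rpow_le_rpow h (by linarith))

theorem hs_div_rpow {x R : ℝ≥0∞} (hR0 : R ≠ 0) (hR : R ≠ ⊤) (a : ℝ) :
    x ^ a = R ^ a * (x / R) ^ a := by
  rcases eq_or_ne x ⊤ with rfl | hx
  · rw [ENNReal.top_div_of_ne_top hR]
    rcases lt_trichotomy a 0 with h | h | h
    · simp [ENNReal.top_rpow_of_neg h]
    · subst h; simp
    · have : R ^ a ≠ 0 := by simp [ENNReal.rpow_eq_zero_iff, hR0, hR]
      simp [ENNReal.top_rpow_of_pos h, ENNReal.mul_top this]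
  · rw [← ENNReal.mul_rpow_of_ne_top hR (ENNReal.div_ne_top hx hR0), ENNReal.mul_div_cancel hR0 hR]

/-- `(R+x)^(lam-n) x^(-lam) ≤ R^(-n) prof(x/R)` -/
theorem hs_weight_le_prof {R x : ℝ≥0∞} (hR0 : R ≠ 0) (hR : R ≠ ⊤) {lam n : ℝ} (h0 : 0 ≤ lam)
    (hn : lam ≤ n) (hx0 : x ≠ 0) (hx : x ≠ ⊤) :
    (R + x) ^ (lam - n) * x ^ (-lam) ≤ R ^ (-n) * hsProf lam n (x / R) := by
  unfold hsProf
  rw [mul_min, ← hs_div_rpow hR0 hR]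
  refine le_min ?_ ?_
  · calc (R + x) ^ (lam - n) * x ^ (-lam) ≤ R ^ (lam - n) * x ^ (-lam) := by
          gcongr ?_ * _; exact hs_ennreal_rpow_le_neg le_self_add (by linarith)
      _ = R ^ (lam - n) * (R ^ (-lam) * (x / R) ^ (-lam)) := by rw [← hs_div_rpow hR0 hR]
      _ = _ := by
        rw [← mul_assoc, ← ENNReal.rpow_add _ _ hR0 hR]; ring_nf
  · calc (R + x) ^ (lam - n) * x ^ (-lam) ≤ x ^ (lam - n) * x ^ (-lam) := by
          gcongr ?_ * _; exact hs_ennreal_rpow_le_neg le_add_self (by linarith)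
      _ = _ := by
        rw [← ENNReal.rpow_add _ _ hx0 hx]; ring_nf

theorem hs_ae_ne_zero [Nontrivial Y] : ∀ᵐ y : Y, y ≠ 0 := by simp [ae_iff]

theorem hs_weight_integral [Nontrivial Y] {lam : ℝ} (h0 : 0 ≤ lam) (h1 : lam < 1) :
    ∃ C : ℝ≥0∞, C ≠ ⊤ ∧ ∀ (r : ℝ) (_ : 0 < r) (y : Y),
      ∫⁻ z : Y, (ENNReal.ofReal r + ‖z - y‖ₑ) ^ (lam - (Module.finrank ℝ Y + 1)) * ‖z‖ₑ ^ (-lam)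
        ≤ C / ENNReal.ofReal r := by
  set d := Module.finrank ℝ Y with hd
  have hd1 : 1 ≤ d := Module.finrank_pos
  have hd1' : (1:ℝ) ≤ d := by exact_mod_cast hd1
  refine ⟨2 * ∫⁻ y : Y, hsProf lam (d + 1) ‖y‖ₑ, ENNReal.mul_ne_top (by simp)
    (hsProf_lintegral_ne_top (by linarith) (by linarith)), fun r hr y => ?_⟩
  set R := ENNReal.ofReal r with hRd
  have hR0 : R ≠ 0 := by simp [hRd, hr]
  have hR : R ≠ ⊤ := by simp [hRd]
  have hG : ∫⁻ z : Y, R ^ (-(d + 1 : ℝ)) * hsProf lam (d + 1) (‖z‖ₑ / R) =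
      (∫⁻ y : Y, hsProf lam (d + 1) ‖y‖ₑ) / R := by
    rw [lintegral_const_mul' _ _ (by simp [ENNReal.rpow_eq_top_iff, hR0, hR]), hsProf_scale _ _ hr,
      ← mul_assoc, div_eq_mul_inv, mul_comm _ R⁻¹, ENNReal.ofReal_pow hr.le, ← ENNReal.rpow_natCast,
      ← ENNReal.rpow_add _ _ hR0 hR, ← ENNReal.rpow_neg_one]
    congr 2; rw [← hd]; ring
  have hG' : ∫⁻ z : Y, R ^ (-(d + 1 : ℝ)) * hsProf lam (d + 1) (‖z - y‖ₑ / R) =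
      (∫⁻ y : Y, hsProf lam (d + 1) ‖y‖ₑ) / R := by
    rw [← hG]
    exact lintegral_sub_right_eq_self (fun z : Y => R ^ (-(d + 1 : ℝ)) * hsProf lam (d + 1) (‖z‖ₑ / R)) y
  calc _ ≤ ∫⁻ z : Y, (R ^ (-(d + 1 : ℝ)) * hsProf lam (d + 1) (‖z‖ₑ / R) +
        R ^ (-(d + 1 : ℝ)) * hsProf lam (d + 1) (‖z - y‖ₑ / R)) := by
        refine lintegral_mono_ae ?_
        have h2 : ∀ᵐ z : Y, z - y ≠ 0 := by
          simp [sub_eq_zero, ae_iff]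
        filter_upwards [hs_ae_ne_zero (Y := Y), h2] with z hz hzy
        rcases le_total ‖z‖ₑ ‖z - y‖ₑ with h | h
        · refine le_trans ?_ le_self_add
          refine le_trans ?_ (hs_weight_le_prof hR0 hR h0 (by linarith) (by simpa using hz) (by simp))
          gcongr ?_ * _
          exact hs_ennreal_rpow_le_neg (by gcongr) (by linarith)
        · refine le_trans ?_ le_add_self
          refine le_trans ?_ (hs_weight_le_prof hR0 hR h0 (by linarith) (by simpa using hzy) (by simp))
          gcongr _ * ?_
          exact hs_ennreal_rpow_le_neg h (by linarith)
    _ = _ := by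
        rw [lintegral_add_left, hG, hG', ← ENNReal.add_div, two_mul]
        have := hsProf_measurable lam (d + 1)
        fun_prop

/-- Hoelder in the slice. Here `1/q = (d)/(d+1-lam)`. -/
theorem hs_holder_slice [Nontrivial Y] {lam : ℝ} (h0 : 0 ≤ lam) (h1 : lam < 1) :
    ∃ C : ℝ≥0∞, C ≠ ⊤ ∧ ∀ (g : Y → ℝ≥0∞) (_ : Measurable g) (r : ℝ) (_ : 0 < r) (y : Y),
      ∫⁻ z : Y, (ENNReal.ofReal r + ‖z - y‖ₑ) ^ (-(Module.finrank ℝ Y : ℝ)) *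
          (g z * ‖z‖ₑ ^ (-(lam * (Module.finrank ℝ Y / (Module.finrank ℝ Y + 1 - lam))))) 
        ≤ C * ((∫⁻ z, g z ^ (((Module.finrank ℝ Y : ℝ) + 1 - lam) / (1 - lam))) ^ ((1 - lam) / ((Module.finrank ℝ Y : ℝ) + 1 - lam)) * ENNReal.ofReal r ^ ((1 - lam) / ((Module.finrank ℝ Y : ℝ) + 1 - lam) - 1)) := by
  obtain ⟨C, hC, hCb⟩ := hs_weight_integral (Y := Y) h0 h1
  set d := Module.finrank ℝ Y with hd
  have hd1 : 1 ≤ d := Module.finrank_pos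
  have hd1' : (1:ℝ) ≤ d := by exact_mod_cast hd1
  have hN : 0 < (d:ℝ) + 1 - lam := by linarith
  refine ⟨C ^ ((d:ℝ) / (d + 1 - lam)), ENNReal.rpow_ne_top_of_nonneg (by positivity) hC,
    fun g hg r hr y => ?_⟩
  have hpq : (((d:ℝ) + 1 - lam) / d).HolderConjugate (((d:ℝ) + 1 - lam) / (1 - lam)) := by
    rw [Real.holderConjugate_iff]
    constructor
    · rw [one_lt_div (by linarith)]; linarith
    · field_simp; ring
  have hh := ENNReal.lintegral_mul_le_Lp_mul_Lq (volume : Measure Y) hpq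
    (f := fun z => (ENNReal.ofReal r + ‖z - y‖ₑ) ^ (-(d : ℝ)) * ‖z‖ₑ ^ (-(lam * (d / (d + 1 - lam)))))
    (g := g) (by fun_prop) hg.aemeasurable
  have e1 : ∀ z : Y, ((ENNReal.ofReal r + ‖z - y‖ₑ) ^ (-(d : ℝ)) * ‖z‖ₑ ^ (-(lam * (d / (d + 1 - lam))))) ^ (((d:ℝ) + 1 - lam) / d)
      = (ENNReal.ofReal r + ‖z - y‖ₑ) ^ (lam - (d + 1)) * ‖z‖ₑ ^ (-lam) := by
    intro z
    rw [ENNReal.mul_rpow_of_nonneg _ _ (by positivity), ← ENNReal.rpow_mul, ← ENNReal.rpow_mul]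
    congr 2 <;> field_simp; ring
  simp only [Pi.mul_apply, e1] at hh
  calc _ = ∫⁻ (a : Y), (ENNReal.ofReal r + ‖a - y‖ₑ) ^ (-(d:ℝ)) * ‖a‖ₑ ^ (-(lam * (↑d / (↑d + 1 - lam)))) * g a := by
        congr 1; ext z; ring
    _ ≤ _ := hh
    _ ≤ (C / ENNReal.ofReal r) ^ (1 / (((d:ℝ) + 1 - lam) / d)) * (∫⁻ (a : Y), g a ^ ((↑d + 1 - lam) / (1 - lam))) ^ (1 / (((d:ℝ) + 1 - lam) / (1 - lam))) := by
        gcongr; exact hCb r hr y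
    _ = _ := by
        have hr0 : ENNReal.ofReal r ≠ 0 := by simp [hr]
        rw [one_div_div, one_div_div, div_eq_mul_inv, ENNReal.mul_rpow_of_nonneg _ _ (by positivity),
          ← ENNReal.rpow_neg_one, ← ENNReal.rpow_mul]
        have : -1 * ((d:ℝ) / (d + 1 - lam)) = (1 - lam) / (d + 1 - lam) - 1 := by
          field_simp; ring
        rw [this]; ring

end slice


section pv
variable {Y : Type*} [NormedAddCommGroup Y] [InnerProductSpace ℝ Y] [FiniteDimensional ℝ Y]
  [MeasurableSpace Y] [BorelSpace Y]

theorem hs_pv [Nontrivial Y] :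
    ∃ C : ℝ≥0∞, C ≠ ⊤ ∧ ∀ (h κ : Y → ℂ) (r : ℝ) (_ : 0 < r) (ζ : Y) (M : ℝ≥0∞),
      Differentiable ℝ h → Continuous κ → Integrable (fun η => h η * κ η) →
      (∀ η, ‖h η‖ₑ ≤ (ENNReal.ofReal r + ‖ζ - η‖ₑ) ^ (-((Module.finrank ℝ Y : ℝ) + 1))) →
      (∀ η, ‖fderiv ℝ h η‖ₑ ≤ (ENNReal.ofReal r + ‖ζ - η‖ₑ) ^ (-((Module.finrank ℝ Y : ℝ) + 2))) →
      (∀ η, ‖κ η‖ₑ ≤ ‖η‖ₑ ^ (-(Module.finrank ℝ Y : ℝ))) →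
      (∀ ρ > 0, ‖∫ η in Metric.ball (0:Y) ρ, κ η‖ₑ ≤ M) →
      ‖∫ η, h η * κ η‖ₑ ≤ C * (1 + M) * ((ENNReal.ofReal r)⁻¹ *
        (ENNReal.ofReal r + ‖ζ‖ₑ) ^ (-(Module.finrank ℝ Y : ℝ))) := by
  obtain ⟨C0, hC0, hC0b⟩ := hs_weight_integral (Y := Y) (lam := 0) le_rfl one_pos
  set d := Module.finrank ℝ Y with hd
  have hd1 : 1 ≤ d := Module.finrank_pos
  have hd1' : (1:ℝ) ≤ d := by exact_mod_cast hd1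
  set P := ∫⁻ y : Y, hsProf (d - 1) (d + 1) ‖y‖ₑ with hP
  have hPt : P ≠ ⊤ := hsProf_lintegral_ne_top (by linarith) (by linarith)
  refine ⟨2 ^ (d + 1) * P + 1 + 2 ^ d * C0, by finiteness, 
    fun h κ r hr ζ M hdiff hκc hkint hh hDh hκ hM => ?_⟩
  set ρ := (r + ‖ζ‖) / 2 with hρ
  have hρ0 : 0 < ρ := by positivity
  set R := ENNReal.ofReal ρ with hRd
  set S := ENNReal.ofReal r + ‖ζ‖ₑ with hSd
  have hS : S = 2 * R := by
    rw [hSd, ← ofReal_norm, ← ENNReal.ofReal_add hr.le (norm_nonneg _), hRd, hρ]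
    rw [show (2:ℝ≥0∞) = ENNReal.ofReal 2 by simp, ← ENNReal.ofReal_mul (by norm_num)]
    congr 1; ring
  have hR0 : R ≠ 0 := by simp [hRd, hρ0]
  have hR : R ≠ ⊤ := by simp [hRd]
  have hS0 : S ≠ 0 := by rw [hS]; simp [hR0]
  have hSt : S ≠ ⊤ := by rw [hS]; finiteness
  have hball : ∀ η ∈ Metric.ball (0:Y) ρ, R ≤ ENNReal.ofReal r + ‖ζ - η‖ₑ := by
    intro η hη
    rw [← ofReal_norm, ← ENNReal.ofReal_add hr.le (norm_nonneg _)]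
    refine ENNReal.ofReal_le_ofReal ?_
    have h1 : ‖ζ‖ - ‖η‖ ≤ ‖ζ - η‖ := norm_sub_norm_le _ _
    have h2 : ‖η‖ < ρ := by simpa using hη
    linarith
  have hSd1 : S ^ (-((d:ℝ) + 1)) ≤ (ENNReal.ofReal r)⁻¹ * S ^ (-(d:ℝ)) := by
    rw [neg_add, ENNReal.rpow_add _ _ hS0 hSt, mul_comm, ENNReal.rpow_neg_one]
    gcongr; exact le_self_add
  have hRpow : ∀ a : ℕ, R ^ (-(a:ℝ)) = 2 ^ a * S ^ (-(a:ℝ)) := by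
    intro a
    rw [hS, ENNReal.mul_rpow_of_ne_top (by simp) hR, ← mul_assoc, ← ENNReal.rpow_natCast,
      ← ENNReal.rpow_add _ _ (by simp) (by simp)]
    simp
  -- integrability on ball
  have hκI : IntegrableOn κ (Metric.ball 0 ρ) :=
    (hκc.continuousOn.integrableOn_compact (isCompact_closedBall 0 ρ)).mono_set Metric.ball_subset_closedBall
  have hsplit : ∫ η, h η * κ η = (∫ η in Metric.ball (0:Y) ρ, (h η - h 0) * κ η) +
      h 0 * (∫ η in Metric.ball (0:Y) ρ, κ η) + ∫ η in (Metric.ball (0:Y) ρ)ᶜ, h η * κ η := by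
    rw [← integral_add_compl measurableSet_ball hkint (s := Metric.ball (0:Y) ρ)]
    congr 1
    rw [← integral_const_mul, ← integral_add]
    · congr 1; ext η; ring
    · have := hkint.integrableOn (s := Metric.ball (0:Y) ρ) |>.sub (hκI.const_mul (h 0))
      refine this.congr (Filter.Eventually.of_forall fun η => ?_)
      simp only [Pi.sub_apply]; ring
    · exact hκI.const_mul _
  have T1 : ‖∫ η in Metric.ball (0:Y) ρ, (h η - h 0) * κ η‖ₑ ≤ R ^ (-((d:ℝ)+1)) * P := by
    refine (enorm_integral_le_lintegral_enorm _).trans ?_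
    have hpt : ∀ᵐ η : Y ∂(volume.restrict (Metric.ball (0:Y) ρ)), ‖(h η - h 0) * κ η‖ₑ ≤ 
        R ^ (-((d:ℝ)+2)) * R ^ (1 - (d:ℝ)) * hsProf (d - 1) (d + 1) (‖η‖ₑ / R) := by
      filter_upwards [ae_restrict_mem measurableSet_ball, ae_restrict_of_ae (hs_ae_ne_zero (Y := Y))] with η hη hη0
      have hDb : ∀ x ∈ Metric.ball (0:Y) ρ, ‖fderiv ℝ h x‖ ≤ ρ ^ (-((d:ℝ)+2)) := by
        intro x hx
        have h1 := (hDh x).trans (hs_ennreal_rpow_le_neg (hball x hx) (by linarith))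
        rw [hRd, ENNReal.ofReal_rpow_of_pos hρ0, ← ofReal_norm] at h1
        exact (ENNReal.ofReal_le_ofReal_iff (by positivity)).1 h1
      have hmv := (convex_ball (0:Y) ρ).norm_image_sub_le_of_norm_fderiv_le
        (fun x _ => hdiff x) hDb (Metric.mem_ball_self hρ0) hη
      rw [sub_zero] at hmv
      have hmv' : ‖h η - h 0‖ₑ ≤ R ^ (-((d:ℝ)+2)) * ‖η‖ₑ := by
        rw [hRd, ENNReal.ofReal_rpow_of_pos hρ0, ← ofReal_norm, ← ofReal_norm, ← ENNReal.ofReal_mul (by positivity)]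
        exact ENNReal.ofReal_le_ofReal hmv
      have hηe : ‖η‖ₑ ≠ 0 := by simpa using hη0
      have hx1 : ‖η‖ₑ / R ≤ 1 := by
        refine ENNReal.div_le_of_le_mul ?_
        rw [one_mul, ← ofReal_norm]
        exact ENNReal.ofReal_le_ofReal (by simpa using (Metric.mem_ball.1 hη).le)
      have hpf : hsProf (d - 1) (d + 1) (‖η‖ₑ / R) = (‖η‖ₑ / R) ^ (1 - (d:ℝ)) := by
        unfold hsProf
        rw [min_eq_left, neg_sub]
        exact ENNReal.rpow_le_rpow_of_exponent_ge hx1 (by linarith)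
      rw [hpf, mul_assoc, ← hs_div_rpow hR0 hR, enorm_mul]
      calc _ ≤ (R ^ (-((d:ℝ)+2)) * ‖η‖ₑ) * ‖η‖ₑ ^ (-(d:ℝ)) := by gcongr; exact hκ η
        _ = _ := by
          rw [sub_eq_add_neg, ENNReal.rpow_add _ _ hηe (by simp), ENNReal.rpow_one, mul_assoc]
    refine (lintegral_mono_ae hpt).trans ?_
    refine (setLIntegral_le_lintegral _ _).trans ?_
    rw [lintegral_const_mul', hsProf_scale _ _ hρ0, ← ENNReal.rpow_add _ _ hR0 hR, ENNReal.ofReal_pow hρ0.le,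
      ← ENNReal.rpow_natCast, ← mul_assoc, ← ENNReal.rpow_add _ _ hR0 hR]
    · refine le_of_eq ?_
      congr 2; rw [← hd]; ring
    · rw [← ENNReal.rpow_add _ _ hR0 hR]
      simp [ENNReal.rpow_eq_top_iff, hR0, hR]
  have T2 : ‖h 0 * (∫ η in Metric.ball (0:Y) ρ, κ η)‖ₑ ≤ S ^ (-((d:ℝ)+1)) * M := by
    rw [enorm_mul]
    gcongr
    · simpa using hh 0
    · exact hM ρ hρ0
  have T3 : ‖∫ η in (Metric.ball (0:Y) ρ)ᶜ, h η * κ η‖ₑ ≤ R ^ (-(d:ℝ)) * (C0 / ENNReal.ofReal r) := by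
    refine (enorm_integral_le_lintegral_enorm _).trans ?_
    have hpt : ∀ᵐ η : Y ∂(volume.restrict (Metric.ball (0:Y) ρ)ᶜ), ‖h η * κ η‖ₑ ≤ 
        R ^ (-(d:ℝ)) * (ENNReal.ofReal r + ‖η - ζ‖ₑ) ^ (-((d:ℝ) + 1)) := by
      filter_upwards [ae_restrict_mem measurableSet_ball.compl] with η hη
      rw [enorm_mul, mul_comm]
      gcongr
      · refine (hκ η).trans (hs_ennreal_rpow_le_neg ?_ (by linarith))
        rw [← ofReal_norm]
        exact ENNReal.ofReal_le_ofReal (by simpa using hη)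
      · have := hh η
        rwa [← enorm_neg (ζ - η), neg_sub] at this
    refine (lintegral_mono_ae hpt).trans ?_
    refine (setLIntegral_le_lintegral _ _).trans ?_
    rw [lintegral_const_mul' _ _ (by simp [ENNReal.rpow_eq_top_iff, hR0, hR])]
    gcongr
    have := hC0b r hr ζ
    simpa using this
  rw [hsplit]
  set Q := (ENNReal.ofReal r)⁻¹ * S ^ (-(d:ℝ)) with hQ
  have hd' : -((d:ℝ)+1) = -((d+1 : ℕ):ℝ) := by push_cast; ring
  calc _ ≤ R ^ (-((d:ℝ)+1)) * P + S ^ (-((d:ℝ)+1)) * M + R ^ (-(d:ℝ)) * (C0 / ENNReal.ofReal r) :=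
        (enorm_add_le _ _).trans (add_le_add ((enorm_add_le _ _).trans (add_le_add T1 T2)) T3)
    _ ≤ 2 ^ (d+1) * Q * P + Q * M + 2 ^ d * C0 * Q := by
        have e3 : R ^ (-(d:ℝ)) * (C0 / ENNReal.ofReal r) = 2 ^ d * C0 * Q := by
          rw [hRpow, hQ, div_eq_mul_inv]; ring
        have e1 : R ^ (-((d:ℝ)+1)) ≤ 2 ^ (d+1) * Q := by
          rw [hd', hRpow, ← hd']; gcongr
        rw [e3]; gcongr
    _ ≤ 2 ^ (d+1) * Q * P * (1 + M) + Q * (1 + M) + 2 ^ d * C0 * Q * (1 + M) := by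
        refine add_le_add (add_le_add ?_ ?_) ?_
        · exact le_mul_of_one_le_right' le_self_add
        · gcongr; exact le_add_self
        · exact le_mul_of_one_le_right' le_self_add
    _ = _ := by ring

end pv


/-- Kernel class: odd Schwartz functions with scale invariant bounds. -/
def HsKer {W : Type*} [NormedAddCommGroup W] [NormedSpace ℝ W] (d : ℕ) (B : ℝ≥0)
    (K : SchwartzMap W ℂ) : Prop :=
  (∀ x, K (-x) = -K x) ∧ (∀ x, ‖K x‖ₑ ≤ B * ‖x‖ₑ ^ (-(d:ℝ))) ∧
  (∀ x, ‖fderiv ℝ K x‖ₑ ≤ B * ‖x‖ₑ ^ (-((d:ℝ) + 1))) ∧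
  (∀ x, ‖fderiv ℝ (fderiv ℝ K) x‖ₑ ≤ B * ‖x‖ₑ ^ (-((d:ℝ) + 2)))

section ker
variable {Y : Type*} [NormedAddCommGroup Y] [InnerProductSpace ℝ Y] [FiniteDimensional ℝ Y]
  [MeasurableSpace Y] [BorelSpace Y]

theorem hs_mv {W : Type*} [NormedAddCommGroup W] [NormedSpace ℝ W] {f : W → ℂ}
    (hf : Differentiable ℝ f) {s : Set W} (hs : Convex ℝ s) {C : ℝ≥0∞} (hC : C ≠ ⊤)
    (hb : ∀ x ∈ s, ‖fderiv ℝ f x‖ₑ ≤ C) {x y : W} (hx : x ∈ s) (hy : y ∈ s) :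
    ‖f y - f x‖ₑ ≤ C * ‖y - x‖ₑ := by
  have := hs.norm_image_sub_le_of_norm_fderiv_le (f := f) (C := C.toReal) (fun x _ => hf x)
    (fun x hx => by
      have := ENNReal.toReal_mono hC (hb x hx)
      simpa using this) hx hy
  rw [← ofReal_norm, ← ofReal_norm (y - x)]
  refine (ENNReal.ofReal_le_ofReal this).trans ?_
  rw [ENNReal.ofReal_mul (by positivity), ENNReal.ofReal_toReal hC]

theorem hs_enorm_fst_le (p : ℝ × Y) : ‖p.1‖ₑ ≤ ‖p‖ₑ := by
  rw [← ofReal_norm, ← ofReal_norm]; exact ENNReal.ofReal_le_ofReal (norm_fst_le p)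
theorem hs_enorm_snd_le (p : ℝ × Y) : ‖p.2‖ₑ ≤ ‖p‖ₑ := by
  rw [← ofReal_norm, ← ofReal_norm]; exact ENNReal.ofReal_le_ofReal (norm_snd_le p)

theorem hs_odd_ball [Nontrivial Y] :
    ∃ C : ℝ≥0∞, C ≠ ⊤ ∧ ∀ (B : ℝ≥0) (K : SchwartzMap (ℝ × Y) ℂ), HsKer (Module.finrank ℝ Y) B K →
      ∀ (δ ρ : ℝ), ‖∫ η in Metric.ball (0:Y) ρ, K (δ, η)‖ₑ ≤ B * C := by
  set d := Module.finrank ℝ Y with hd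
  have hd1 : 1 ≤ d := Module.finrank_pos
  have hd1' : (1:ℝ) ≤ d := by exact_mod_cast hd1
  set P := ∫⁻ y : Y, hsProf 0 (d + 1) ‖y‖ₑ with hP
  have hPt : P ≠ ⊤ := hsProf_lintegral_ne_top (by linarith) (by linarith)
  refine ⟨2 * P, by finiteness, fun B K ⟨hodd, hK0, hK1, _⟩ δ ρ => ?_⟩
  have hneg : ∀ f : Y → ℂ, ∫ η in Metric.ball (0:Y) ρ, f (-η) = ∫ η in Metric.ball (0:Y) ρ, f η := by
    intro f
    rw [← integral_indicator measurableSet_ball, ← integral_indicator measurableSet_ball]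
    rw [← integral_neg_eq_self (fun x => Set.indicator (Metric.ball (0:Y) ρ) f x)]
    congr 1; ext η
    by_cases h : η ∈ Metric.ball (0:Y) ρ
    · have h' : -η ∈ Metric.ball (0:Y) ρ := by simpa using h
      rw [Set.indicator_of_mem h, Set.indicator_of_mem h']
    · have h' : -η ∉ Metric.ball (0:Y) ρ := by simpa using h
      rw [Set.indicator_of_notMem h, Set.indicator_of_notMem h']
  have hI : ∀ δ : ℝ, IntegrableOn (fun η : Y => K (δ, η)) (Metric.ball 0 ρ) := fun δ =>
    ((K.continuous.comp (by fun_prop : Continuous fun η : Y => (δ, η))).continuousOn.integrableOn_compact (isCompact_closedBall 0 ρ)).mono_set Metric.ball_subset_closedBall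
  have h2 : (2:ℂ) * ∫ η in Metric.ball (0:Y) ρ, K (δ, η) = ∫ η in Metric.ball (0:Y) ρ, (K (δ, η) - K (-δ, η)) := by
    rw [integral_sub (hI δ) (hI (-δ)), two_mul, sub_eq_add_neg]
    congr 1
    rw [← hneg (fun η => K (-δ, η)), ← integral_neg]
    rw [← hneg (fun η => K (δ, η)), ← hneg]
    congr 1; ext η
    rw [← hodd]; simp
  have hle : ‖∫ η in Metric.ball (0:Y) ρ, K (δ, η)‖ₑ ≤ ‖(2:ℂ) * ∫ η in Metric.ball (0:Y) ρ, K (δ, η)‖ₑ := by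
    rw [enorm_mul]
    refine le_mul_of_one_le_left' ?_
    rw [← ofReal_norm]; simp
  refine hle.trans ?_
  rw [h2]
  rcases eq_or_ne δ 0 with rfl | hδ
  · simp
  set R := ‖δ‖ₑ with hR
  have hR0 : R ≠ 0 := by simpa [hR] using hδ
  have hRt : R ≠ ⊤ := by simp [hR]
  have hRof : R = ENNReal.ofReal |δ| := by rw [hR, ← ofReal_norm, Real.norm_eq_abs]
  refine (enorm_integral_le_lintegral_enorm _).trans ?_
  have hpt : ∀ᵐ η : Y, ‖K (δ, η) - K (-δ, η)‖ₑ ≤ 2 * B * R ^ (-(d:ℝ)) * hsProf 0 (d + 1) (‖η‖ₑ / R) := by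
    filter_upwards [hs_ae_ne_zero (Y := Y)] with η hη
    have hηe : ‖η‖ₑ ≠ 0 := by simpa using hη
    unfold hsProf
    rw [mul_min]
    refine le_min ?_ ?_
    · have hb : ∀ σ : ℝ, ‖σ‖ₑ = R → ‖K (σ, η)‖ₑ ≤ B * R ^ (-(d:ℝ)) := by
        intro σ hσ
        refine (hK0 _).trans ?_
        gcongr _ * ?_
        refine hs_ennreal_rpow_le_neg ?_ (by linarith)
        rw [← hσ]; exact hs_enorm_fst_le (σ, η)
      simp only [neg_zero, ENNReal.rpow_zero, mul_one]
      calc _ ≤ ‖K (δ, η)‖ₑ + ‖K (-δ, η)‖ₑ := enorm_sub_le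
        _ ≤ B * R ^ (-(d:ℝ)) + B * R ^ (-(d:ℝ)) := add_le_add (hb δ rfl) (hb (-δ) (by simp [hR]))
        _ = _ := by ring
    · have hmv := hs_mv (K.differentiable) (s := {p : ℝ × Y | p.2 = η}) (C := B * ‖η‖ₑ ^ (-((d:ℝ) + 1)))
        (by
          intro p hp q hq a b ha hb hab
          simp only [Set.mem_setOf_eq] at hp hq
          simp only [Set.mem_setOf_eq, Prod.snd_add, Prod.smul_snd, hp, hq, ← add_smul, hab, one_smul]) 
        (by simp [ENNReal.mul_eq_top, ENNReal.rpow_eq_top_iff, hηe])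
        (by
          intro p hp
          refine (hK1 p).trans ?_
          gcongr _ * ?_
          refine hs_ennreal_rpow_le_neg ?_ (by linarith)
          simp only [Set.mem_setOf_eq] at hp
          rw [← hp]; exact hs_enorm_snd_le p)
        (x := (-δ, η)) (y := (δ, η)) rfl rfl
      refine hmv.trans ?_
      have e1 : ‖((δ, η) : ℝ × Y) - (-δ, η)‖ₑ = 2 * R := by
        rw [hRof, ← ofReal_norm]
        simp only [Prod.mk_sub_mk, sub_self, sub_neg_eq_add]
        rw [Prod.norm_def]
        simp only [norm_zero, norm_nonneg, sup_of_le_left]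
        rw [← two_mul, norm_mul, ENNReal.ofReal_mul (by simp)]
        simp
      rw [e1, hs_div_rpow hR0 hRt]
      refine le_of_eq ?_
      have : R ^ (-(d:ℝ)) = R ^ (-((d:ℝ)+1)) * R := by
        nth_rewrite 3 [← ENNReal.rpow_one R]
        rw [← ENNReal.rpow_add _ _ hR0 hRt]; ring_nf
      rw [this]; ring
  refine (setLIntegral_le_lintegral _ _).trans ?_
  refine (lintegral_mono_ae hpt).trans ?_
  rw [lintegral_const_mul']
  · rw [hRof, hsProf_scale _ _ (abs_pos.2 hδ), ← hRof, ENNReal.ofReal_pow (abs_nonneg _), ← hRof, ← ENNReal.rpow_natCast, ← hd]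
    have : R ^ (-(d:ℝ)) * R ^ (d:ℝ) = 1 := by
      rw [← ENNReal.rpow_add _ _ hR0 hRt]; simp
    calc _ = 2 * B * (R ^ (-(d:ℝ)) * R ^ (d:ℝ)) * P := by ring
      _ ≤ _ := by rw [this, mul_one]; exact le_of_eq (by ring)
  · simp [ENNReal.mul_eq_top, ENNReal.rpow_eq_top_iff, hR0, hRt]

end ker


set_option linter.unusedSectionVars false
set_option linter.unusedVariables false

section bracket
variable {Y : Type*} [NormedAddCommGroup Y] [InnerProductSpace ℝ Y] [FiniteDimensional ℝ Y]
  [MeasurableSpace Y] [BorelSpace Y]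

theorem hsSl_tg (ε a : ℝ) (z : Y) : (fun y : Y => ((a, z + ε • y) : ℝ × Y)).HasTemperateGrowth := by
  have h : (fun y : Y => ((a, z + ε • y) : ℝ × Y)) =
      (fun _ => ((a, z) : ℝ × Y)) + ⇑((ContinuousLinearMap.inr ℝ ℝ Y).comp (ε • ContinuousLinearMap.id ℝ Y)) := by
    ext y <;> simp
  rw [h]
  exact (Function.HasTemperateGrowth.const _).add (ContinuousLinearMap.hasTemperateGrowth _)

theorem hsSl_up {ε : ℝ} (hε : ε ≠ 0) (a : ℝ) (z : Y) :
    ∃ (k : ℕ) (C : ℝ), ∀ y : Y, ‖y‖ ≤ C * (1 + ‖((a, z + ε • y) : ℝ × Y)‖) ^ k := by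
  refine ⟨1, |ε|⁻¹ * (1 + ‖z‖), fun y => ?_⟩
  have h1 : ‖z + ε • y‖ ≤ ‖((a, z + ε • y) : ℝ × Y)‖ := norm_snd_le (a, z + ε • y)
  have h2 : |ε| * ‖y‖ ≤ ‖z‖ + ‖z + ε • y‖ := by
    rw [← Real.norm_eq_abs, ← norm_smul]
    have e : ‖ε • y‖ = ‖(z + ε • y) - z‖ := by congr 1; abel
    rw [e, add_comm ‖z‖]; exact norm_sub_le _ _
  have hp : 0 < |ε| := abs_pos.2 hε
  rw [pow_one, mul_assoc, le_inv_mul_iff₀ hp]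
  nlinarith [norm_nonneg z, norm_nonneg ((a, z + ε • y) : ℝ × Y)]

/-- slices of Schwartz functions on `ℝ × Y`, as Schwartz functions on `Y` -/
def hsSl (K : SchwartzMap (ℝ × Y) ℂ) {ε : ℝ} (hε : ε ≠ 0) (a : ℝ) (z : Y) : SchwartzMap Y ℂ :=
  SchwartzMap.compCLM ℝ (hsSl_tg ε a z) (hsSl_up hε a z) K

theorem hsSl_apply (K : SchwartzMap (ℝ × Y) ℂ) {ε : ℝ} (hε : ε ≠ 0) (a : ℝ) (z y : Y) :
    hsSl K hε a z y = K (a, z + ε • y) := rfl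

theorem hsSl_hasFDerivAt (K : SchwartzMap (ℝ × Y) ℂ) {ε : ℝ} (hε : ε ≠ 0) (a : ℝ) (z y : Y) :
    HasFDerivAt (hsSl K hε a z) ((fderiv ℝ K (a, z + ε • y)).comp ((ContinuousLinearMap.inr ℝ ℝ Y).comp (ε • ContinuousLinearMap.id ℝ Y))) y := by
  have h1 : HasFDerivAt (fun y : Y => ((a, z + ε • y) : ℝ × Y)) ((ContinuousLinearMap.inr ℝ ℝ Y).comp (ε • ContinuousLinearMap.id ℝ Y)) y := by
    have := ((hasFDerivAt_id (𝕜 := ℝ) y).const_smul ε).const_add z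
    exact (hasFDerivAt_const a y).prodMk this |>.congr_fderiv (by ext <;> simp)
  exact (K.differentiable (a, z + ε • y)).hasFDerivAt.comp y h1

theorem hsSl_lineDeriv (K : SchwartzMap (ℝ × Y) ℂ) {ε : ℝ} (hε : ε ≠ 0) (a : ℝ) (z y τ : Y) :
    (LineDeriv.lineDerivOp τ (hsSl K hε a z) : SchwartzMap Y ℂ) y =
      ε * (hsSl (LineDeriv.lineDerivOp ((0:ℝ), τ) K) hε a z) y := by
  rw [SchwartzMap.lineDerivOp_apply_eq_fderiv, (hsSl_hasFDerivAt K hε a z y).fderiv, hsSl_apply,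
    SchwartzMap.lineDerivOp_apply_eq_fderiv]
  have : (ContinuousLinearMap.inr ℝ ℝ Y) (ε • τ) = ε • ((0:ℝ), τ) := by simp
  simp only [ContinuousLinearMap.comp_apply, smul_apply, ContinuousLinearMap.id_apply, this, map_smul]
  simp

theorem hs_prod_norm (a : ℝ) (y : Y) : ‖a‖ₑ + ‖y‖ₑ ≤ 2 * ‖((a, y) : ℝ × Y)‖ₑ := by
  rw [two_mul]; exact add_le_add (hs_enorm_fst_le (a, y)) (hs_enorm_snd_le (a, y))

theorem hs_prod_rpow (a : ℝ) (y : Y) (m : ℕ) :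
    ‖((a, y) : ℝ × Y)‖ₑ ^ (-(m:ℝ)) ≤ 2 ^ m * (‖a‖ₑ + ‖y‖ₑ) ^ (-(m:ℝ)) := by
  have h := hs_ennreal_rpow_le_neg (hs_prod_norm a y) (a := -(m:ℝ)) (by simp)
  calc ‖((a, y) : ℝ × Y)‖ₑ ^ (-(m:ℝ)) = 2 ^ m * (2 * ‖((a, y) : ℝ × Y)‖ₑ) ^ (-(m:ℝ)) := by
        rw [ENNReal.mul_rpow_of_ne_top (by simp) (by simp), ← mul_assoc, ← ENNReal.rpow_natCast,
          ← ENNReal.rpow_add _ _ (by simp) (by simp)]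
        simp
    _ ≤ _ := by gcongr

theorem hs_flip_comp_le {W Z : Type*} [NormedAddCommGroup W] [NormedSpace ℝ W] [NormedAddCommGroup Z]
    [NormedSpace ℝ Z] (F : W →L[ℝ] W →L[ℝ] ℂ) (w : W) {L : Z →L[ℝ] W} (hL : ‖L‖ ≤ 1) :
    ‖(F.flip w).comp L‖ₑ ≤ ‖F‖ₑ * ‖w‖ₑ := by
  rw [← ofReal_norm, ← ofReal_norm, ← ofReal_norm, ← ENNReal.ofReal_mul (norm_nonneg _)]
  refine ENNReal.ofReal_le_ofReal ?_
  refine (ContinuousLinearMap.opNorm_comp_le _ _).trans ?_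
  refine (mul_le_of_le_one_right (norm_nonneg _) hL).trans ?_
  refine (ContinuousLinearMap.le_opNorm _ _).trans ?_
  rw [ContinuousLinearMap.opNorm_flip]

theorem hs_bracket [Nontrivial Y] (B T : ℝ≥0) :
    ∃ C : ℝ≥0∞, C ≠ ⊤ ∧ ∀ (K K' : SchwartzMap (ℝ × Y) ℂ), HsKer (Module.finrank ℝ Y) B K →
      HsKer (Module.finrank ℝ Y) B K' → ∀ (τ : Y), ‖τ‖ₑ ≤ T → ∀ (a δ : ℝ) (ζ : Y), a ≠ 0 →
      ‖∫ η : Y, (hsSl (LineDeriv.lineDerivOp ((0:ℝ), τ) K) (neg_ne_zero.2 one_ne_zero : (-1:ℝ) ≠ 0) a ζ) η * K' (δ, η)‖ₑ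
        ≤ C * (‖a‖ₑ⁻¹ * (‖a‖ₑ + ‖ζ‖ₑ) ^ (-(Module.finrank ℝ Y : ℝ))) := by
  obtain ⟨C1, hC1, hC1b⟩ := hs_pv (Y := Y)
  obtain ⟨C2, hC2, hC2b⟩ := hs_odd_ball (Y := Y)
  set d := Module.finrank ℝ Y with hd
  have hd1 : 1 ≤ d := Module.finrank_pos
  have hd1' : (1:ℝ) ≤ d := by exact_mod_cast hd1
  set N : ℝ≥0 := B * T * 2 ^ (d + 2) + 1 with hN
  set N' : ℝ≥0 := B + 1 with hN'
  have hN0 : N ≠ 0 := by positivity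
  have hN'0 : N' ≠ 0 := by positivity
  refine ⟨N * N' * (C1 * (1 + B * C2)), by finiteness, fun K K' hK hK' τ hτ a δ ζ ha => ?_⟩
  set Hs := hsSl (LineDeriv.lineDerivOp ((0:ℝ), τ) K) (neg_ne_zero.2 one_ne_zero : (-1:ℝ) ≠ 0) a ζ with hHs
  have hrof : ENNReal.ofReal |a| = ‖a‖ₑ := by rw [← ofReal_norm, Real.norm_eq_abs]
  have hnn : ∀ (M : ℝ≥0) (w : ℂ), ‖((M:ℝ):ℂ)⁻¹ * w‖ₑ = (M:ℝ≥0∞)⁻¹ * ‖w‖ₑ ∨ M = 0 := by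
    intro M w
    rcases eq_or_ne M 0 with h | h
    · exact Or.inr h
    left
    rw [enorm_mul, enorm_inv (by simpa using h)]
    congr 2
    rw [← ofReal_norm]; simp
  have hnn' : ∀ (M : ℝ≥0) (w : ℂ), M ≠ 0 → ‖((M:ℝ):ℂ)⁻¹ * w‖ₑ = (M:ℝ≥0∞)⁻¹ * ‖w‖ₑ := fun M w h =>
    (hnn M w).resolve_right h
  have hmain := hC1b (fun η => ((N:ℝ):ℂ)⁻¹ * Hs η) (fun η => ((N':ℝ):ℂ)⁻¹ * K' (δ, η)) |a| (abs_pos.2 ha) ζ (B * C2)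
    (Hs.differentiable.const_mul _) ((K'.continuous.comp (by fun_prop)).const_smul (((N':ℝ):ℂ)⁻¹)) ?_ ?_ ?_ ?_ ?_
  · have e : ∫ η : Y, ((N:ℝ):ℂ)⁻¹ * Hs η * (((N':ℝ):ℂ)⁻¹ * K' (δ, η)) = ((N:ℝ):ℂ)⁻¹ * (((N':ℝ):ℂ)⁻¹ * ∫ η, Hs η * K' (δ, η)) := by
      rw [← integral_const_mul, ← integral_const_mul]; congr 1; ext η; ring
    rw [e, hnn' _ _ hN0, hnn' _ _ hN'0, hrof] at hmain
    calc _ = (N * (N:ℝ≥0∞)⁻¹) * (N' * (N':ℝ≥0∞)⁻¹) * ‖∫ η, Hs η * K' (δ, η)‖ₑ := by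
          rw [ENNReal.mul_inv_cancel (by simpa using hN0) (by simp),
            ENNReal.mul_inv_cancel (by simpa using hN'0) (by simp)]; simp
      _ = N * N' * ((N:ℝ≥0∞)⁻¹ * ((N':ℝ≥0∞)⁻¹ * ‖∫ η, Hs η * K' (δ, η)‖ₑ)) := by ring
      _ ≤ N * N' * (C1 * (1 + B * C2) * (‖a‖ₑ⁻¹ * (‖a‖ₑ + ‖ζ‖ₑ) ^ (-(d:ℝ)))) := by gcongr
      _ = _ := by ring
  · -- integrability
    have h1 : Integrable (fun η => Hs η * hsSl K' one_ne_zero δ 0 η) := by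
      have hc : Integrable Hs := Hs.integrable
      refine hc.mul_bdd (c := SchwartzMap.seminorm ℝ 0 0 (hsSl K' one_ne_zero δ 0)) ((hsSl K' one_ne_zero δ 0).continuous.aestronglyMeasurable) ?_
      exact Filter.Eventually.of_forall fun η => SchwartzMap.norm_le_seminorm ℝ _ _
    have h2 := (h1.const_mul (((N':ℝ):ℂ)⁻¹)).const_mul (((N:ℝ):ℂ)⁻¹)
    refine h2.congr (Filter.Eventually.of_forall fun η => ?_)
    simp only [hsSl_apply]; simp; ring
  · intro η
    rw [hnn' _ _ hN0, hrof]
    rw [ENNReal.inv_mul_le_iff (by simpa using hN0) (by simp)]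
    rw [hHs, hsSl_apply, SchwartzMap.lineDerivOp_apply_eq_fderiv]
    have e0 : ζ + (-1:ℝ) • η = ζ - η := by simp [sub_eq_add_neg]
    rw [e0]
    calc _ ≤ ‖fderiv ℝ K (a, ζ - η)‖ₑ * ‖((0:ℝ), τ)‖ₑ := ContinuousLinearMap.le_opENorm _ _
      _ ≤ (B * ‖((a, ζ - η) : ℝ × Y)‖ₑ ^ (-((d:ℝ)+1))) * T := by
          gcongr
          · exact hK.2.2.1 _
          · refine le_trans (le_of_eq ?_) hτ
            rw [← ofReal_norm, ← ofReal_norm, Prod.norm_def]; simp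
      _ ≤ (B * (2 ^ (d+1) * (‖a‖ₑ + ‖ζ - η‖ₑ) ^ (-((d:ℝ)+1)))) * T := by
          have := hs_prod_rpow a (ζ - η) (d + 1)
          push_cast at this
          gcongr
      _ = (B * T * 2 ^ (d + 1)) * (‖a‖ₑ + ‖ζ - η‖ₑ) ^ (-((d:ℝ)+1)) := by ring
      _ ≤ _ := by
          gcongr
          have : B * T * 2 ^ (d+1) ≤ N := by
            rw [hN]
            refine le_trans ?_ le_self_add
            gcongr
            · norm_num
            · norm_num
          exact_mod_cast this
  · intro η
    have hfd : fderiv ℝ (fun η => ((N:ℝ):ℂ)⁻¹ * Hs η) η = (((N:ℝ))⁻¹ : ℝ) • fderiv ℝ Hs η := by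
      have := fderiv_const_smul (Hs.differentiable η) ((N:ℝ)⁻¹)
      rw [← this]
      congr 1; ext η; simp
    rw [hfd, enorm_smul, hrof]
    have e1 : ‖((N:ℝ))⁻¹‖ₑ = (N:ℝ≥0∞)⁻¹ := by
      rw [enorm_inv (by simpa using hN0)]; congr 1; rw [← ofReal_norm]; simp
    rw [e1, ENNReal.inv_mul_le_iff (by simpa using hN0) (by simp)]
    have e0 : ζ + (-1:ℝ) • η = ζ - η := by simp [sub_eq_add_neg]
    have hHd := (hsSl_hasFDerivAt (LineDeriv.lineDerivOp ((0:ℝ), τ) K) (neg_ne_zero.2 one_ne_zero : (-1:ℝ) ≠ 0) a ζ η).fderiv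
    rw [hHs, hHd, e0]
    have hK2 : ∀ p, fderiv ℝ (LineDeriv.lineDerivOp ((0:ℝ), τ) K : SchwartzMap (ℝ × Y) ℂ) p =
        (fderiv ℝ (fderiv ℝ K) p).flip ((0:ℝ), τ) := by
      intro p
      have hd2 : DifferentiableAt ℝ (fderiv ℝ K) p := (SchwartzMap.fderivCLM ℝ (ℝ × Y) ℂ K).differentiable p
      have := (hd2.hasFDerivAt.clm_apply (hasFDerivAt_const ((0:ℝ), τ) p)).fderiv
      simp only [ContinuousLinearMap.comp_zero, zero_add] at this
      exact this
    rw [hK2]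
    have hL : ‖(ContinuousLinearMap.inr ℝ ℝ Y).comp ((-1:ℝ) • ContinuousLinearMap.id ℝ Y)‖ ≤ 1 := by
      refine ContinuousLinearMap.opNorm_le_bound _ zero_le_one fun y => ?_
      rw [Prod.norm_def]; simp
    have hen := hs_flip_comp_le (fderiv ℝ (fderiv ℝ K) (a, ζ - η)) ((0:ℝ), τ) hL
    have e2 : ‖((0:ℝ), τ)‖ₑ = ‖τ‖ₑ := by
      rw [← ofReal_norm, ← ofReal_norm, Prod.norm_def]; simp
    rw [e2] at hen
    refine hen.trans ?_
    calc _ ≤ (B * ‖((a, ζ - η) : ℝ × Y)‖ₑ ^ (-((d:ℝ)+2))) * T := by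
          gcongr
          exact hK.2.2.2 _
      _ ≤ (B * (2 ^ (d+2) * (‖a‖ₑ + ‖ζ - η‖ₑ) ^ (-((d:ℝ)+2)))) * T := by
          have := hs_prod_rpow a (ζ - η) (d + 2)
          push_cast at this
          gcongr
      _ = (B * T * 2 ^ (d + 2)) * (‖a‖ₑ + ‖ζ - η‖ₑ) ^ (-((d:ℝ)+2)) := by ring
      _ ≤ _ := by
          gcongr
          have : B * T * 2 ^ (d+2) ≤ N := by
            rw [hN]
            exact le_self_add
          exact_mod_cast this
  · intro η
    rw [hnn' _ _ hN'0, ENNReal.inv_mul_le_iff (by simpa using hN'0) (by simp)]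
    refine (hK'.2.1 _).trans ?_
    refine mul_le_mul' ?_ ?_
    · exact_mod_cast (le_self_add : B ≤ B + 1)
    · exact hs_ennreal_rpow_le_neg (hs_enorm_snd_le (δ, η)) (by linarith)
  · intro ρ _
    rw [integral_const_mul, hnn' _ _ hN'0, ENNReal.inv_mul_le_iff (by simpa using hN'0) (by simp)]
    refine (hC2b B K' hK' δ ρ).trans ?_
    refine le_mul_of_one_le_left' ?_
    exact_mod_cast (le_add_self : 1 ≤ B + 1)

end bracket


section sliceprop
universe hsu
variable {Y : Type hsu} [NormedAddCommGroup Y] [InnerProductSpace ℝ Y] [FiniteDimensional ℝ Y]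
  [MeasurableSpace Y] [BorelSpace Y]

instance hs_prod_haar : (volume : Measure (ℝ × Y)).IsAddHaarMeasure :=
  inferInstanceAs (Measure.IsAddHaarMeasure ((volume : Measure ℝ).prod (volume : Measure Y)))

theorem hs_holder_conv [Nontrivial Y] {lam : ℝ} (h0 : 0 ≤ lam) (h1 : lam < 1) :
    ∃ C : ℝ≥0∞, C ≠ ⊤ ∧ ∀ {Ω : Type hsu} [MeasurableSpace Ω] (μ : Measure Ω) [SFinite μ]
      (f : Ω → ℝ≥0∞) (_ : Measurable f) (π : Ω → Y) (_ : Measurable π)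
      (g : Y → ℝ≥0∞) (_ : Measurable g) (r : ℝ) (_ : 0 < r),
      ∫⁻ z : Y, (∫⁻ ω, f ω * (ENNReal.ofReal r + ‖z - π ω‖ₑ) ^ (-(Module.finrank ℝ Y : ℝ)) ∂μ) *
          (g z * ‖z‖ₑ ^ (-(lam * (Module.finrank ℝ Y / (Module.finrank ℝ Y + 1 - lam))))) 
        ≤ (∫⁻ ω, f ω ∂μ) * (C * ((∫⁻ z, g z ^ (((Module.finrank ℝ Y : ℝ) + 1 - lam) / (1 - lam))) ^ ((1 - lam) / ((Module.finrank ℝ Y : ℝ) + 1 - lam)) * ENNReal.ofReal r ^ ((1 - lam) / ((Module.finrank ℝ Y : ℝ) + 1 - lam) - 1))) := by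
  obtain ⟨C, hC, hCb⟩ := hs_holder_slice (Y := Y) h0 h1
  refine ⟨C, hC, ?_⟩
  intro Ω _ μ _ f hf π hπ g hg r hr
  set w : Y → ℝ≥0∞ := fun z => g z * ‖z‖ₑ ^ (-(lam * (Module.finrank ℝ Y / (Module.finrank ℝ Y + 1 - lam)))) with hw
  have hwm : Measurable w := by fun_prop
  have hker : Measurable (fun p : Y × Ω => (ENNReal.ofReal r + ‖p.1 - π p.2‖ₑ) ^ (-(Module.finrank ℝ Y : ℝ))) := by
    have : Measurable (fun p : Y × Ω => π p.2) := hπ.comp measurable_snd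
    fun_prop
  have hfm : Measurable (fun p : Y × Ω => f p.2) := hf.comp measurable_snd
  have hwm' : Measurable (fun p : Y × Ω => w p.1) := hwm.comp measurable_fst
  calc _ = ∫⁻ z : Y, ∫⁻ ω, f ω * (ENNReal.ofReal r + ‖z - π ω‖ₑ) ^ (-(Module.finrank ℝ Y : ℝ)) * w z ∂μ := by
        refine lintegral_congr fun z => ?_
        refine (lintegral_mul_const _ ?_).symm
        exact (hfm.mul hker).comp measurable_prodMk_left
    _ = ∫⁻ ω, ∫⁻ z : Y, f ω * (ENNReal.ofReal r + ‖z - π ω‖ₑ) ^ (-(Module.finrank ℝ Y : ℝ)) * w z ∂volume ∂μ := by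
        refine lintegral_lintegral_swap ?_
        exact ((hfm.mul hker).mul hwm').aemeasurable
    _ = ∫⁻ ω, f ω * ∫⁻ z : Y, (ENNReal.ofReal r + ‖z - π ω‖ₑ) ^ (-(Module.finrank ℝ Y : ℝ)) * w z ∂volume ∂μ := by
        refine lintegral_congr fun ω => ?_
        have hmm : Measurable (fun z : Y => (ENNReal.ofReal r + ‖z - π ω‖ₑ) ^ (-(Module.finrank ℝ Y : ℝ)) * w z) := by
          fun_prop
        rw [← lintegral_const_mul _ hmm]
        simp only [mul_assoc]
    _ ≤ ∫⁻ ω, f ω * (C * ((∫⁻ z, g z ^ (((Module.finrank ℝ Y : ℝ) + 1 - lam) / (1 - lam))) ^ ((1 - lam) / ((Module.finrank ℝ Y : ℝ) + 1 - lam)) * ENNReal.ofReal r ^ ((1 - lam) / ((Module.finrank ℝ Y : ℝ) + 1 - lam) - 1))) ∂μ := by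
        gcongr with ω
        exact hCb g hg r hr (π ω)
    _ = _ := lintegral_mul_const _ hf

theorem hs_schwartz_bdd {W : Type*} [NormedAddCommGroup W] [NormedSpace ℝ W] (K : SchwartzMap W ℂ) :
    ∃ c, ∀ x, ‖K x‖ ≤ c := ⟨_, fun x => SchwartzMap.norm_le_seminorm ℝ K x⟩

theorem hs_swap (G : SchwartzMap Y ℂ) (K' F : SchwartzMap (ℝ × Y) ℂ) (t : ℝ) :
    ∫ y, G y * ∫ w, K' ((t, y) - w) * F w = ∫ w : ℝ × Y, F w * ∫ y, G (y + w.2) * K' (t - w.1, y) := by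
  obtain ⟨c, hc⟩ := hs_schwartz_bdd K'
  have hI : Integrable (fun p : Y × (ℝ × Y) => (G p.1 * F p.2) * K' ((t, p.1) - p.2)) (volume.prod volume) := by
    refine (G.integrable.mul_prod F.integrable).mul_bdd (c := c) ?_ ?_
    · have hcc : Continuous (fun p : Y × (ℝ × Y) => ((t, p.1) : ℝ × Y) - p.2) := by fun_prop
      exact (K'.continuous.comp hcc).aestronglyMeasurable
    · exact Filter.Eventually.of_forall fun p => hc _
  calc _ = ∫ y, ∫ w : ℝ × Y, (G y * F w) * K' ((t, y) - w) := by
        congr 1; ext y; rw [← integral_const_mul]; congr 1; ext w; ring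
    _ = ∫ w : ℝ × Y, ∫ y, (G y * F w) * K' ((t, y) - w) := integral_integral_swap hI
    _ = _ := by
        congr 1; ext w
        rw [← integral_const_mul]
        rw [← integral_add_right_eq_self _ w.2]
        congr 1; ext y
        have : ((t, y + w.2) : ℝ × Y) - w = (t - w.1, y) := by ext <;> simp
        rw [this]; ring

theorem hs_neg_one : (-1:ℝ) ≠ 0 := neg_ne_zero.2 one_ne_zero

theorem hs_B2 [Nontrivial Y] (B T : ℝ≥0) (J P : Type) [Fintype J] [Fintype P] :
    ∃ C : ℝ≥0∞, C ≠ ⊤ ∧ ∀ (K : SchwartzMap (ℝ × Y) ℂ) (K' : J → P → SchwartzMap (ℝ × Y) ℂ)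
      (τ : J → Y) (F : P → SchwartzMap (ℝ × Y) ℂ) (u : J → SchwartzMap (ℝ × Y) ℂ)
      (φ : SchwartzMap (ℝ × Y) ℂ),
      HsKer (Module.finrank ℝ Y) B K → (∀ j p, HsKer (Module.finrank ℝ Y) B (K' j p)) →
      (∀ j, ‖τ j‖ₑ ≤ T) → (∀ j w, u j w = ∑ p, ∫ w', K' j p (w - w') * F p w') →
      (∀ w, φ w = ∑ j, (LineDeriv.lineDerivOp ((0:ℝ), τ j) (u j) : SchwartzMap (ℝ × Y) ℂ) w) →
      ∀ (a t : ℝ) (z : Y), a ≠ 0 →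
      ‖∫ y : Y, K (a, z - y) * φ (t, y)‖ₑ ≤
        C * (‖a‖ₑ⁻¹ * ∑ p, ∫⁻ w, ‖F p w‖ₑ * (‖a‖ₑ + ‖z - w.2‖ₑ) ^ (-(Module.finrank ℝ Y : ℝ))) := by
  obtain ⟨C, hC, hCb⟩ := hs_bracket (Y := Y) B T
  refine ⟨Fintype.card J * C, by finiteness, ?_⟩
  intro K K' τ F u φ hK hK' hτ hu hφ a t z ha
  set d := Module.finrank ℝ Y with hd
  set KS := hsSl K hs_neg_one a z with hKS
  let DK : J → SchwartzMap Y ℂ := fun j => hsSl (LineDeriv.lineDerivOp ((0:ℝ), τ j) K) hs_neg_one a z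
  let US : J → SchwartzMap Y ℂ := fun j => hsSl (u j) one_ne_zero t 0
  have e0 : ∀ y : Y, z + (-1:ℝ) • y = z - y := fun y => by simp [sub_eq_add_neg]
  have e1 : ∫ y : Y, K (a, z - y) * φ (t, y) = ∑ j, ∫ y, DK j y * US j y := by
    have : ∀ y, K (a, z - y) * φ (t, y) = ∑ j, KS y * (LineDeriv.lineDerivOp (τ j) (US j) : SchwartzMap Y ℂ) y := by
      intro y
      rw [hφ, Finset.mul_sum]
      refine Finset.sum_congr rfl fun j _ => ?_
      rw [hsSl_lineDeriv, hsSl_apply, hsSl_apply, e0]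
      simp
    simp_rw [this]
    rw [integral_finsetSum]
    · refine Finset.sum_congr rfl fun j _ => ?_
      rw [SchwartzMap.integral_mul_lineDerivOp_right_eq_neg_left, ← integral_neg]
      congr 1; ext y
      rw [hKS, hsSl_lineDeriv]
      simp only [DK]; push_cast; ring
    · intro j _
      obtain ⟨c, hc⟩ := hs_schwartz_bdd (LineDeriv.lineDerivOp (τ j) (US j) : SchwartzMap Y ℂ)
      exact KS.integrable.mul_bdd (c := c) (SchwartzMap.continuous _).aestronglyMeasurable (Filter.Eventually.of_forall hc)
  rw [e1]
  refine (enorm_sum_le _ _).trans ?_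
  have hj : ∀ j, ‖∫ y, DK j y * US j y‖ₑ ≤ C * (‖a‖ₑ⁻¹ * ∑ p, ∫⁻ w, ‖F p w‖ₑ * (‖a‖ₑ + ‖z - w.2‖ₑ) ^ (-(d : ℝ))) := by
    intro j
    have e2 : ∫ y, DK j y * US j y = ∑ p, ∫ w : ℝ × Y, F p w * ∫ y, DK j (y + w.2) * K' j p (t - w.1, y) := by
      have : ∀ y, DK j y * US j y = ∑ p, DK j y * ∫ w, K' j p ((t, y) - w) * F p w := by
        intro y
        have : US j y = u j (t, y) := by simp [US, hsSl_apply]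
        rw [this, hu, Finset.mul_sum]
      simp_rw [this]
      rw [integral_finsetSum]
      · exact Finset.sum_congr rfl fun p _ => hs_swap _ _ _ _
      · intro p _
        obtain ⟨c, hc⟩ := hs_schwartz_bdd (K' j p)
        refine (DK j).integrable.mul_bdd (c := c * ∫ w, ‖F p w‖) ?_ ?_
        · have : Continuous (fun y : Y => ∫ w, K' j p ((t, y) - w) * F p w) := by
            refine continuous_of_dominated (bound := fun w => c * ‖F p w‖) ?_ ?_ ?_ ?_
            · intro y
              exact (((K' j p).continuous.comp (by fun_prop)).mul (F p).continuous).aestronglyMeasurable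
            · intro y
              refine Filter.Eventually.of_forall fun w => ?_
              rw [norm_mul]; gcongr; exact hc _
            · exact (F p).integrable.norm.const_mul c
            · refine Filter.Eventually.of_forall fun w => ?_
              exact ((K' j p).continuous.comp (by fun_prop)).mul continuous_const
          exact this.aestronglyMeasurable
        · refine Filter.Eventually.of_forall fun y => ?_
          rw [← integral_const_mul]
          refine norm_integral_le_of_norm_le ((F p).integrable.norm.const_mul c) ?_
          refine Filter.Eventually.of_forall fun w => ?_
          rw [norm_mul]; gcongr; exact hc _
    rw [e2]
    refine (enorm_sum_le _ _).trans ?_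
    rw [Finset.mul_sum, Finset.mul_sum]
    refine Finset.sum_le_sum fun p _ => ?_
    refine (enorm_integral_le_lintegral_enorm _).trans ?_
    have hm : Measurable (fun w : ℝ × Y => ‖F p w‖ₑ * (‖a‖ₑ + ‖z - w.2‖ₑ) ^ (-(d : ℝ))) := by
      have := (F p).continuous.measurable
      fun_prop
    rw [← lintegral_const_mul _ hm, ← lintegral_const_mul _ (hm.const_mul _)]
    refine lintegral_mono fun w => ?_
    rw [enorm_mul]
    have hb := hCb K (K' j p) hK (hK' j p) (τ j) (hτ j) a (t - w.1) (z - w.2) ha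
    have e3 : ∀ y, DK j (y + w.2) = hsSl (LineDeriv.lineDerivOp ((0:ℝ), τ j) K) hs_neg_one a (z - w.2) y := by
      intro y
      simp only [DK, hsSl_apply]
      congr 2; simp; abel
    simp_rw [e3]
    calc _ ≤ ‖F p w‖ₑ * (C * (‖a‖ₑ⁻¹ * (‖a‖ₑ + ‖z - w.2‖ₑ) ^ (-(d:ℝ)))) := by gcongr
      _ = _ := by ring
  refine (Finset.sum_le_sum fun j _ => hj j).trans ?_
  rw [Finset.sum_const, Finset.card_univ, nsmul_eq_mul, mul_assoc]

end sliceprop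


section sliceprop2
universe hsu2
variable {Y : Type hsu2} [NormedAddCommGroup Y] [InnerProductSpace ℝ Y] [FiniteDimensional ℝ Y]
  [MeasurableSpace Y] [BorelSpace Y]

set_option maxHeartbeats 1000000 in
theorem hs_slice [Nontrivial Y] {lam : ℝ} (h0 : 0 ≤ lam) (h1 : lam < 1) (B T M : ℝ≥0)
    (J P : Type) [Fintype J] [Fintype P] :
    ∃ C : ℝ≥0∞, C ≠ ⊤ ∧ ∀ (K : SchwartzMap (ℝ × Y) ℂ) (K' : J → P → SchwartzMap (ℝ × Y) ℂ)
      (τ : J → Y) (F : P → SchwartzMap (ℝ × Y) ℂ) (u : J → SchwartzMap (ℝ × Y) ℂ)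
      (φ : SchwartzMap (ℝ × Y) ℂ),
      HsKer (Module.finrank ℝ Y) B K → (∀ j p, HsKer (Module.finrank ℝ Y) B (K' j p)) →
      (∀ j, ‖τ j‖ₑ ≤ T) → (∀ j w, u j w = ∑ p, ∫ w', K' j p (w - w') * F p w') →
      (∀ w, φ w = ∑ j, (LineDeriv.lineDerivOp ((0:ℝ), τ j) (u j) : SchwartzMap (ℝ × Y) ℂ) w) →
      (∑ p, ∫⁻ w, ‖F p w‖ₑ ≤ 1) → (∫⁻ w, ‖φ w‖ₑ ≤ M) →
      ∀ g : ℝ × Y → ℝ≥0∞, Measurable g →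
      ∫⁻ x : ℝ × Y, ‖∫ w, K (x - w) * φ w‖ₑ *
          (g x * ‖x.2‖ₑ ^ (-(lam * (Module.finrank ℝ Y / (Module.finrank ℝ Y + 1 - lam))))) ≤
        C * (1 + ∫⁻ x, g x ^ (((Module.finrank ℝ Y : ℝ) + 1 - lam) / (1 - lam))) := by
  obtain ⟨CB, hCB, hB2⟩ := hs_B2 (Y := Y) B T J P
  obtain ⟨CH, hCH, hH⟩ := hs_holder_conv (Y := Y) h0 h1
  set d := Module.finrank ℝ Y with hd
  have hd1 : 1 ≤ d := Module.finrank_pos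
  have hd1' : (1:ℝ) ≤ d := by exact_mod_cast hd1
  have hN : 0 < (d:ℝ) + 1 - lam := by linarith
  set β := (1 - lam) / ((d:ℝ) + 1 - lam) with hβ
  have hβ0 : 0 < β := by rw [hβ]; exact div_pos (by linarith) hN
  have hβ1 : β < 1 := by rw [hβ, div_lt_one hN]; linarith
  obtain ⟨C1, hC1, h1D⟩ := hs_oneD hβ0 hβ1
  set C2 : ℝ≥0∞ := (B * 2 ^ d + CB) * CH with hC2
  refine ⟨C2 * (C1 * (1 + M)), by finiteness, ?_⟩
  intro K K' τ F u φ hK hK' hτ hu hφ hF hM g hg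
  set θ := -(lam * (d / (d + 1 - lam))) with hθ
  set q' := ((d:ℝ) + 1 - lam) / (1 - lam) with hq'
  have hqβ : 1 / β = q' := by rw [hβ, hq', one_div_div]
  obtain ⟨c, hc⟩ := hs_schwartz_bdd K
  set V : ℝ → ℝ → Y → ℂ := fun s t z => ∫ y, K (s - t, z - y) * φ (t, y) with hV
  set Φ : ℝ → ℝ≥0∞ := fun s => (∫⁻ z, g (s, z) ^ q') ^ β with hΦ
  set a : ℝ → ℝ≥0∞ := fun t => ∫⁻ y, ‖φ (t, y)‖ₑ with ha
  have hφm : Measurable (fun w => ‖φ w‖ₑ) := by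
    have := φ.continuous.measurable
    fun_prop
  have hΦm : Measurable Φ := (Measurable.lintegral_prod_right' (f := fun p : ℝ × Y => g p ^ q') (by fun_prop)).pow_const β
  have ham : Measurable a := Measurable.lintegral_prod_right' hφm
  -- measurability of V
  have hVm : ∀ s, Measurable (fun p : ℝ × Y => ‖V s p.1 p.2‖ₑ) := by
    intro s
    have hcont : Continuous (fun p : (ℝ × Y) × Y => K (s - p.1.1, p.1.2 - p.2) * φ (p.1.1, p.2)) := 
      (K.continuous.comp (by fun_prop)).mul (φ.continuous.comp (by fun_prop))
    have := hcont.stronglyMeasurable.integral_prod_right' (ν := (volume : Measure Y))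
    exact this.measurable.enorm
  have hconv : ∀ s z, ‖∫ w, K ((s, z) - w) * φ w‖ₑ ≤ ∫⁻ t, ‖V s t z‖ₑ := by
    intro s z
    have hI : Integrable (fun w : ℝ × Y => K ((s, z) - w) * φ w) (volume.prod volume) := by
      have : Integrable φ (volume : Measure (ℝ × Y)) := φ.integrable
      exact this.bdd_mul (c := c) (K.continuous.comp (by fun_prop)).aestronglyMeasurable
        (Filter.Eventually.of_forall fun w => hc _)
    have := integral_prod _ hI
    have e : ∫ w, K ((s, z) - w) * φ w = ∫ t, V s t z := by
      rw [Measure.volume_eq_prod, this]; rfl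
    rw [e]; exact enorm_integral_le_lintegral_enorm _
  have hI : ∀ s t, t ≠ s → ∫⁻ z, ‖V s t z‖ₑ * (g (s, z) * ‖z‖ₑ ^ θ) ≤
      C2 * (Φ s * min (a t) (‖s - t‖ₑ⁻¹) * ‖s - t‖ₑ ^ (β - 1)) := by
    intro s t hst
    have hst' : s - t ≠ 0 := sub_ne_zero.2 (Ne.symm hst)
    have hr : 0 < |s - t| := abs_pos.2 hst'
    have hrof : ENNReal.ofReal |s - t| = ‖s - t‖ₑ := by rw [← ofReal_norm, Real.norm_eq_abs]
    have hgs : Measurable (fun z => g (s, z)) := hg.comp measurable_prodMk_left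
    have b1 : ∫⁻ z, ‖V s t z‖ₑ * (g (s, z) * ‖z‖ₑ ^ θ) ≤ C2 * (a t * (Φ s * ‖s - t‖ₑ ^ (β - 1))) := by
      have hh := hH (volume : Measure Y) (fun y => ‖φ (t, y)‖ₑ) (hφm.comp measurable_prodMk_left) id measurable_id
        (fun z => g (s, z)) hgs |s - t| hr
      rw [hrof] at hh
      calc _ ≤ ∫⁻ z, (B * 2 ^ d) * ((∫⁻ y, ‖φ (t, y)‖ₑ * (‖s - t‖ₑ + ‖z - y‖ₑ) ^ (-(d:ℝ))) * (g (s, z) * ‖z‖ₑ ^ θ)) := by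
            refine lintegral_mono fun z => ?_
            rw [← mul_assoc (_ * _ : ℝ≥0∞) (lintegral _ _)]
            refine mul_le_mul' ?_ le_rfl
            have hmm : Measurable (fun y => ‖φ (t, y)‖ₑ * (‖s - t‖ₑ + ‖z - y‖ₑ) ^ (-(d:ℝ))) := by
              have : Measurable (fun y => ‖φ (t, y)‖ₑ) := hφm.comp measurable_prodMk_left
              fun_prop
            rw [← lintegral_const_mul _ hmm]
            refine (enorm_integral_le_lintegral_enorm _).trans (lintegral_mono fun y => ?_)
            rw [enorm_mul]
            calc _ ≤ (B * (2 ^ d * (‖s - t‖ₑ + ‖z - y‖ₑ) ^ (-(d:ℝ)))) * ‖φ (t, y)‖ₑ := by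
                  gcongr
                  refine (hK.2.1 _).trans ?_
                  gcongr
                  exact hs_prod_rpow _ _ _
              _ = _ := by ring
        _ = (B * 2 ^ d) * ∫⁻ z, ((∫⁻ y, ‖φ (t, y)‖ₑ * (‖s - t‖ₑ + ‖z - y‖ₑ) ^ (-(d:ℝ))) * (g (s, z) * ‖z‖ₑ ^ θ)) := by
            rw [lintegral_const_mul' _ _ (by finiteness)]
        _ ≤ (B * 2 ^ d) * (a t * (CH * (Φ s * ‖s - t‖ₑ ^ (β - 1)))) := by
            gcongr
            exact hh
        _ = (B * 2 ^ d * CH) * (a t * (Φ s * ‖s - t‖ₑ ^ (β - 1))) := by ring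
        _ ≤ _ := by
            rw [hC2]; gcongr; exact le_self_add
    have b2 : ∫⁻ z, ‖V s t z‖ₑ * (g (s, z) * ‖z‖ₑ ^ θ) ≤ C2 * (‖s - t‖ₑ⁻¹ * (Φ s * ‖s - t‖ₑ ^ (β - 1))) := by
      have hFm : ∀ p, Measurable (fun w => ‖F p w‖ₑ) := fun p => by
        have := (F p).continuous.measurable
        fun_prop
      have hh := fun p => hH (volume : Measure (ℝ × Y)) (fun w => ‖F p w‖ₑ) (hFm p) (fun w => w.2) measurable_snd
        (fun z => g (s, z)) hgs |s - t| hr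
      rw [hrof] at hh
      have hcc : CB * ‖s - t‖ₑ⁻¹ ≠ ⊤ := by
        refine ENNReal.mul_ne_top hCB ?_
        simpa using hst'
      have hmeas : ∀ p, Measurable (fun z => (∫⁻ w, ‖F p w‖ₑ * (‖s - t‖ₑ + ‖z - w.2‖ₑ) ^ (-(d:ℝ))) * (g (s, z) * ‖z‖ₑ ^ θ)) := by
        intro p
        refine Measurable.mul ?_ (by fun_prop)
        refine Measurable.lintegral_prod_right' (f := fun q : Y × (ℝ × Y) => ‖F p q.2‖ₑ * (‖s - t‖ₑ + ‖q.1 - q.2.2‖ₑ) ^ (-(d:ℝ))) ?_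
        have h3 : Measurable (fun q : Y × (ℝ × Y) => ‖F p q.2‖ₑ) := (hFm p).comp (measurable_snd (α := Y))
        have h5 : Measurable (fun q : Y × (ℝ × Y) => (‖s - t‖ₑ + ‖q.1 - q.2.2‖ₑ) ^ (-(d:ℝ))) :=
          (measurable_const.add (measurable_fst.sub (measurable_snd.comp measurable_snd)).enorm).pow_const _
        exact h3.mul h5
      calc _ ≤ ∫⁻ z, (CB * ‖s - t‖ₑ⁻¹) * ∑ p, ((∫⁻ w, ‖F p w‖ₑ * (‖s - t‖ₑ + ‖z - w.2‖ₑ) ^ (-(d:ℝ))) * (g (s, z) * ‖z‖ₑ ^ θ)) := by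
            refine lintegral_mono fun z => ?_
            rw [← Finset.sum_mul, ← mul_assoc (_ * _ : ℝ≥0∞) (Finset.sum _ _)]
            refine mul_le_mul' ?_ le_rfl
            rw [mul_assoc CB]
            exact hB2 K K' τ F u φ hK hK' hτ hu hφ (s - t) t z hst'
        _ = (CB * ‖s - t‖ₑ⁻¹) * ∑ p, ∫⁻ z, ((∫⁻ w, ‖F p w‖ₑ * (‖s - t‖ₑ + ‖z - w.2‖ₑ) ^ (-(d:ℝ))) * (g (s, z) * ‖z‖ₑ ^ θ)) := by
            rw [lintegral_const_mul' _ _ hcc, lintegral_finsetSum _ (fun p _ => hmeas p)]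
        _ ≤ (CB * ‖s - t‖ₑ⁻¹) * ∑ p, ((∫⁻ w, ‖F p w‖ₑ) * (CH * (Φ s * ‖s - t‖ₑ ^ (β - 1)))) := by
            gcongr with p
            exact hh p
        _ ≤ (CB * ‖s - t‖ₑ⁻¹) * (1 * (CH * (Φ s * ‖s - t‖ₑ ^ (β - 1)))) := by
            rw [← Finset.sum_mul]; gcongr
        _ = (CB * CH) * (‖s - t‖ₑ⁻¹ * (Φ s * ‖s - t‖ₑ ^ (β - 1))) := by ring
        _ ≤ _ := by
            rw [hC2]; gcongr; exact le_add_self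
    rcases le_total (a t) (‖s - t‖ₑ⁻¹) with h | h
    · rw [min_eq_left h]; refine b1.trans (le_of_eq (by ring))
    · rw [min_eq_right h]; refine b2.trans (le_of_eq (by ring))
  have hC2t : C2 ≠ ⊤ := by finiteness
  clear_value V a Φ
  have hVz : ∀ s z, Measurable (fun t => ‖V s t z‖ₑ) := fun s z =>
    (hVm s).comp (measurable_prodMk_right : Measurable fun t : ℝ => (t, z))
  have hVsw : ∀ s, Measurable (fun p : Y × ℝ => ‖V s p.2 p.1‖ₑ) := fun s =>
    (hVm s).comp (measurable_swap : Measurable (Prod.swap : Y × ℝ → ℝ × Y))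
  calc _ = ∫⁻ s, ∫⁻ z, ‖∫ w, K ((s, z) - w) * φ w‖ₑ * (g (s, z) * ‖z‖ₑ ^ θ) := by
        rw [Measure.volume_eq_prod, lintegral_prod]
        refine AEMeasurable.mul ?_ (by fun_prop)
        have hcont : Continuous (fun p : (ℝ × Y) × (ℝ × Y) => K (p.1 - p.2) * φ p.2) := 
          (K.continuous.comp (by fun_prop)).mul (φ.continuous.comp (by fun_prop))
        have := hcont.stronglyMeasurable.integral_prod_right' (ν := (volume : Measure (ℝ × Y)))
        exact this.measurable.enorm.aemeasurable
    _ ≤ ∫⁻ s, ∫⁻ z, ∫⁻ t, ‖V s t z‖ₑ * (g (s, z) * ‖z‖ₑ ^ θ) := by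
        refine lintegral_mono fun s => lintegral_mono fun z => ?_
        have hm1 : Measurable (fun t => ‖V s t z‖ₑ) := hVz s z
        rw [lintegral_mul_const _ hm1]
        exact mul_le_mul' (hconv s z) le_rfl
    _ = ∫⁻ s, ∫⁻ t, ∫⁻ z, ‖V s t z‖ₑ * (g (s, z) * ‖z‖ₑ ^ θ) := by
        refine lintegral_congr fun s => ?_
        refine lintegral_lintegral_swap ?_
        have h4 : Measurable (fun p : Y × ℝ => ‖V s p.2 p.1‖ₑ) := hVsw s
        have hgs : Measurable (fun p : Y × ℝ => g (s, p.1)) := hg.comp (measurable_const.prodMk measurable_fst)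
        have h6 : Measurable (fun p : Y × ℝ => ‖p.1‖ₑ ^ θ) := measurable_fst.enorm.pow_const _
        exact (h4.mul (hgs.mul h6)).aemeasurable
    _ ≤ ∫⁻ s, ∫⁻ t, C2 * (Φ s * min (a t) (‖s - t‖ₑ⁻¹) * ‖s - t‖ₑ ^ (β - 1)) := by
        refine lintegral_mono fun s => lintegral_mono_ae ?_
        have : ∀ᵐ t : ℝ, t ≠ s := by simp [ae_iff]
        filter_upwards [this] with t ht
        exact hI s t ht
    _ = C2 * ∫⁻ s, ∫⁻ t, (Φ s * min (a t) (‖s - t‖ₑ⁻¹) * ‖s - t‖ₑ ^ (β - 1)) := by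
        rw [← lintegral_const_mul' _ _ hC2t]
        refine lintegral_congr fun s => ?_
        rw [lintegral_const_mul' _ _ hC2t]
    _ ≤ C2 * (C1 * ((∫⁻ s, Φ s ^ (1 / β)) + ∫⁻ t, a t)) := by
        gcongr; exact h1D Φ a hΦm ham
    _ ≤ C2 * (C1 * ((∫⁻ x, g x ^ q') + M)) := by
        gcongr
        · rw [Measure.volume_eq_prod, lintegral_prod _ (by fun_prop)]
          refine le_of_eq (lintegral_congr fun s => ?_)
          rw [hΦ]
          simp only []
          rw [← ENNReal.rpow_mul, mul_one_div_cancel hβ0.ne', ENNReal.rpow_one]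
        · refine le_trans (le_of_eq ?_) hM
          rw [ha, Measure.volume_eq_prod, lintegral_prod _ hφm.aemeasurable]
    _ ≤ _ := by
        set G := ∫⁻ x, g x ^ q'
        have hG : G + M ≤ (1 + M) * (1 + G) := by
          calc G + M ≤ (1 + M) * G + (1 + M) * 1 := by
                refine add_le_add ?_ ?_
                · exact le_mul_of_one_le_left' le_self_add
                · rw [mul_one]; exact le_add_self
            _ = _ := by ring
        calc C2 * (C1 * (G + M)) ≤ C2 * (C1 * ((1 + M) * (1 + G))) :=
              mul_le_mul' le_rfl (mul_le_mul' le_rfl hG)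
          _ = _ := by ring

end sliceprop2


section dyadic

theorem hs_geom_int : ∑' i : ℤ, min ((2:ℝ≥0∞) ^ i) (((2:ℝ≥0∞) ^ i)⁻¹) ≠ ⊤ := by
  rw [tsum_of_nat_of_neg_add_one ENNReal.summable ENNReal.summable]
  have h1 : ∑' n : ℕ, min ((2:ℝ≥0∞) ^ (n:ℤ)) (((2:ℝ≥0∞) ^ (n:ℤ))⁻¹) ≤ ∑' n : ℕ, (2⁻¹ : ℝ≥0∞) ^ n := by
    refine ENNReal.tsum_le_tsum fun n => (min_le_right _ _).trans (le_of_eq ?_)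
    rw [zpow_natCast, ENNReal.inv_pow]
  have h2 : ∑' n : ℕ, min ((2:ℝ≥0∞) ^ (-((n:ℤ) + 1))) (((2:ℝ≥0∞) ^ (-((n:ℤ) + 1)))⁻¹) ≤ ∑' n : ℕ, (2⁻¹ : ℝ≥0∞) ^ n := by
    refine ENNReal.tsum_le_tsum fun n => (min_le_left _ _).trans ?_
    rw [← Nat.cast_succ, ENNReal.zpow_neg, zpow_natCast, ENNReal.inv_pow]
    exact pow_le_pow_right_of_le_one' (ENNReal.inv_le_one.2 one_le_two) (Nat.le_succ n)
  have h3 : ∑' n : ℕ, (2⁻¹ : ℝ≥0∞) ^ n ≠ ⊤ := by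
    rw [ENNReal.tsum_geometric]; simp
  exact ENNReal.add_ne_top.2 ⟨ne_top_of_le_ne_top h3 h1, ne_top_of_le_ne_top h3 h2⟩

theorem hs_dyadic : ∃ C : ℝ≥0, ∀ t : ℝ≥0∞, t ≠ 0 → t ≠ ⊤ →
    ∑' j : ℤ, min ((2:ℝ≥0∞) ^ j * t) (((2:ℝ≥0∞) ^ j * t)⁻¹) ≤ C := by
  refine ⟨(2 * ∑' i : ℤ, min ((2:ℝ≥0∞) ^ i) (((2:ℝ≥0∞) ^ i)⁻¹)).toNNReal, fun t h0 ht => ?_⟩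
  rw [ENNReal.coe_toNNReal (ENNReal.mul_ne_top (by simp) hs_geom_int)]
  obtain ⟨n, hn1, hn2⟩ := ENNReal.exists_mem_Ico_zpow h0 ht (y := 2) (by simp) (by simp)
  have h2 : (2:ℝ≥0∞) ≠ 0 := by simp
  have h2t : (2:ℝ≥0∞) ≠ ⊤ := by simp
  rw [← ENNReal.tsum_mul_left]
  rw [← (Equiv.addRight n).tsum_eq (fun i : ℤ => 2 * min ((2:ℝ≥0∞) ^ i) (((2:ℝ≥0∞) ^ i)⁻¹))]
  refine ENNReal.tsum_le_tsum fun j => ?_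
  simp only [Equiv.coe_addRight]
  rw [mul_min]
  refine min_le_min ?_ ?_
  · calc (2:ℝ≥0∞) ^ j * t ≤ 2 ^ j * 2 ^ (n + 1) := by gcongr
      _ = 2 * 2 ^ (j + n) := by
        rw [ENNReal.zpow_add h2 h2t, ENNReal.zpow_add h2 h2t]; simp; ring
  · calc ((2:ℝ≥0∞) ^ j * t)⁻¹ ≤ (2 ^ j * 2 ^ n)⁻¹ := by gcongr
      _ = (2 ^ (j + n))⁻¹ := by rw [ENNReal.zpow_add h2 h2t]
      _ ≤ _ := le_mul_of_one_le_left' (by simp)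

theorem hs_enorm_two_zpow (j : ℤ) : ‖(2:ℝ) ^ j‖ₑ = (2:ℝ≥0∞) ^ j := by
  rw [enorm_eq_nnnorm, nnnorm_zpow, ENNReal.coe_zpow (by simp)]; simp

theorem hs_two_zpow_mul (j : ℤ) (a : ℕ) : (2:ℝ≥0∞) ^ (j * a) = ((2:ℝ≥0∞) ^ j) ^ a := by
  rw [← hs_enorm_two_zpow, ← hs_enorm_two_zpow, ← enorm_pow, zpow_mul, zpow_natCast]

theorem hs_dyadic_sum : ∃ C : ℝ≥0, ∀ {X G : Type} [NormedAddCommGroup X] [NormedSpace ℝ X]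
    [NormedAddCommGroup G] (h : X → G) (a : ℕ) (_ : 1 ≤ a) (D : ℝ≥0∞) (_ : ∀ x, ‖h x‖ₑ ≤ D)
    (_ : ∀ x, ‖x‖ₑ ^ (a + 1) * ‖h x‖ₑ ≤ D) (S : Finset ℤ) (x : X) (_ : x ≠ 0),
    ∑ j ∈ S, (2:ℝ≥0∞) ^ (j * a) * ‖h ((2:ℝ) ^ j • x)‖ₑ ≤ C * D * ‖x‖ₑ ^ (-(a:ℝ)) := by
  obtain ⟨C, hC⟩ := hs_dyadic
  refine ⟨C, ?_⟩
  intro X G _ _ _ h a ha D h1 h2 S x hx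
  have hx0 : ‖x‖ₑ ≠ 0 := by simpa using hx
  have hxt : ‖x‖ₑ ≠ ⊤ := by simp
  calc _ ≤ ∑ j ∈ S, (D * ‖x‖ₑ ^ (-(a:ℝ))) * min ((2:ℝ≥0∞) ^ j * ‖x‖ₑ) (((2:ℝ≥0∞) ^ j * ‖x‖ₑ)⁻¹) := by
        refine Finset.sum_le_sum fun j _ => ?_
        set t := (2:ℝ≥0∞) ^ j * ‖x‖ₑ with ht
        have hn : ‖(2:ℝ) ^ j • x‖ₑ = t := by
          rw [enorm_smul, ht]
          congr 1
          exact hs_enorm_two_zpow j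
        have h2j0 : (2:ℝ≥0∞) ^ j ≠ 0 := (ENNReal.zpow_pos (by simp) (by simp) j).ne'
        have h2jt : (2:ℝ≥0∞) ^ j ≠ ⊤ := (ENNReal.zpow_lt_top (by simp) (by simp) j).ne
        have ht0 : t ≠ 0 := mul_ne_zero h2j0 hx0
        have htt : t ≠ ⊤ := ENNReal.mul_ne_top h2jt hxt
        have e1 : (2:ℝ≥0∞) ^ (j * a) = t ^ a * ‖x‖ₑ ^ (-(a:ℝ)) := by
          rw [ht, mul_pow, mul_assoc, ENNReal.rpow_neg, ENNReal.rpow_natCast, 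
            ENNReal.mul_inv_cancel (pow_ne_zero _ hx0) (ENNReal.pow_ne_top hxt), mul_one, hs_two_zpow_mul]
        have k1 := h1 ((2:ℝ) ^ j • x)
        have k2 := h2 ((2:ℝ) ^ j • x)
        rw [hn] at k2
        set w := ‖h ((2:ℝ) ^ j • x)‖ₑ
        have key : t ^ a * w ≤ D * min t t⁻¹ := by
          have kk : t ^ a * w ≤ D * t⁻¹ := by
            calc t ^ a * w = (t ^ (a + 1) * w) * t⁻¹ := by
                  calc _ = t ^ a * w * (t * t⁻¹) := by rw [ENNReal.mul_inv_cancel ht0 htt, mul_one]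
                    _ = _ := by ring
              _ ≤ _ := by gcongr
          rcases le_total t 1 with h | h
          · have : t ≤ t⁻¹ := h.trans (ENNReal.one_le_inv.2 h)
            rw [min_eq_left this, mul_comm]
            exact mul_le_mul' k1 (by simpa using pow_le_pow_right_of_le_one' h ha)
          · have : t⁻¹ ≤ t := (ENNReal.inv_le_one.2 h).trans h
            rw [min_eq_right this]; exact kk
        calc _ = (t ^ a * w) * ‖x‖ₑ ^ (-(a:ℝ)) := by rw [e1]; ring
          _ ≤ (D * min t t⁻¹) * ‖x‖ₑ ^ (-(a:ℝ)) := by gcongr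
          _ = _ := by ring
    _ = (D * ‖x‖ₑ ^ (-(a:ℝ))) * ∑ j ∈ S, min ((2:ℝ≥0∞) ^ j * ‖x‖ₑ) (((2:ℝ≥0∞) ^ j * ‖x‖ₑ)⁻¹) := by
        rw [Finset.mul_sum]
    _ ≤ (D * ‖x‖ₑ ^ (-(a:ℝ))) * C := by
        gcongr
        exact (ENNReal.sum_le_tsum S).trans (hC _ hx0 hxt)
    _ = _ := by ring

end dyadic


section fourierhelpers
open FourierTransform LineDeriv
variable {X : Type} [NormedAddCommGroup X] [InnerProductSpace ℝ X] [FiniteDimensional ℝ X]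
  [MeasurableSpace X] [BorelSpace X]

/-- Dilation of a Schwartz function. -/
def hsDil (c : ℝˣ) (f : SchwartzMap X ℂ) : SchwartzMap X ℂ :=
  SchwartzMap.compCLMOfContinuousLinearEquiv ℂ (ContinuousLinearEquiv.smulLeft (R₁ := ℝ) (M₁ := X) c) f

theorem hsDil_apply (c : ℝˣ) (f : SchwartzMap X ℂ) (x : X) : hsDil c f x = f ((c:ℝ) • x) := by
  simp [hsDil, SchwartzMap.compCLMOfContinuousLinearEquiv_apply, Units.smul_def]

theorem hsDil_fourier (c : ℝˣ) (f : SchwartzMap X ℂ) (ξ : X) :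
    𝓕 (hsDil c f) ξ = ((|((c:ℝ) ^ Module.finrank ℝ X)⁻¹| : ℝ) : ℂ) * 𝓕 f ((c:ℝ)⁻¹ • ξ) := by
  rw [SchwartzMap.fourier_coe, SchwartzMap.fourier_coe, Real.fourier_eq, Real.fourier_eq]
  have := Measure.integral_comp_smul (volume : Measure X)
    (fun v => Real.fourierChar (-inner ℝ v ((c:ℝ)⁻¹ • ξ)) • f v) (c:ℝ)
  rw [Complex.real_smul] at this
  rw [← this]
  congr 1
  ext v
  rw [hsDil_apply, inner_smul_left, inner_smul_right]
  simp

theorem hs_fourier_lineDeriv (f : SchwartzMap X ℂ) (m ξ : X) :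
    𝓕 (∂_{m} f : SchwartzMap X ℂ) ξ = (2 * Real.pi * Complex.I) * ((inner ℝ ξ m : ℝ) : ℂ) * 𝓕 f ξ := by
  rw [SchwartzMap.fourier_lineDerivOp_eq]
  rw [SchwartzMap.smul_apply, SchwartzMap.smulLeftCLM_apply_apply (by fun_prop)]
  simp [mul_assoc]

theorem hs_fourier_iter {r : ℕ} (m : Fin r → X) (f : SchwartzMap X ℂ) (ξ : X) :
    𝓕 (∂^{m} f : SchwartzMap X ℂ) ξ =
      (2 * Real.pi * Complex.I) ^ r * (∏ l, ((inner ℝ ξ (m l) : ℝ) : ℂ)) * 𝓕 f ξ := by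
  induction r with
  | zero => simp
  | succ r ih =>
    rw [iteratedLineDerivOp_succ_left, hs_fourier_lineDeriv, ih, Fin.prod_univ_succ]
    simp only [Fin.tail]
    ring

/-- Convolution of Schwartz functions. -/
def hsConv (K F : SchwartzMap X ℂ) : SchwartzMap X ℂ :=
  SchwartzMap.convolution (ContinuousLinearMap.mul ℂ ℂ) F K

theorem hsConv_apply (K F : SchwartzMap X ℂ) (x : X) : hsConv K F x = ∫ w, K (x - w) * F w := by
  rw [hsConv, SchwartzMap.convolution_apply, convolution_def]
  simp [mul_comm]

theorem hsConv_fourier (K F : SchwartzMap X ℂ) (ξ : X) : 𝓕 (hsConv K F) ξ = 𝓕 K ξ * 𝓕 F ξ := by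
  rw [hsConv, SchwartzMap.fourier_convolution]
  simp [mul_comm]

theorem hs_fourier_inj {f g : SchwartzMap X ℂ} (h : ∀ ξ, 𝓕 f ξ = 𝓕 g ξ) : f = g := by
  have : 𝓕 f = 𝓕 g := SchwartzMap.ext h
  have h2 := congrArg (fun h => (𝓕⁻ h : SchwartzMap X ℂ)) this
  simpa using h2

end fourierhelpers


section kernels
open FourierTransform LineDeriv
variable {X : Type} [NormedAddCommGroup X] [InnerProductSpace ℝ X] [FiniteDimensional ℝ X]
  [MeasurableSpace X] [BorelSpace X]

/-- Multipliers: smooth off the origin, homogeneous of degree `-1` and odd. -/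
def HsMul (μ : X → ℂ) : Prop :=
  (∀ ξ, ξ ≠ 0 → ContDiffAt ℝ (⊤ : ℕ∞) μ ξ) ∧ ∀ (c : ℝ) (ξ : X), c ≠ 0 → ξ ≠ 0 → μ (c • ξ) = (c:ℂ)⁻¹ * μ ξ

/-- The low frequency bump. -/
def hsBump (X : Type) [NormedAddCommGroup X] [InnerProductSpace ℝ X] : ContDiffBump (0 : X) :=
  ⟨1, 2, one_pos, one_lt_two⟩

/-- The annular bump. -/
def hsTh (ξ : X) : ℝ := hsBump X ((2:ℝ)⁻¹ • ξ) - hsBump X ξ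

/-- The sum of dyadic annular bumps. -/
def hsTheta (J : ℕ) (ξ : X) : ℝ := ∑ j ∈ Finset.Icc (-(J:ℤ)) J, hsTh (((2:ℝ) ^ j)⁻¹ • ξ)

theorem hsBump_neg (ξ : X) : hsBump X (-ξ) = hsBump X ξ := by
  have := (hsBump X).sub ξ
  simpa using this

theorem hsBump_one {ξ : X} (h : ‖ξ‖ ≤ 1) : hsBump X ξ = 1 :=
  (hsBump X).one_of_mem_closedBall (by simpa [hsBump] using h)

theorem hsBump_zero {ξ : X} (h : 2 ≤ ‖ξ‖) : hsBump X ξ = 0 :=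
  (hsBump X).zero_of_le_dist (by simpa [hsBump] using h)

theorem hsBump_contDiff : ContDiff ℝ (⊤ : ℕ∞) (hsBump X) := (hsBump X).contDiff

theorem hsTh_neg (ξ : X) : hsTh (-ξ) = hsTh ξ := by
  simp [hsTh, hsBump_neg]

theorem hsTh_zero_near {ξ : X} (h : ‖ξ‖ ≤ 1) : hsTh ξ = 0 := by
  rw [hsTh, hsBump_one h, hsBump_one, sub_self]
  rw [norm_smul]; norm_num; linarith

theorem hsTh_zero_far {ξ : X} (h : 4 ≤ ‖ξ‖) : hsTh ξ = 0 := by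
  have h2 : 2 ≤ ‖(2:ℝ)⁻¹ • ξ‖ := by
    rw [norm_smul]; norm_num; linarith
  rw [hsTh, hsBump_zero h2, hsBump_zero (show 2 ≤ ‖ξ‖ by linarith), sub_self]

theorem hsTh_contDiff : ContDiff ℝ (⊤ : ℕ∞) (hsTh : X → ℝ) := by
  unfold hsTh
  exact (hsBump_contDiff.comp (contDiff_const_smul _)).sub hsBump_contDiff

theorem hsTheta_eq (J : ℕ) (ξ : X) :
    hsTheta J ξ = hsBump X (((2:ℝ) ^ (J + 1))⁻¹ • ξ) - hsBump X ((2:ℝ) ^ J • ξ) := by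
  induction J with
  | zero => simp [hsTheta, hsTh]
  | succ J ih =>
    have e : Finset.Icc (-((J + 1 : ℕ):ℤ)) (J + 1 : ℕ) =
        insert (-((J:ℤ) + 1)) (insert ((J:ℤ) + 1) (Finset.Icc (-(J:ℤ)) J)) := by
      ext x; simp only [Finset.mem_Icc, Finset.mem_insert]; push_cast; omega
    rw [hsTheta, e, Finset.sum_insert, Finset.sum_insert]
    · change _ + (_ + hsTheta J ξ) = _
      rw [ih, hsTh, hsTh]
      simp only [smul_smul]
      have e1 : (2:ℝ)⁻¹ * ((2:ℝ) ^ (-((J:ℤ) + 1)))⁻¹ = 2 ^ J := by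
        rw [zpow_neg, inv_inv, zpow_add₀ two_ne_zero]; simp; ring
      have e2 : ((2:ℝ) ^ (-((J:ℤ) + 1)))⁻¹ = 2 ^ (J + 1) := by
        rw [zpow_neg, inv_inv, ← Nat.cast_succ, zpow_natCast]
      have e3 : (2:ℝ)⁻¹ * ((2:ℝ) ^ (((J:ℤ) + 1)))⁻¹ = (2 ^ (J + 1 + 1))⁻¹ := by
        rw [← Nat.cast_succ, zpow_natCast, ← mul_inv, pow_succ (n := J + 1), mul_comm]
      have e4 : ((2:ℝ) ^ (((J:ℤ) + 1)))⁻¹ = (2 ^ (J + 1))⁻¹ := by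
        rw [← Nat.cast_succ, zpow_natCast]
      rw [e1, e2, e3, e4]; ring
    · simp
    · simp only [Finset.mem_Icc, Finset.mem_insert]; omega

theorem hs_schwartz_decay {G : Type} [NormedAddCommGroup G] [NormedSpace ℝ G] (f : SchwartzMap X G) (a : ℕ) :
    ∃ D : ℝ≥0, (∀ x, ‖f x‖ₑ ≤ D) ∧ ∀ x, ‖x‖ₑ ^ a * ‖f x‖ₑ ≤ D := by
  obtain ⟨C1, h1, hC1⟩ := f.decay 0 0
  obtain ⟨C2, h2, hC2⟩ := f.decay a 0
  refine ⟨(max C1 C2).toNNReal, fun x => ?_, fun x => ?_⟩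
  · have := hC1 x
    simp at this
    rw [← ofReal_norm]
    exact ENNReal.ofReal_le_ofReal (this.trans (le_max_left _ _))
  · have := hC2 x
    simp at this
    rw [← ofReal_norm, ← ofReal_norm, ← ENNReal.ofReal_pow (norm_nonneg _), ← ENNReal.ofReal_mul (by positivity)]
    exact ENNReal.ofReal_le_ofReal (this.trans (le_max_right _ _))

theorem hs_kerpiece {μ : X → ℂ} (hμ : HsMul μ) :
    ∃ κ : SchwartzMap X ℂ, (∀ x, κ (-x) = -κ x) ∧ ∀ ξ, 𝓕 κ ξ = hsTh ξ * μ ξ := by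
  have hsm : ContDiff ℝ (⊤ : ℕ∞) (fun ξ : X => (hsTh ξ : ℂ) * μ ξ) := by
    rw [contDiff_iff_contDiffAt]
    intro ξ
    by_cases h : ξ = 0
    · have : (fun ξ : X => (hsTh ξ : ℂ) * μ ξ) =ᶠ[nhds ξ] fun _ => 0 := by
        subst h
        filter_upwards [Metric.ball_mem_nhds (0:X) one_pos] with x hx
        rw [hsTh_zero_near (by simpa using (Metric.mem_ball.1 hx).le)]; simp
      exact contDiffAt_const.congr_of_eventuallyEq this
    · exact (Complex.ofRealCLM.contDiff.comp hsTh_contDiff).contDiffAt.mul (hμ.1 ξ h)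
  have hcs : HasCompactSupport (fun ξ : X => (hsTh ξ : ℂ) * μ ξ) := by
    refine HasCompactSupport.intro (isCompact_closedBall (0:X) 4) fun x hx => ?_
    rw [hsTh_zero_far]; · simp
    simp at hx; exact hx.le
  set g : SchwartzMap X ℂ := hcs.toSchwartzMap hsm with hg
  have hga : ∀ ξ, g ξ = hsTh ξ * μ ξ := fun ξ => rfl
  have hodd : (fun ξ => g (-ξ)) = fun ξ => - g ξ := by
    ext ξ
    rw [hga, hga, hsTh_neg]
    by_cases h : ξ = 0
    · subst h; rw [hsTh_zero_near (by simp)]; simp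
    · have := hμ.2 (-1) ξ (by norm_num) h
      rw [neg_one_smul] at this
      rw [this]; push_cast; ring
  refine ⟨𝓕⁻ g, fun x => ?_, fun ξ => ?_⟩
  · rw [SchwartzMap.fourierInv_coe]
    have h1 : 𝓕⁻ (g : X → ℂ) (-x) = 𝓕 (g : X → ℂ) x := by
      rw [Real.fourierInv_eq_fourier_neg, neg_neg]
    have h2 : 𝓕⁻ (g : X → ℂ) x = 𝓕 (fun ξ => g (-ξ)) x := by
      rw [Real.fourierInv_eq_fourier_comp_neg]
    rw [h1, h2, hodd, Real.fourier_eq, Real.fourier_eq, ← integral_neg]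
    congr 1
    ext v
    rw [smul_neg, neg_neg]
  · rw [FourierTransform.fourier_fourierInv_eq, hga]

end kernels


section kernels2
open FourierTransform LineDeriv
variable {X : Type} [NormedAddCommGroup X] [InnerProductSpace ℝ X] [FiniteDimensional ℝ X]
  [MeasurableSpace X] [BorelSpace X]

/-- Dyadic sum of dilates. -/
def hsDS {G : Type} [NormedAddCommGroup G] [NormedSpace ℝ G] (S : Finset ℤ) (a : ℕ) (h : X → G) (x : X) : G :=
  ∑ j ∈ S, ((2:ℝ) ^ j) ^ a • h ((2:ℝ) ^ j • x)

theorem hsDS_hasFDerivAt {G : Type} [NormedAddCommGroup G] [NormedSpace ℝ G] (S : Finset ℤ) (a : ℕ)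
    {h : X → G} {h' : X → X →L[ℝ] G} (hh : ∀ x, HasFDerivAt h (h' x) x) (x : X) :
    HasFDerivAt (hsDS S a h) (hsDS S (a + 1) h' x) x := by
  unfold hsDS
  refine HasFDerivAt.fun_sum fun j _ => ?_
  have h1 : HasFDerivAt (fun x : X => (2:ℝ) ^ j • x) ((2:ℝ) ^ j • ContinuousLinearMap.id ℝ X) x :=
    (hasFDerivAt_id x).const_smul _
  have h2 := ((hh ((2:ℝ) ^ j • x)).comp x h1).const_smul (((2:ℝ) ^ j) ^ a)
  refine h2.congr_fderiv ?_
  rw [ContinuousLinearMap.comp_smul, ContinuousLinearMap.comp_id, smul_smul, pow_succ]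

theorem hsDS_bound {C : ℝ≥0} (hC : ∀ {X G : Type} [NormedAddCommGroup X] [NormedSpace ℝ X]
    [NormedAddCommGroup G] (h : X → G) (a : ℕ) (_ : 1 ≤ a) (D : ℝ≥0∞) (_ : ∀ x, ‖h x‖ₑ ≤ D)
    (_ : ∀ x, ‖x‖ₑ ^ (a + 1) * ‖h x‖ₑ ≤ D) (S : Finset ℤ) (x : X) (_ : x ≠ 0),
    ∑ j ∈ S, (2:ℝ≥0∞) ^ (j * a) * ‖h ((2:ℝ) ^ j • x)‖ₑ ≤ C * D * ‖x‖ₑ ^ (-(a:ℝ)))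
    {G : Type} [NormedAddCommGroup G] [NormedSpace ℝ G] (h : SchwartzMap X G) (a : ℕ) (ha : 1 ≤ a) :
    ∃ B : ℝ≥0, 0 < B ∧ ∀ (S : Finset ℤ) x, ‖hsDS S a h x‖ₑ ≤ B * ‖x‖ₑ ^ (-(a:ℝ)) := by
  obtain ⟨D, hD1, hD2⟩ := hs_schwartz_decay h (a + 1)
  refine ⟨C * D + 1, by positivity, fun S x => ?_⟩
  by_cases hx : x = 0
  · subst hx
    rw [enorm_zero, ENNReal.zero_rpow_of_neg (by simpa using by omega)]
    rw [ENNReal.mul_top (by positivity)]; exact le_top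
  · calc ‖hsDS S a h x‖ₑ ≤ ∑ j ∈ S, ‖((2:ℝ) ^ j) ^ a • h ((2:ℝ) ^ j • x)‖ₑ := enorm_sum_le _ _
      _ = ∑ j ∈ S, (2:ℝ≥0∞) ^ (j * a) * ‖h ((2:ℝ) ^ j • x)‖ₑ := by
          refine Finset.sum_congr rfl fun j _ => ?_
          rw [enorm_smul, enorm_pow, hs_enorm_two_zpow, hs_two_zpow_mul]
      _ ≤ C * D * ‖x‖ₑ ^ (-(a:ℝ)) := hC h a ha D hD1 hD2 S x hx
      _ ≤ _ := by
          refine mul_le_mul' ?_ le_rfl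
          push_cast; exact le_self_add

/-- The dyadic unit. -/
def hsTwo (j : ℤ) : ℝˣ := Units.mk0 ((2:ℝ) ^ j) (by positivity)

theorem hs_kernel (hn : 2 ≤ Module.finrank ℝ X) {μ : X → ℂ} (hμ : HsMul μ) :
    ∃ B : ℝ≥0, ∀ J : ℕ, ∃ K : SchwartzMap X ℂ, HsKer (Module.finrank ℝ X - 1) B K ∧
      ∀ ξ, 𝓕 K ξ = hsTheta J ξ * μ ξ := by
  obtain ⟨κ, hodd, hκ⟩ := hs_kerpiece hμ
  obtain ⟨C, hC⟩ := hs_dyadic_sum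
  set d := Module.finrank ℝ X - 1 with hd
  have hd1 : 1 ≤ d := by omega
  set κ1 := SchwartzMap.fderivCLM ℝ X ℂ κ with hκ1
  set κ2 := SchwartzMap.fderivCLM ℝ X (X →L[ℝ] ℂ) κ1 with hκ2
  obtain ⟨B0, hB0, h0⟩ := hsDS_bound hC κ d hd1
  obtain ⟨B1, hB1, h1⟩ := hsDS_bound hC κ1 (d + 1) (by omega)
  obtain ⟨B2, hB2, h2⟩ := hsDS_bound hC κ2 (d + 1 + 1) (by omega)
  refine ⟨B0 + B1 + B2, fun J => ?_⟩
  set S := Finset.Icc (-(J:ℤ)) J with hS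
  set K : SchwartzMap X ℂ := ∑ j ∈ S, (((2:ℝ) ^ j) ^ d) • hsDil (hsTwo j) κ with hK
  have hKa : (K : X → ℂ) = hsDS S d κ := by
    ext x
    rw [hK, SchwartzMap.sum_apply, hsDS]
    refine Finset.sum_congr rfl fun j _ => ?_
    rw [SchwartzMap.smul_apply, hsDil_apply]; rfl
  have hK1 : fderiv ℝ K = hsDS S (d + 1) κ1 := by
    ext1 x
    rw [hKa]
    exact (hsDS_hasFDerivAt S d (h' := κ1) (fun x => (κ.differentiableAt (x := x)).hasFDerivAt) x).fderiv
  have hK2 : fderiv ℝ (fderiv ℝ K) = hsDS S (d + 1 + 1) κ2 := by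
    ext1 x
    rw [hK1]
    exact (hsDS_hasFDerivAt S (d + 1) (h' := κ2) (fun x => (κ1.differentiableAt (x := x)).hasFDerivAt) x).fderiv
  refine ⟨K, ⟨fun x => ?_, fun x => ?_, fun x => ?_, fun x => ?_⟩, fun ξ => ?_⟩
  · rw [hKa, hsDS, hsDS, ← Finset.sum_neg_distrib]
    refine Finset.sum_congr rfl fun j _ => ?_
    rw [smul_neg, hodd, smul_neg]
  · rw [hKa]
    refine (h0 S x).trans (mul_le_mul' ?_ le_rfl)
    push_cast; rw [add_assoc]; exact le_self_add
  · rw [hK1]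
    refine (h1 S x).trans (mul_le_mul' ?_ (le_of_eq ?_))
    · push_cast; rw [add_comm (B0 : ℝ≥0∞), add_assoc]; exact le_self_add
    · push_cast; rfl
  · rw [hK2]
    refine (h2 S x).trans (mul_le_mul' ?_ (le_of_eq ?_))
    · push_cast; exact le_add_self
    · push_cast; congr 2; ring
  · have hF : 𝓕 K ξ = ∑ j ∈ S, ((((2:ℝ) ^ j) ^ d : ℝ) : ℂ) * 𝓕 (hsDil (hsTwo j) κ) ξ := by
      have : 𝓕 K = ∑ j ∈ S, ((((2:ℝ) ^ j) ^ d : ℝ) : ℂ) • 𝓕 (hsDil (hsTwo j) κ) := by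
        have e := map_sum (fourierCLM ℂ (SchwartzMap X ℂ)) (fun j => ((((2:ℝ) ^ j) ^ d : ℝ) : ℂ) • hsDil (hsTwo j) κ) S
        simp only [map_smul] at e
        exact e
      rw [this, SchwartzMap.sum_apply]
      rfl
    rw [hF, hsTheta]
    push_cast
    rw [Finset.sum_mul]
    refine Finset.sum_congr rfl fun j _ => ?_
    rw [hsDil_fourier, hκ]
    have ht : ((hsTwo j : ℝˣ) : ℝ) = 2 ^ j := rfl
    rw [ht]
    have hpos : (0:ℝ) < 2 ^ j := by positivity
    have hfr : Module.finrank ℝ X = d + 1 := by omega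
    rw [hfr, abs_of_pos (by positivity)]
    by_cases hξ : ξ = 0
    · subst hξ; rw [smul_zero, hsTh_zero_near (by simp)]; simp
    · rw [hμ.2 _ ξ (by positivity) hξ]
      have : ((2:ℂ) ^ j) ≠ 0 := zpow_ne_zero _ two_ne_zero
      push_cast
      field_simp
      ring
end kernels2


section transfer
open FourierTransform LineDeriv

theorem hsKer_comp {W W' : Type*} [NormedAddCommGroup W] [NormedSpace ℝ W] [NormedAddCommGroup W']
    [NormedSpace ℝ W'] {d : ℕ} {B : ℝ≥0} (L : W ≃L[ℝ] W') (hL : ∀ w, ‖w‖ ≤ ‖L w‖)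
    {K : SchwartzMap W' ℂ} (hK : HsKer d B K) :
    HsKer d (B * (1 + ‖(L : W →L[ℝ] W')‖₊) ^ 2) (SchwartzMap.compCLMOfContinuousLinearEquiv ℂ L K) := by
  set L' : W →L[ℝ] W' := (L : W →L[ℝ] W') with hL'
  set N : ℝ≥0 := 1 + ‖L'‖₊ with hN
  have hN1 : 1 ≤ N := le_self_add
  have hLN : ‖L'‖ₑ ≤ N := by
    rw [enorm_eq_nnnorm]; exact_mod_cast le_add_self
  have hr : ∀ (w : W) (a : ℝ), 0 ≤ a → ‖L w‖ₑ ^ (-a) ≤ ‖w‖ₑ ^ (-a) := by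
    intro w a ha
    refine hs_ennreal_rpow_le_neg ?_ (by linarith)
    rw [← ofReal_norm, ← ofReal_norm]; exact ENNReal.ofReal_le_ofReal (hL w)
  have hd0 : (0:ℝ) ≤ d := by positivity
  have e0 : ((SchwartzMap.compCLMOfContinuousLinearEquiv ℂ L K : SchwartzMap W ℂ) : W → ℂ) = fun w => K (L w) := by
    ext w; simp
  have e1 : fderiv ℝ (SchwartzMap.compCLMOfContinuousLinearEquiv ℂ L K : SchwartzMap W ℂ) =
      fun w => (fderiv ℝ K (L w)).comp L' := by
    ext1 w
    rw [e0]
    exact ((K.differentiableAt (x := L w)).hasFDerivAt.comp w L'.hasFDerivAt).fderiv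
  have e2 : ∀ w, ‖fderiv ℝ (fderiv ℝ (SchwartzMap.compCLMOfContinuousLinearEquiv ℂ L K : SchwartzMap W ℂ)) w‖ₑ ≤
      ‖fderiv ℝ (fderiv ℝ K) (L w)‖ₑ * ‖L'‖ₑ * ‖L'‖ₑ := by
    intro w
    rw [e1]
    have hd1 : DifferentiableAt ℝ (fderiv ℝ K) (L w) :=
      ((SchwartzMap.fderivCLM ℝ W' ℂ K).differentiableAt (x := L w))
    have h2 := (hd1.hasFDerivAt.comp w L'.hasFDerivAt).clm_comp (hasFDerivAt_const L' w)
    have h3 : fderiv ℝ (fun w => (fderiv ℝ K (L w)).comp L') w =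
      ((ContinuousLinearMap.compL ℝ W W' ℂ).flip L').comp ((fderiv ℝ (fderiv ℝ K) (L w)).comp L') := by
      refine HasFDerivAt.fderiv ?_
      refine HasFDerivAt.congr_fderiv h2 ?_
      ext v u
      simp
    rw [h3]
    rw [← ofReal_norm, ← ofReal_norm, ← ofReal_norm, ← ENNReal.ofReal_mul (norm_nonneg _),
      ← ENNReal.ofReal_mul (by positivity)]
    refine ENNReal.ofReal_le_ofReal ?_
    refine ContinuousLinearMap.opNorm_le_bound _ (by positivity) fun v => ?_
    simp only [ContinuousLinearMap.comp_apply, ContinuousLinearMap.flip_apply, ContinuousLinearMap.compL_apply]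
    refine (ContinuousLinearMap.opNorm_comp_le _ _).trans ?_
    calc _ ≤ (‖fderiv ℝ (fderiv ℝ K) (L w)‖ * (‖L'‖ * ‖v‖)) * ‖L'‖ := by
          gcongr
          exact (ContinuousLinearMap.le_opNorm _ _).trans (by gcongr; exact ContinuousLinearMap.le_opNorm _ _)
      _ = _ := by ring
  have hNe : (1:ℝ≥0∞) ≤ N := by exact_mod_cast hN1
  refine ⟨fun w => ?_, fun w => ?_, fun w => ?_, fun w => ?_⟩
  · rw [e0]; simp [hK.1]
  · rw [e0]
    refine (hK.2.1 _).trans (mul_le_mul' ?_ (hr w _ hd0))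
    push_cast
    exact le_mul_of_one_le_right' (one_le_pow_of_one_le' hNe 2)
  · rw [e1]
    have : ‖(fderiv ℝ K (L w)).comp L'‖ₑ ≤ ‖fderiv ℝ K (L w)‖ₑ * ‖L'‖ₑ := by
      rw [← ofReal_norm, ← ofReal_norm, ← ofReal_norm, ← ENNReal.ofReal_mul (norm_nonneg _)]
      exact ENNReal.ofReal_le_ofReal (ContinuousLinearMap.opNorm_comp_le _ _)
    refine this.trans ?_
    calc _ ≤ (B * ‖w‖ₑ ^ (-((d:ℝ) + 1))) * N := by
          refine mul_le_mul' ((hK.2.2.1 _).trans (mul_le_mul' le_rfl (hr w _ (by linarith)))) hLN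
      _ = (B * N) * ‖w‖ₑ ^ (-((d:ℝ) + 1)) := by ring
      _ ≤ _ := by
          refine mul_le_mul' ?_ le_rfl
          push_cast
          refine mul_le_mul' le_rfl ?_
          exact le_self_pow hNe (by norm_num)
  · refine (e2 w).trans ?_
    calc _ ≤ (B * ‖w‖ₑ ^ (-((d:ℝ) + 2))) * N * N := by
          refine mul_le_mul' (mul_le_mul' ((hK.2.2.2 _).trans (mul_le_mul' le_rfl (hr w _ (by linarith)))) hLN) hLN
      _ = _ := by push_cast; ring

variable {X : Type} [NormedAddCommGroup X] [InnerProductSpace ℝ X] [FiniteDimensional ℝ X]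
  [MeasurableSpace X] [BorelSpace X]

theorem hs_split (ω : X) (hω : ‖ω‖ = 1) :
    ∃ Φ : X ≃L[ℝ] ℝ × (ℝ ∙ ω)ᗮ, MeasurePreserving Φ volume volume ∧ (∀ x, ‖Φ x‖ ≤ ‖x‖) ∧
      ∀ y : (ℝ ∙ ω)ᗮ, Φ (y : X) = (0, y) := by
  set e := LinearIsometryEquiv.toSpanUnitSingleton (𝕜 := ℝ) ω hω
  set od := (ℝ ∙ ω).orthogonalDecomposition
  refine ⟨(od.toContinuousLinearEquiv.trans (WithLp.prodContinuousLinearEquiv 2 ℝ (ℝ ∙ ω) (ℝ ∙ ω)ᗮ)).trans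
    (e.symm.toContinuousLinearEquiv.prodCongr (ContinuousLinearEquiv.refl ℝ _)), ?_, ?_, ?_⟩
  · have h1 := (WithLp.volume_preserving_ofLp (ℝ ∙ ω) (ℝ ∙ ω)ᗮ).comp (od.measurePreserving)
    have h2 : MeasurePreserving (Prod.map e.symm (id : (ℝ ∙ ω)ᗮ → (ℝ ∙ ω)ᗮ)) (volume.prod volume) (volume.prod volume) :=
      e.symm.measurePreserving.prod (MeasurePreserving.id volume)
    exact h2.comp h1
  · intro x
    have h1 : ‖x‖ = ‖od x‖ := (od.norm_map x).symm
    have h2 := WithLp.prod_norm_eq_of_L2 (od x)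
    have a1 : ‖(od x).fst‖ ≤ ‖x‖ := by
      rw [h1, h2]; refine Real.le_sqrt_of_sq_le ?_; nlinarith [sq_nonneg ‖(od x).snd‖]
    have a2 : ‖(od x).snd‖ ≤ ‖x‖ := by
      rw [h1, h2]; refine Real.le_sqrt_of_sq_le ?_; nlinarith [sq_nonneg ‖(od x).fst‖]
    rw [Prod.norm_def]
    refine max_le ?_ a2
    refine le_trans (le_of_eq ?_) a1
    exact e.symm.norm_map _
  · intro y
    have h1 : od (y : X) = WithLp.toLp 2 (0, y) := by
      rw [Submodule.orthogonalDecomposition_apply]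
      congr 2
      · exact Submodule.orthogonalProjectionOnto_apply_of_mem_orthogonal y.2
      · simp
    have h2 : (WithLp.prodContinuousLinearEquiv 2 ℝ (ℝ ∙ ω) (ℝ ∙ ω)ᗮ) (od (y : X)) = (0, y) := by
      rw [h1]; rfl
    change (e.symm.toContinuousLinearEquiv.prodCongr (ContinuousLinearEquiv.refl ℝ _)) 
      ((WithLp.prodContinuousLinearEquiv 2 ℝ (ℝ ∙ ω) (ℝ ∙ ω)ᗮ) (od (y : X))) = _
    rw [h2]
    simp

end transfer


section transfer2
open FourierTransform LineDeriv
variable {X : Type} [NormedAddCommGroup X] [InnerProductSpace ℝ X] [FiniteDimensional ℝ X]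
  [MeasurableSpace X] [BorelSpace X]

theorem hs_sliceX (hn : 2 ≤ Module.finrank ℝ X) {lam : ℝ} (h0 : 0 ≤ lam) (h1 : lam < 1) (B T M : ℝ≥0)
    (J P : Type) [Fintype J] [Fintype P] (ω : X) (hω : ‖ω‖ = 1) :
    ∃ C : ℝ≥0∞, C ≠ ⊤ ∧ ∀ (K : SchwartzMap X ℂ) (K' : J → P → SchwartzMap X ℂ)
      (τ : J → X) (F : P → SchwartzMap X ℂ) (u : J → SchwartzMap X ℂ)
      (φ : SchwartzMap X ℂ),
      HsKer (Module.finrank ℝ X - 1) B K → (∀ j p, HsKer (Module.finrank ℝ X - 1) B (K' j p)) →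
      (∀ j, ‖τ j‖ₑ ≤ T) → (∀ j, inner ℝ ω (τ j) = 0) →
      (∀ j, u j = ∑ p, hsConv (K' j p) (F p)) →
      (φ = ∑ j, (∂_{τ j} (u j) : SchwartzMap X ℂ)) →
      (∑ p, ∫⁻ w, ‖F p w‖ₑ ≤ 1) → (∫⁻ w, ‖φ w‖ₑ ≤ M) →
      ∀ g : X → ℝ≥0∞, Measurable g →
      ∫⁻ x : X, ‖hsConv K φ x‖ₑ *
          (g x * ‖x‖ₑ ^ (-(lam * (((Module.finrank ℝ X : ℝ) - 1) / (Module.finrank ℝ X - lam))))) ≤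
        C * (1 + ∫⁻ x, g x ^ (((Module.finrank ℝ X : ℝ) - lam) / (1 - lam))) := by
  obtain ⟨Φ, hΦ, hΦn, hΦy⟩ := hs_split ω hω
  have hfin : Module.finrank ℝ (ℝ ∙ ω)ᗮ = Module.finrank ℝ X - 1 := by
    have h := (ℝ ∙ ω).finrank_add_finrank_orthogonal
    have hω0 : ω ≠ 0 := by rintro rfl; simp at hω
    rw [finrank_span_singleton hω0] at h
    omega
  have hfinR : (Module.finrank ℝ (ℝ ∙ ω)ᗮ : ℝ) = (Module.finrank ℝ X : ℝ) - 1 := by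
    rw [hfin, Nat.cast_sub (by omega)]; simp
  haveI : Nontrivial (ℝ ∙ ω)ᗮ := Module.nontrivial_of_finrank_pos (R := ℝ) (by rw [hfin]; omega)
  set Θ : (ℝ × (ℝ ∙ ω)ᗮ) ≃L[ℝ] X := Φ.symm with hΘ
  obtain ⟨C, hC, H⟩ := hs_slice (Y := (ℝ ∙ ω)ᗮ) h0 h1
    (B * (1 + ‖(Θ : (ℝ × (ℝ ∙ ω)ᗮ) →L[ℝ] X)‖₊) ^ 2) T M J P
  have hΘn : ∀ w, ‖w‖ ≤ ‖Θ w‖ := fun w => by simpa [hΘ] using hΦn (Φ.symm w)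
  have hemb : MeasurableEmbedding Φ := Φ.toHomeomorph.measurableEmbedding
  have hΘm : MeasurePreserving Θ volume volume := by
    have := hΦ.symm Φ.toHomeomorph.toMeasurableEquiv
    exact this
  have hembΘ : MeasurableEmbedding Θ := Θ.toHomeomorph.measurableEmbedding
  set cp : SchwartzMap X ℂ →L[ℂ] SchwartzMap (ℝ × (ℝ ∙ ω)ᗮ) ℂ := SchwartzMap.compCLMOfContinuousLinearEquiv ℂ Θ with hcp
  have hcpa : ∀ f w, cp f w = f (Θ w) := fun f w => rfl
  have hconv : ∀ K F : SchwartzMap X ℂ, ∀ w, ∫ w', cp K (w - w') * cp F w' = hsConv K F (Θ w) := by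
    intro K F w
    rw [hsConv_apply, ← hΘm.integral_comp hembΘ]
    simp only [hcpa, map_sub]
  refine ⟨C, hC, ?_⟩
  intro K K' τ F u φ hK hK' hτ hτω hu hφ hF hφM g hg
  have hmem : ∀ j, τ j ∈ (ℝ ∙ ω)ᗮ := fun j => by
    rw [Submodule.mem_orthogonal_singleton_iff_inner_right]; exact hτω j
  have hl : ∀ f : SchwartzMap X ℂ, ∫⁻ w, ‖cp f w‖ₑ = ∫⁻ x, ‖f x‖ₑ := fun f => by
    rw [← hΘm.lintegral_comp_emb hembΘ]; rfl
  have h := H (cp K) (fun j p => cp (K' j p)) (fun j => ⟨τ j, hmem j⟩) (fun p => cp (F p)) (fun j => cp (u j)) (cp φ)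
    (by rw [hfin]; exact hsKer_comp Θ hΘn hK) (fun j p => by rw [hfin]; exact hsKer_comp Θ hΘn (hK' j p))
    (fun j => hτ j)
    (fun j w => by
      simp only [hconv]
      rw [hcpa, hu j, SchwartzMap.sum_apply])
    (fun w => by
      rw [hφ, hcpa, SchwartzMap.sum_apply]
      refine Finset.sum_congr rfl fun j _ => ?_
      rw [hcp, SchwartzMap.lineDerivOp_compCLMOfContinuousLinearEquiv]
      have : Θ (0, ⟨τ j, hmem j⟩) = τ j := by
        rw [← hΦy]; simp [hΘ]
      rw [this]; rfl)
    (by simpa only [hl] using hF) (by simpa only [hl] using hφM) (fun w => g (Θ w)) (hg.comp hΘm.measurable)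
  rw [hΘm.lintegral_comp (f := fun x => g x ^ _) (hg.pow_const _)] at h
  simp only [hconv] at h
  rw [hfinR, sub_add_cancel] at h
  refine le_trans ?_ h
  rw [← hΘm.lintegral_comp_emb hembΘ]
  refine lintegral_mono fun w => ?_
  refine mul_le_mul' le_rfl (mul_le_mul' le_rfl ?_)
  refine hs_ennreal_rpow_le_neg ?_ ?_
  · rw [← ofReal_norm, ← ofReal_norm]
    exact ENNReal.ofReal_le_ofReal ((norm_snd_le w).trans (hΘn w))
  · have : (2:ℝ) ≤ Module.finrank ℝ X := by exact_mod_cast hn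
    have : 0 ≤ lam * (((Module.finrank ℝ X : ℝ) - 1) / (Module.finrank ℝ X - lam)) :=
      mul_nonneg h0 (div_nonneg (by linarith) (by linarith))
    linarith

end transfer2


section algebra
variable {X : Type} [NormedAddCommGroup X] [InnerProductSpace ℝ X] [FiniteDimensional ℝ X]
universe hsv hse
variable {V : Type hsv} {E : Type hse} [NormedAddCommGroup V] [InnerProductSpace ℝ V] [FiniteDimensional ℝ V]
    [NormedAddCommGroup E] [InnerProductSpace ℝ E] [FiniteDimensional ℝ E]

/-- Polarised symbol. -/
def hsPol {k : ℕ} (A : DiffOperator X k V E) (w : Fin k → X) (v : V) : E :=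
  A (((ContinuousMultilinearMap.mkPiAlgebra ℝ (Fin k) ℝ).compContinuousLinearMap
      (fun l => innerSL ℝ (w l))).smulRight v)

theorem hsPol_symbol {k : ℕ} (A : DiffOperator X k V E) (ξ : X) (v : V) :
    A.symbol ξ v = hsPol A (fun _ => ξ) v := by
  simp only [DiffOperator.symbol, hsPol]
  rw [ContinuousLinearMap.comp_apply]
  congr 1

theorem hsPol_update_add {k : ℕ} (A : DiffOperator X k V E) (w : Fin k → X) (v : V) (i : Fin k) (x y : X) :
    hsPol A (Function.update w i (x + y)) v =
      hsPol A (Function.update w i x) v + hsPol A (Function.update w i y) v := by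
  unfold hsPol
  rw [← map_add]
  congr 1
  ext m
  simp only [ContinuousMultilinearMap.smulRight_apply, ContinuousMultilinearMap.compContinuousLinearMap_apply,
    ContinuousMultilinearMap.mkPiAlgebra_apply, ContinuousMultilinearMap.add_apply, innerSL_apply_apply]
  rw [← add_smul]
  congr 1
  rw [Fintype.prod_eq_mul_prod_compl i, Fintype.prod_eq_mul_prod_compl i, Fintype.prod_eq_mul_prod_compl i]
  have : ∀ z, ∏ l ∈ {i}ᶜ, inner ℝ (Function.update w i z l) (m l) = ∏ l ∈ {i}ᶜ, inner ℝ (w l) (m l) := fun z =>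
    Finset.prod_congr rfl fun l hl => by
      have : l ≠ i := by simpa using hl
      rw [Function.update_of_ne this]
  simp only [this, Function.update_self, inner_add_left, add_mul]

theorem hsPol_update_smul {k : ℕ} (A : DiffOperator X k V E) (w : Fin k → X) (v : V) (i : Fin k) (c : ℝ) (x : X) :
    hsPol A (Function.update w i (c • x)) v = c • hsPol A (Function.update w i x) v := by
  unfold hsPol
  rw [← map_smul]
  congr 1
  ext m
  simp only [ContinuousMultilinearMap.smulRight_apply, ContinuousMultilinearMap.compContinuousLinearMap_apply,
    ContinuousMultilinearMap.mkPiAlgebra_apply, ContinuousMultilinearMap.smul_apply, innerSL_apply_apply]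
  rw [smul_smul]
  congr 1
  rw [Fintype.prod_eq_mul_prod_compl i, Fintype.prod_eq_mul_prod_compl i]
  have : ∀ z, ∏ l ∈ {i}ᶜ, inner ℝ (Function.update w i z l) (m l) = ∏ l ∈ {i}ᶜ, inner ℝ (w l) (m l) := fun z =>
    Finset.prod_congr rfl fun l hl => by
      have : l ≠ i := by simpa using hl
      rw [Function.update_of_ne this]
  simp only [this, Function.update_self, inner_smul_left]
  simp [mul_assoc]

/-- The polarised symbol as a multilinear map. -/
def hsPolM {k : ℕ} (A : DiffOperator X k V E) (v : V) : MultilinearMap ℝ (fun _ : Fin k => X) E where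
  toFun w := hsPol A w v
  map_update_add' w i x y := by
    convert hsPol_update_add A w v i x y
  map_update_smul' w i c x := by
    convert hsPol_update_smul A w v i c x

theorem hs_symbol_expand {k : ℕ} (A : DiffOperator X k V E) {ι : Type} [Fintype ι]
    (b : OrthonormalBasis ι ℝ X) (ξ : X) (v : V) :
    A.symbol ξ v = ∑ c : Fin k → ι, (∏ l, inner ℝ ξ (b (c l))) • hsPol A (fun l => b (c l)) v := by
  classical
  rw [hsPol_symbol]
  have h1 : (fun _ : Fin k => ξ) = fun _ => ∑ j, inner ℝ (b j) ξ • b j := by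
    ext1; exact (b.sum_repr' ξ).symm
  change hsPolM A v (fun _ => ξ) = _
  rw [h1, MultilinearMap.map_sum]
  refine Finset.sum_congr rfl fun c _ => ?_
  rw [MultilinearMap.map_smul_univ]
  simp only [real_inner_comm]
  rfl

theorem hs_symbol_smul {k : ℕ} (A : DiffOperator X k V E) (c : ℝ) (ξ : X) :
    A.symbol (c • ξ) = c ^ k • A.symbol ξ := by
  ext v
  rw [ContinuousLinearMap.smul_apply, hsPol_symbol, hsPol_symbol]
  have := (hsPolM A v).map_smul_univ (fun _ => c) (fun _ => ξ)
  simp only [Finset.prod_const, Finset.card_univ, Fintype.card_fin] at this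
  exact this

theorem hs_symbol_contDiff {k : ℕ} (A : DiffOperator X k V E) (v : V) :
    ContDiff ℝ (⊤ : ℕ∞) (fun ξ => A.symbol ξ v) := by
  have : (fun ξ => A.symbol ξ v) = fun ξ => ∑ c : Fin k → Fin (Module.finrank ℝ X),
      (∏ l, inner ℝ ξ (stdOrthonormalBasis ℝ X (c l))) • hsPol A (fun l => stdOrthonormalBasis ℝ X (c l)) v := by
    ext1 ξ; exact hs_symbol_expand A _ ξ v
  rw [this]
  refine ContDiff.sum fun c _ => ContDiff.smul ?_ contDiff_const
  exact contDiff_prod fun l _ => contDiff_id.inner ℝ contDiff_const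

/-- Transpose of the symbol -/
def hsTr {k : ℕ} (A : DiffOperator X k V E) (ξ : X) : E →L[ℝ] V :=
  ∑ i, (innerSL ℝ (A.symbol ξ (stdOrthonormalBasis ℝ V i))).smulRight (stdOrthonormalBasis ℝ V i)

/-- Left inverse of the symbol. -/
def hsPinv {k : ℕ} (A : DiffOperator X k V E) (ξ : X) : E →L[ℝ] V :=
  (Ring.inverse ((hsTr A ξ).comp (A.symbol ξ))).comp (hsTr A ξ)

theorem hsTr_smul {k : ℕ} (A : DiffOperator X k V E) (c : ℝ) (ξ : X) :
    hsTr A (c • ξ) = c ^ k • hsTr A ξ := by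
  ext e
  simp [hsTr, hs_symbol_smul, Finset.smul_sum, smul_smul, inner_smul_left]

theorem hs_unit {k : ℕ} {A : DiffOperator X k V E} (hA : A.IsElliptic) {ξ : X} (hξ : ξ ≠ 0) :
    IsUnit ((hsTr A ξ).comp (A.symbol ξ)) := by
  have hinj : Function.Injective ((hsTr A ξ).comp (A.symbol ξ)) := by
    rw [injective_iff_map_eq_zero]
    intro v hv
    apply (injective_iff_map_eq_zero _).1 (hA ξ hξ)
    have h1 : ∀ i, inner ℝ (A.symbol ξ (stdOrthonormalBasis ℝ V i)) (A.symbol ξ v) = 0 := by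
      intro i
      have := congrArg (fun z => inner ℝ (stdOrthonormalBasis ℝ V i) z) hv
      simpa [hsTr, inner_sum, inner_smul_right, OrthonormalBasis.inner_eq_ite] using this
    have h2 : inner ℝ (A.symbol ξ v) (A.symbol ξ v) = 0 := by
      conv_lhs => rw [← (stdOrthonormalBasis ℝ V).sum_repr' v]
      simp only [map_sum, map_smul, sum_inner, inner_smul_left]
      refine Finset.sum_eq_zero fun i _ => ?_
      have := h1 i
      rw [← (stdOrthonormalBasis ℝ V).sum_repr' v] at this
      simp only [map_sum, map_smul] at this
      rw [this]; simp
    exact inner_self_eq_zero.1 h2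
  exact ⟨ContinuousLinearEquiv.toUnit (LinearEquiv.toContinuousLinearEquiv
    (LinearEquiv.ofInjectiveEndo (((hsTr A ξ).comp (A.symbol ξ)) : V →ₗ[ℝ] V) hinj)), by ext; rfl⟩

theorem hsPinv_symbol {k : ℕ} {A : DiffOperator X k V E} (hA : A.IsElliptic) {ξ : X} (hξ : ξ ≠ 0) (v : V) :
    hsPinv A ξ (A.symbol ξ v) = v := by
  have := Ring.inverse_mul_cancel _ (hs_unit hA hξ)
  have h2 := congrArg (fun L : V →L[ℝ] V => L v) this
  exact h2

theorem hsPinv_smul {k : ℕ} {A : DiffOperator X k V E} (hA : A.IsElliptic) {c : ℝ} (hc : c ≠ 0)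
    {ξ : X} (hξ : ξ ≠ 0) :
    hsPinv A (c • ξ) = (c ^ k)⁻¹ • hsPinv A ξ := by
  have hck : c ^ k ≠ 0 := pow_ne_zero _ hc
  have hcξ : c • ξ ≠ 0 := smul_ne_zero hc hξ
  have e1 : (hsTr A (c • ξ)).comp (A.symbol (c • ξ)) = (c ^ k * c ^ k) • (hsTr A ξ).comp (A.symbol ξ) := by
    rw [hsTr_smul, hs_symbol_smul]
    ext v
    simp [smul_smul]
  have e2 : Ring.inverse ((hsTr A (c • ξ)).comp (A.symbol (c • ξ))) =
      (c ^ k * c ^ k)⁻¹ • Ring.inverse ((hsTr A ξ).comp (A.symbol ξ)) := by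
    rw [e1]
    obtain ⟨M, hM⟩ := hs_unit hA hξ
    rw [← hM]
    have : (c ^ k * c ^ k) • (M : V →L[ℝ] V) = ((Units.mk0 (c ^ k * c ^ k) (mul_ne_zero hck hck) • M : (V →L[ℝ] V)ˣ) : V →L[ℝ] V) := by
      ext; simp [Units.smul_def]
    rw [this, Ring.inverse_unit, Ring.inverse_unit]
    ext; simp [Units.smul_def]
  rw [hsPinv, e2, hsTr_smul, hsPinv]
  ext v
  simp only [ContinuousLinearMap.comp_apply, ContinuousLinearMap.smul_apply, map_smul, smul_smul]
  congr 1
  field_simp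

theorem hsPinv_contDiffAt {k : ℕ} {A : DiffOperator X k V E} (hA : A.IsElliptic)
    {ξ : X} (hξ : ξ ≠ 0) : ContDiffAt ℝ (⊤ : ℕ∞) (fun ξ => hsPinv A ξ) ξ := by
  have h1 : ContDiff ℝ (⊤ : ℕ∞) (fun ξ => hsTr A ξ) := by
    rw [contDiff_clm_apply_iff]
    intro e
    simp only [hsTr, ContinuousLinearMap.sum_apply, ContinuousLinearMap.smulRight_apply, innerSL_apply_apply]
    exact ContDiff.sum fun i _ => (ContDiff.inner ℝ (hs_symbol_contDiff A _) contDiff_const).smul contDiff_const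
  have h2 : ContDiff ℝ (⊤ : ℕ∞) (fun ξ => A.symbol ξ) := by
    rw [contDiff_clm_apply_iff]
    exact fun v => hs_symbol_contDiff A v
  have h3 := (h1.clm_comp h2).contDiffAt (x := ξ)
  obtain ⟨M, hM⟩ := hs_unit hA hξ
  have h4 : ContDiffAt ℝ (⊤ : ℕ∞) Ring.inverse ((hsTr A ξ).comp (A.symbol ξ)) := by
    rw [← hM]
    exact contDiffAt_ringInverse ℝ M
  exact (h4.comp ξ h3).clm_comp h1.contDiffAt

end algebra


section algebra2
open FourierTransform LineDeriv
variable {X : Type} [NormedAddCommGroup X] [InnerProductSpace ℝ X] [FiniteDimensional ℝ X]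
  [MeasurableSpace X] [BorelSpace X]
universe hsv hse
variable {V : Type hsv} {E : Type hse} [NormedAddCommGroup V] [InnerProductSpace ℝ V] [FiniteDimensional ℝ V]
    [NormedAddCommGroup E] [InnerProductSpace ℝ E] [FiniteDimensional ℝ E]

/-- Homogeneous multiplier of degree `-1`. -/
def hsMu {r : ℕ} (A : DiffOperator X (r + 1) V E) (m : Fin r → X) (v : V) (e : E) (ξ : X) : ℂ :=
  (2 * Real.pi * Complex.I)⁻¹ * (∏ l, ((inner ℝ ξ (m l) : ℝ) : ℂ)) * ((inner ℝ v (hsPinv A ξ e) : ℝ) : ℂ)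

theorem hsMu_HsMul {r : ℕ} {A : DiffOperator X (r + 1) V E} (hA : A.IsElliptic) (m : Fin r → X) (v : V) (e : E) :
    HsMul (hsMu A m v e) := by
  constructor
  · intro ξ hξ
    unfold hsMu
    refine ContDiffAt.mul (contDiffAt_const.mul ?_) ?_
    · refine contDiffAt_prod fun l _ => ?_
      exact Complex.ofRealCLM.contDiff.contDiffAt.comp ξ (contDiffAt_id.inner ℝ contDiffAt_const)
    · refine Complex.ofRealCLM.contDiff.contDiffAt.comp ξ (contDiffAt_const.inner ℝ ?_)
      exact (hsPinv_contDiffAt hA hξ).clm_apply contDiffAt_const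
  · intro c ξ hc hξ
    unfold hsMu
    rw [hsPinv_smul hA hc hξ]
    simp only [inner_smul_left, ContinuousLinearMap.smul_apply, inner_smul_right]
    have hcc : (c : ℂ) ≠ 0 := by exact_mod_cast hc
    push_cast
    rw [Finset.prod_mul_distrib]
    simp
    field_simp
    ring

/-- `F` is the image `A(D)U`, in coordinates and on the Fourier side. -/
def HsRel {k : ℕ} (A : DiffOperator X k V E) (U : Fin (Module.finrank ℝ V) → SchwartzMap X ℂ)
    (F : Fin (Module.finrank ℝ E) → SchwartzMap X ℂ) : Prop :=
  ∀ p ξ, 𝓕 (F p) ξ = (2 * Real.pi * Complex.I) ^ k *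
    ∑ i, ((inner ℝ (stdOrthonormalBasis ℝ E p) (A.symbol ξ (stdOrthonormalBasis ℝ V i)) : ℝ) : ℂ) * 𝓕 (U i) ξ

/-- component of `F` along `e` -/
def hsDot (e : E) (F : Fin (Module.finrank ℝ E) → SchwartzMap X ℂ) : SchwartzMap X ℂ :=
  ∑ p, ((inner ℝ e (stdOrthonormalBasis ℝ E p) : ℝ) : ℂ) • F p

theorem hs_fourier_sum {ι : Type} [Fintype ι] (f : ι → SchwartzMap X ℂ) (ξ : X) :
    𝓕 (∑ i, f i) ξ = ∑ i, 𝓕 (f i) ξ := by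
  have := map_sum (fourierCLM ℂ (SchwartzMap X ℂ)) f Finset.univ
  have h2 := congrArg (fun g : SchwartzMap X ℂ => g ξ) this
  simp only [SchwartzMap.sum_apply] at h2
  exact h2

theorem hs_fourier_smul (c : ℂ) (f : SchwartzMap X ℂ) (ξ : X) : 𝓕 (c • f) ξ = c * 𝓕 f ξ := by
  have := map_smul (fourierCLM ℂ (SchwartzMap X ℂ)) c f
  exact congrArg (fun g : SchwartzMap X ℂ => g ξ) this

theorem hsDot_fourier {k : ℕ} {A : DiffOperator X k V E} {U : Fin (Module.finrank ℝ V) → SchwartzMap X ℂ}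
    {F : Fin (Module.finrank ℝ E) → SchwartzMap X ℂ} (h : HsRel A U F) (e : E) (ξ : X) :
    𝓕 (hsDot e F) ξ = (2 * Real.pi * Complex.I) ^ k *
      ∑ i, ((inner ℝ e (A.symbol ξ (stdOrthonormalBasis ℝ V i)) : ℝ) : ℂ) * 𝓕 (U i) ξ := by
  rw [hsDot, hs_fourier_sum]
  simp only [hs_fourier_smul, h _ ξ]
  simp only [Finset.mul_sum]
  rw [Finset.sum_comm]
  refine Finset.sum_congr rfl fun i _ => ?_
  rw [← (stdOrthonormalBasis ℝ E).sum_inner_mul_inner e]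
  push_cast
  rw [Finset.sum_mul, Finset.mul_sum]
  refine Finset.sum_congr rfl fun p _ => ?_
  ring

theorem hsDot_basis (p) (F : Fin (Module.finrank ℝ E) → SchwartzMap X ℂ) :
    hsDot (stdOrthonormalBasis ℝ E p) F = F p := by
  simp [hsDot, OrthonormalBasis.inner_eq_ite]

theorem hs_two_pi_ne : (2 * Real.pi * Complex.I : ℂ) ≠ 0 := by
  simp [Real.pi_ne_zero]

theorem hsTheta_zero (J : ℕ) : hsTheta J (0 : X) = 0 := by
  rw [hsTheta_eq]; simp

theorem hs_rep {r : ℕ} {A : DiffOperator X (r + 1) V E} (hA : A.IsElliptic)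
    {U : Fin (Module.finrank ℝ V) → SchwartzMap X ℂ}
    {F : Fin (Module.finrank ℝ E) → SchwartzMap X ℂ} (h : HsRel A U F) {J : ℕ}
    (hU : ∀ i ξ, 𝓕 (U i) ξ ≠ 0 → hsTheta J ξ = 1) {L : Type} [Fintype L] (e e' : L → E)
    (he : ∀ z : E, z = ∑ l, inner ℝ (e l) z • e' l) (m : Fin r → X) (i : Fin (Module.finrank ℝ V))
    (K : L → SchwartzMap X ℂ) (hK : ∀ l ξ, 𝓕 (K l) ξ = (hsTheta J ξ : ℂ) * hsMu A m (stdOrthonormalBasis ℝ V i) (e' l) ξ) :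
    (∂^{m} (U i) : SchwartzMap X ℂ) = ∑ l, hsConv (K l) (hsDot (e l) F) := by
  apply hs_fourier_inj
  intro ξ
  rw [hs_fourier_sum, hs_fourier_iter]
  simp only [hsConv_fourier, hK, hsDot_fourier h]
  by_cases hξ : hsTheta J ξ = 1
  · have hξ0 : ξ ≠ 0 := by
      rintro rfl
      rw [hsTheta_zero] at hξ; norm_num at hξ
    rw [hξ]
    unfold hsMu
    have key : ∀ i', ∑ l, (((inner ℝ (stdOrthonormalBasis ℝ V i) (hsPinv A ξ (e' l)) : ℝ)) : ℂ) *
        ((inner ℝ (e l) (A.symbol ξ (stdOrthonormalBasis ℝ V i')) : ℝ) : ℂ) = if i = i' then 1 else 0 := by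
      intro i'
      have h1 := congrArg (fun z => inner ℝ (stdOrthonormalBasis ℝ V i) (hsPinv A ξ z))
        (he (A.symbol ξ (stdOrthonormalBasis ℝ V i')))
      simp only [hsPinv_symbol hA hξ0, map_sum, map_smul, inner_sum, inner_smul_right,
        OrthonormalBasis.inner_eq_ite] at h1
      have h2 := congrArg (fun t : ℝ => (t : ℂ)) h1.symm
      push_cast at h2
      have h3 : (((if i = i' then 1 else 0 : ℝ)) : ℂ) = if i = i' then 1 else 0 := by split_ifs <;> simp
      rw [← h3, ← h2]
      exact Finset.sum_congr rfl fun l _ => mul_comm _ _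
    have : 𝓕 (U i) ξ = ∑ i', (if i = i' then 1 else 0) * 𝓕 (U i') ξ := by simp
    rw [this]
    simp only [← key]
    simp only [Finset.mul_sum, Finset.sum_mul]
    rw [Finset.sum_comm]
    refine Finset.sum_congr rfl fun l _ => Finset.sum_congr rfl fun i' _ => ?_
    rw [pow_succ]
    have := hs_two_pi_ne
    field_simp
    push_cast; ring
  · have : ∀ i, 𝓕 (U i) ξ = 0 := fun i => by
      by_contra h'; exact hξ (hU i ξ h')
    simp [this]

theorem hs_onb (hn : 0 < Module.finrank ℝ X) (ω : X) (hω : ‖ω‖ = 1) :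
    ∃ (b : OrthonormalBasis (Fin (Module.finrank ℝ X)) ℝ X) (i0 : Fin (Module.finrank ℝ X)), b i0 = ω := by
  have hv : Orthonormal ℝ (({(⟨0, hn⟩ : Fin (Module.finrank ℝ X))} : Set _).restrict (fun _ => ω)) := by
    constructor
    · intro i; exact hω
    · rintro ⟨i, hi⟩ ⟨j, hj⟩ hij
      exact absurd (by simp at hi hj; simp [hi, hj]) hij
  obtain ⟨b, hb⟩ := Orthonormal.exists_orthonormalBasis_extension_of_card_eq (by simp) hv
  exact ⟨b, ⟨0, hn⟩, hb _ rfl⟩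

theorem hs_tangential (hn : 0 < Module.finrank ℝ X) {r : ℕ} (A : DiffOperator X (r + 1) V E) (ω : X) (hω : ‖ω‖ = 1)
    (e : E) (he : ∀ v, inner ℝ e (A.symbol ω v) = 0) :
    ∃ (τ : (Fin (r + 1) → Fin (Module.finrank ℝ X)) × Fin (Module.finrank ℝ V) → X)
      (m : (Fin (r + 1) → Fin (Module.finrank ℝ X)) × Fin (Module.finrank ℝ V) → Fin r → X),
      (∀ j, inner ℝ ω (τ j) = 0) ∧ ∀ (ξ : X) (w : Fin (Module.finrank ℝ V) → ℂ),
      ∑ i, ((inner ℝ e (A.symbol ξ (stdOrthonormalBasis ℝ V i)) : ℝ) : ℂ) * w i =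
      ∑ j, ((inner ℝ ξ (τ j) : ℝ) : ℂ) * (∏ l, ((inner ℝ ξ (m j l) : ℝ) : ℂ)) * w j.2 := by
  classical
  obtain ⟨b, i0, hb⟩ := hs_onb hn ω hω
  have H : ∀ j : (Fin (r + 1) → Fin (Module.finrank ℝ X)) × Fin (Module.finrank ℝ V), ∃ (τ : X) (m : Fin r → X),
      inner ℝ ω τ = 0 ∧ ∀ ξ, (∏ l, inner ℝ ξ (b (j.1 l))) * inner ℝ e (hsPol A (fun l => b (j.1 l)) (stdOrthonormalBasis ℝ V j.2))
        = inner ℝ ξ τ * ∏ l, inner ℝ ξ (m l) := by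
    rintro ⟨c, i⟩
    by_cases hc : ∃ l, c l ≠ i0
    · obtain ⟨l0, hl0⟩ := hc
      refine ⟨inner ℝ e (hsPol A (fun l => b (c l)) (stdOrthonormalBasis ℝ V i)) • b (c l0),
        fun l => b (c (l0.succAbove l)), ?_, fun ξ => ?_⟩
      · rw [inner_smul_right, ← hb, OrthonormalBasis.inner_eq_ite, if_neg (Ne.symm hl0), mul_zero]
      · simp only
        rw [inner_smul_right, Fin.prod_univ_succAbove _ l0]
        ring
    · push Not at hc
      refine ⟨0, fun _ => 0, by simp, fun ξ => ?_⟩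
      have : (fun l => b (c l)) = fun _ => ω := by ext1 l; rw [hc l, hb]
      simp only [this]
      rw [← hsPol_symbol, he]; simp
  choose τ m h1 h2 using H
  refine ⟨τ, m, h1, fun ξ w => ?_⟩
  have h3 : ∀ j, ((inner ℝ ξ (τ j) : ℝ) : ℂ) * (∏ l, ((inner ℝ ξ (m j l) : ℝ) : ℂ)) =
    (((∏ l, inner ℝ ξ (b (j.1 l))) * inner ℝ e (hsPol A (fun l => b (j.1 l)) (stdOrthonormalBasis ℝ V j.2)) : ℝ) : ℂ) := by
    intro j; rw [h2]; push_cast; ring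
  simp only [h3]
  rw [Fintype.sum_prod_type_right]
  refine Finset.sum_congr rfl fun i _ => ?_
  rw [hs_symbol_expand A b, inner_sum]
  simp only [inner_smul_right]
  push_cast
  rw [Finset.sum_mul]

theorem hs_tangential_rep (hn : 0 < Module.finrank ℝ X) {r : ℕ} (A : DiffOperator X (r + 1) V E) (ω : X) (hω : ‖ω‖ = 1)
    (e : E) (he : ∀ v, inner ℝ e (A.symbol ω v) = 0) :
    ∃ (τ : (Fin (r + 1) → Fin (Module.finrank ℝ X)) × Fin (Module.finrank ℝ V) → X)
      (m : (Fin (r + 1) → Fin (Module.finrank ℝ X)) × Fin (Module.finrank ℝ V) → Fin r → X),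
      (∀ j, inner ℝ ω (τ j) = 0) ∧ ∀ U F, HsRel A U F →
      hsDot e F = ∑ j, (∂_{τ j} (∂^{m j} (U j.2) : SchwartzMap X ℂ) : SchwartzMap X ℂ) := by
  obtain ⟨τ, m, h1, h2⟩ := hs_tangential hn A ω hω e he
  refine ⟨τ, m, h1, fun U F h => ?_⟩
  apply hs_fourier_inj
  intro ξ
  rw [hsDot_fourier h, hs_fourier_sum, h2 ξ (fun i => 𝓕 (U i) ξ), Finset.mul_sum]
  refine Finset.sum_congr rfl fun j _ => ?_
  rw [hs_fourier_lineDeriv, hs_fourier_iter]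
  ring

theorem hs_cancel {k : ℕ} {A : DiffOperator X k V E} (hA : A.IsCanceling) :
    ∃ (L : Type) (_ : Fintype L) (ω : L → X) (e e' : L → E), (∀ l, ‖ω l‖ = 1) ∧
      (∀ l v, inner ℝ (e l) (A.symbol (ω l) v) = 0) ∧ ∀ z : E, z = ∑ l, inner ℝ (e l) z • e' l := by
  set S : Set E := {e | ∃ ω : X, ‖ω‖ = 1 ∧ ∀ v, inner ℝ e (A.symbol ω v) = 0} with hS
  have htop : Submodule.span ℝ S = ⊤ := by
    rw [← Submodule.orthogonal_eq_bot_iff, Submodule.eq_bot_iff]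
    intro z hz
    have hz0 : z ∈ (⋂ (ξ : X) (_ : ξ ≠ 0), Set.range (A.symbol ξ)) := by
      simp only [Set.mem_iInter]
      intro ξ hξ
      have hξn : ‖ξ‖ ≠ 0 := norm_ne_zero_iff.2 hξ
      set ω := ‖ξ‖⁻¹ • ξ with hω
      have hωn : ‖ω‖ = 1 := by rw [hω, norm_smul, norm_inv, norm_norm, inv_mul_cancel₀ hξn]
      have hz1 : z ∈ (A.symbol ω).range := by
        rw [← Submodule.orthogonal_orthogonal (A.symbol ω).range]
        rw [Submodule.mem_orthogonal]
        intro e he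
        rw [Submodule.mem_orthogonal] at hz
        apply hz
        apply Submodule.subset_span
        refine ⟨ω, hωn, fun v => ?_⟩
        rw [real_inner_comm]
        exact (Submodule.mem_orthogonal _ _).1 he _ ⟨v, rfl⟩
      obtain ⟨v, hv⟩ := hz1
      refine ⟨(‖ξ‖⁻¹) ^ k • v, ?_⟩
      have : A.symbol ω v = z := hv
      rw [← this, hω, hs_symbol_smul]; simp
    have : (⋂ (ξ : X) (_ : ξ ≠ 0), Set.range (A.symbol ξ)) = {0} := hA
    rw [this] at hz0
    exact hz0
  have hmem : ∀ p, ∃ (N : ℕ) (f : Fin N → ℝ) (g : Fin N → S), ∑ i, f i • (g i : E) = stdOrthonormalBasis ℝ E p := by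
    intro p
    exact (Submodule.mem_span_set' ).1 (by rw [htop]; trivial)
  choose N f g hfg using hmem
  have hg : ∀ p t, ∃ ω : X, ‖ω‖ = 1 ∧ ∀ v, inner ℝ (g p t : E) (A.symbol ω v) = 0 := fun p t => (g p t).2
  choose ω hω1 hω2 using hg
  refine ⟨Σ p, Fin (N p), inferInstance, fun l => ω l.1 l.2, fun l => g l.1 l.2,
    fun l => f l.1 l.2 • stdOrthonormalBasis ℝ E l.1, fun l => hω1 _ _, fun l => hω2 _ _, fun z => ?_⟩
  rw [Fintype.sum_sigma]
  conv_lhs => rw [← (stdOrthonormalBasis ℝ E).sum_repr' z]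
  refine Finset.sum_congr rfl fun p _ => ?_
  rw [← hfg p, sum_inner, Finset.sum_smul]
  refine Finset.sum_congr rfl fun t _ => ?_
  rw [inner_smul_left, smul_smul, hfg p]
  simp [mul_comm]

end algebra2


section L5
open FourierTransform LineDeriv
variable {X : Type} [NormedAddCommGroup X] [InnerProductSpace ℝ X] [FiniteDimensional ℝ X]
  [MeasurableSpace X] [BorelSpace X]

theorem hs_schwartz_weight [Nontrivial X] (f : SchwartzMap X ℂ) {q lam : ℝ} (hq : 1 ≤ q)
    (hl1 : lam < Module.finrank ℝ X) (h0 : 0 ≤ lam) :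
    ∫⁻ x, ‖f x‖ₑ ^ q * ‖x‖ₑ ^ (-lam) ≠ ⊤ := by
  obtain ⟨D, hD1, hD2⟩ := hs_schwartz_decay f (Module.finrank ℝ X + 1)
  have hDt : (D:ℝ≥0∞) ^ (q - 1) * D ≠ ⊤ :=
    ENNReal.mul_ne_top (ENNReal.rpow_ne_top_of_nonneg (by linarith) (by simp)) (by simp)
  refine ne_top_of_le_ne_top (b := (D:ℝ≥0∞) ^ (q - 1) * D * ∫⁻ x : X, hsProf lam (Module.finrank ℝ X + 1 + lam) ‖x‖ₑ) ?_ ?_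
  · exact ENNReal.mul_ne_top hDt (hsProf_lintegral_ne_top hl1 (by linarith))
  · rw [← lintegral_const_mul' _ _ hDt]
    refine lintegral_mono_ae ?_
    filter_upwards [hs_ae_ne_zero (Y := X)] with x hx
    have hx0 : ‖x‖ₑ ≠ 0 := by simpa using hx
    have hxt : ‖x‖ₑ ≠ ⊤ := by simp
    have e1 : ‖f x‖ₑ ^ q ≤ (D:ℝ≥0∞) ^ (q - 1) * ‖f x‖ₑ := by
      have : ‖f x‖ₑ ^ q = ‖f x‖ₑ ^ (q - 1) * ‖f x‖ₑ := by
        conv_rhs => rw [← ENNReal.rpow_one (‖f x‖ₑ), ← ENNReal.rpow_mul, ← ENNReal.rpow_add_of_nonneg _ _ (by linarith) (by norm_num)]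
        congr 1; ring
      rw [this]
      exact mul_le_mul' (ENNReal.rpow_le_rpow (hD1 x) (by linarith)) le_rfl
    refine (mul_le_mul' e1 le_rfl).trans ?_
    rw [mul_assoc, mul_assoc]
    refine mul_le_mul' le_rfl ?_
    unfold hsProf
    rw [mul_min]
    refine le_min (mul_le_mul' (hD1 x) le_rfl) ?_
    have e2 : ‖f x‖ₑ ≤ D * ‖x‖ₑ ^ (-((Module.finrank ℝ X : ℝ) + 1)) := by
      rw [ENNReal.rpow_neg, ← div_eq_mul_inv, ENNReal.le_div_iff_mul_le (Or.inl ?_) (Or.inl ?_), mul_comm]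
      · have := hD2 x
        rw [← ENNReal.rpow_natCast] at this
        push_cast at this
        exact this
      · exact (ENNReal.rpow_pos (pos_iff_ne_zero.2 hx0) hxt).ne'
      · exact ENNReal.rpow_ne_top_of_nonneg (by positivity) hxt
    refine (mul_le_mul' e2 le_rfl).trans ?_
    rw [mul_assoc, ← ENNReal.rpow_add _ _ hx0 hxt]
    apply le_of_eq; congr 2; ring

/-- duality trick -/
theorem hs_selfimprove [Nontrivial X] (hn : 2 ≤ Module.finrank ℝ X) {lam : ℝ} (h0 : 0 ≤ lam) (h1 : lam < 1)
    (C : ℝ≥0∞) (hC : C ≠ ⊤) : ∃ C' : ℝ≥0∞, C' ≠ ⊤ ∧ ∀ v : SchwartzMap X ℂ,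
      (∀ g : X → ℝ≥0∞, Measurable g →
        ∫⁻ x : X, ‖v x‖ₑ *
          (g x * ‖x‖ₑ ^ (-(lam * (((Module.finrank ℝ X : ℝ) - 1) / (Module.finrank ℝ X - lam))))) ≤
        C * (1 + ∫⁻ x, g x ^ (((Module.finrank ℝ X : ℝ) - lam) / (1 - lam)))) →
      ∫⁻ x, ‖v x‖ₑ ^ (((Module.finrank ℝ X : ℝ) - lam) / ((Module.finrank ℝ X : ℝ) - 1)) * ‖x‖ₑ ^ (-lam) ≤ C' := by
  set n := Module.finrank ℝ X with hnn
  have hn' : (2:ℝ) ≤ n := by exact_mod_cast hn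
  set q := ((n : ℝ) - lam) / ((n : ℝ) - 1) with hq
  set q' := ((n : ℝ) - lam) / (1 - lam) with hq'
  have hq1 : 1 ≤ q := by rw [hq, le_div_iff₀ (by linarith)]; linarith
  have hq'1 : 1 < q' := by rw [hq', lt_div_iff₀ (by linarith)]; linarith
  set c := C.toReal with hc
  have hCc : C = ENNReal.ofReal c := (ENNReal.ofReal_toReal hC).symm
  have hc0 : 0 ≤ c := ENNReal.toReal_nonneg
  set ε : ℝ := (1 / (2 * (c + 1))) ^ (1 / (q' - 1)) with hε
  have hε0 : 0 < ε := by positivity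
  have hεq : c * ε ^ q' ≤ ε / 2 := by
    have : ε ^ q' = ε * (1 / (2 * (c + 1))) := by
      have h1 : ε ^ q' = ε ^ (q' - 1) * ε := by
        conv_rhs => rw [← Real.rpow_one ε, ← Real.rpow_mul hε0.le, ← Real.rpow_add hε0]
        congr 1; ring
      rw [h1, hε, ← Real.rpow_mul (by positivity), one_div_mul_cancel (by linarith), Real.rpow_one]; ring
    rw [this]
    have h3 : c * (1 / (2 * (c + 1))) ≤ 1 / 2 := by
      rw [mul_one_div, div_le_div_iff₀ (by positivity) (by norm_num)]; linarith
    nlinarith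
  refine ⟨ENNReal.ofReal (2 * c / ε), by simp, fun v hv => ?_⟩
  set g : X → ℝ≥0∞ := fun x => ENNReal.ofReal ε * (‖v x‖ₑ ^ (q - 1) * ‖x‖ₑ ^ (-(lam / q'))) with hg
  have hgm : Measurable g := by
    have := v.continuous.measurable
    fun_prop
  have h := hv g hgm
  set I := ∫⁻ x, ‖v x‖ₑ ^ q * ‖x‖ₑ ^ (-lam) with hI
  have hIfin : I ≠ ⊤ := hs_schwartz_weight v hq1 (by linarith) h0
  have hne : ∀ᵐ x : X, x ≠ 0 := hs_ae_ne_zero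
  have e1 : ∫⁻ x : X, ‖v x‖ₑ * (g x * ‖x‖ₑ ^ (-(lam * (((n : ℝ) - 1) / (n - lam))))) = ENNReal.ofReal ε * I := by
    rw [hI, ← lintegral_const_mul' _ _ (by simp)]
    refine lintegral_congr_ae ?_
    filter_upwards [hne] with x hx
    have hx0 : ‖x‖ₑ ≠ 0 := by simpa using hx
    have a1 : ‖v x‖ₑ ^ q = ‖v x‖ₑ * ‖v x‖ₑ ^ (q - 1) := by
      conv_rhs => rw [← ENNReal.rpow_one (‖v x‖ₑ), ← ENNReal.rpow_mul, ← ENNReal.rpow_add_of_nonneg _ _ (by norm_num) (by linarith)]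
      congr 1; ring
    have a2 : ‖x‖ₑ ^ (-lam) = ‖x‖ₑ ^ (-(lam / q')) * ‖x‖ₑ ^ (-(lam * (((n : ℝ) - 1) / (n - lam)))) := by
      rw [← ENNReal.rpow_add _ _ hx0 (by simp)]
      congr 1
      rw [hq']
      have : (n:ℝ) - lam ≠ 0 := by linarith
      field_simp
      ring
    rw [a1, a2]; simp only [hg]; ring
  have e2 : ∫⁻ x, g x ^ q' = ENNReal.ofReal ε ^ q' * I := by
    rw [hI, ← lintegral_const_mul' _ _ (ENNReal.rpow_ne_top_of_nonneg (by linarith) (by simp))]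
    refine lintegral_congr fun x => ?_
    simp only [hg]
    rw [ENNReal.mul_rpow_of_nonneg _ _ (by linarith), ENNReal.mul_rpow_of_nonneg _ _ (by linarith),
      ← ENNReal.rpow_mul, ← ENNReal.rpow_mul]
    have b1 : (q - 1) * q' = q := by
      rw [hq, hq']
      have : (n:ℝ) - 1 ≠ 0 := by linarith
      have : (1:ℝ) - lam ≠ 0 := by linarith
      field_simp
      ring
    have b2 : -(lam / q') * q' = -lam := by
      have : q' ≠ 0 := by linarith
      field_simp
    rw [b1, b2]
  rw [e1, e2, hCc] at h
  rw [← ENNReal.ofReal_toReal hIfin] at h ⊢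
  set i := I.toReal with hi
  have hi0 : 0 ≤ i := ENNReal.toReal_nonneg
  rw [ENNReal.ofReal_rpow_of_pos hε0, ← ENNReal.ofReal_mul hε0.le, ← ENNReal.ofReal_mul (by positivity),
    ← ENNReal.ofReal_one, ← ENNReal.ofReal_add (by norm_num) (by positivity), ← ENNReal.ofReal_mul hc0,
    ENNReal.ofReal_le_ofReal_iff (by positivity)] at h
  refine ENNReal.ofReal_le_ofReal ?_
  rw [le_div_iff₀ hε0]
  nlinarith

theorem HsKer.mono {d : ℕ} {B B' : ℝ≥0} {K : SchwartzMap X ℂ} (h : HsKer d B K) (hB : B ≤ B') : HsKer d B' K := by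
  have hB' : (B:ℝ≥0∞) ≤ B' := by exact_mod_cast hB
  exact ⟨h.1, fun x => (h.2.1 x).trans (mul_le_mul' hB' le_rfl), fun x => (h.2.2.1 x).trans (mul_le_mul' hB' le_rfl),
    fun x => (h.2.2.2 x).trans (mul_le_mul' hB' le_rfl)⟩

universe hsv hse
variable {V : Type hsv} {E : Type hse} [NormedAddCommGroup V] [InnerProductSpace ℝ V] [FiniteDimensional ℝ V]
    [NormedAddCommGroup E] [InnerProductSpace ℝ E] [FiniteDimensional ℝ E]

theorem hsDot_L1 (e : E) (F : Fin (Module.finrank ℝ E) → SchwartzMap X ℂ) :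
    ∫⁻ w, ‖hsDot e F w‖ₑ ≤ ‖e‖₊ * ∑ p, ∫⁻ w, ‖F p w‖ₑ := by
  calc _ ≤ ∫⁻ w, ∑ p, (‖e‖₊ : ℝ≥0∞) * ‖F p w‖ₑ := by
        refine lintegral_mono fun w => ?_
        simp only [hsDot]
        rw [SchwartzMap.sum_apply]
        refine (enorm_sum_le _ _).trans (Finset.sum_le_sum fun p _ => ?_)
        rw [SchwartzMap.smul_apply, smul_eq_mul, enorm_mul]
        refine mul_le_mul' ?_ le_rfl
        rw [← enorm_eq_nnnorm, ← ofReal_norm, ← ofReal_norm]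
        refine ENNReal.ofReal_le_ofReal ?_
        rw [Complex.norm_real]
        refine (norm_inner_le_norm _ _).trans ?_
        simp
    _ = _ := by
        rw [lintegral_finsetSum _ (fun p _ => ((F p).continuous.measurable.enorm.const_mul _)), Finset.mul_sum]
        refine Finset.sum_congr rfl fun p _ => ?_
        rw [lintegral_const_mul _ (F p).continuous.measurable.enorm]

theorem hs_L5 (hn : 2 ≤ Module.finrank ℝ X) {lam : ℝ} (h0 : 0 ≤ lam) (h1 : lam < 1) {r : ℕ}
    {A : DiffOperator X (r + 1) V E} (hA : A.IsElliptic) (hA' : A.IsCanceling) (m : Fin r → X)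
    (i : Fin (Module.finrank ℝ V)) : ∃ C : ℝ≥0∞, C ≠ ⊤ ∧ ∀ J U F, HsRel A U F →
      (∀ i ξ, 𝓕 (U i) ξ ≠ 0 → hsTheta J ξ = 1) → ∑ p, ∫⁻ w, ‖F p w‖ₑ ≤ 1 →
      ∫⁻ x, ‖(∂^{m} (U i) : SchwartzMap X ℂ) x‖ₑ ^ (((Module.finrank ℝ X : ℝ) - lam) / ((Module.finrank ℝ X : ℝ) - 1))
        * ‖x‖ₑ ^ (-lam) ≤ C := by
  haveI : Nontrivial X := Module.nontrivial_of_finrank_pos (R := ℝ) (by omega)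
  obtain ⟨L, _, ω, e, e', hω, he, hee⟩ := hs_cancel hA'
  have hT := fun l => hs_tangential_rep (by omega) A (ω l) (hω l) (e l) (he l)
  choose τ m' hτ hrep using hT
  have hk1 := fun l => hs_kernel hn (hsMu_HsMul hA m (stdOrthonormalBasis ℝ V i) (e' l))
  choose B1 K1 hK1 hK1f using hk1
  have hk2 := fun l j p => hs_kernel hn (hsMu_HsMul hA (m' l j) (stdOrthonormalBasis ℝ V j.2) (stdOrthonormalBasis ℝ E p))
  choose B2 K2 hK2 hK2f using hk2
  set B : L → ℝ≥0 := fun l => B1 l + ∑ j, ∑ p, B2 l j p with hB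
  have hB1 : ∀ l, B1 l ≤ B l := fun l => le_self_add
  have hB2 : ∀ l j p, B2 l j p ≤ B l := fun l j p => by
    refine le_trans ?_ (le_add_self)
    exact (Finset.single_le_sum (f := fun p => B2 l j p) (fun _ _ => zero_le) (Finset.mem_univ p)).trans
      (Finset.single_le_sum (f := fun j => ∑ p, B2 l j p) (fun _ _ => zero_le) (Finset.mem_univ j))
  set T : L → ℝ≥0 := fun l => ∑ j, ‖τ l j‖₊ with hTdef
  have hT : ∀ l j, ‖τ l j‖ₑ ≤ T l := fun l j => by
    rw [enorm_eq_nnnorm]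
    exact_mod_cast Finset.single_le_sum (f := fun j => ‖τ l j‖₊) (fun _ _ => zero_le) (Finset.mem_univ j)
  have hS := fun l => hs_sliceX hn h0 h1 (B l) (T l) ‖e l‖₊
    ((Fin (r + 1) → Fin (Module.finrank ℝ X)) × Fin (Module.finrank ℝ V)) (Fin (Module.finrank ℝ E)) (ω l) (hω l)
  choose C hC HC using hS
  obtain ⟨C', hC', H'⟩ := hs_selfimprove hn h0 h1 (∑ l, C l) (ENNReal.sum_ne_top.2 fun l _ => hC l)
  refine ⟨C', hC', fun J U F hUF hU hF => ?_⟩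
  apply H'
  intro g hg
  have hv := hs_rep hA hUF hU e e' hee m i (fun l => K1 l J) (fun l ξ => hK1f l J ξ)
  have hl : ∀ l, ∫⁻ x : X, ‖hsConv (K1 l J) (hsDot (e l) F) x‖ₑ *
          (g x * ‖x‖ₑ ^ (-(lam * (((Module.finrank ℝ X : ℝ) - 1) / (Module.finrank ℝ X - lam))))) ≤
        C l * (1 + ∫⁻ x, g x ^ (((Module.finrank ℝ X : ℝ) - lam) / (1 - lam))) := by
    intro l
    refine HC l (K1 l J) (fun j p => K2 l j p J) (τ l) F (fun j => (∂^{m' l j} (U j.2) : SchwartzMap X ℂ)) _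
      ((hK1 l J).mono (hB1 l)) (fun j p => (hK2 l j p J).mono (hB2 l j p)) (hT l) (hτ l) ?_ (hrep l U F hUF) hF ?_ g hg
    · intro j
      have := hs_rep hA hUF hU (fun p => stdOrthonormalBasis ℝ E p) (fun p => stdOrthonormalBasis ℝ E p)
        (fun z => ((stdOrthonormalBasis ℝ E).sum_repr' z).symm) (m' l j) j.2 (fun p => K2 l j p J) (fun p ξ => hK2f l j p J ξ)
      simp only [hsDot_basis] at this
      exact this
    · refine (hsDot_L1 _ _).trans ?_
      exact (mul_le_mul' le_rfl hF).trans (by simp)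
  rw [hv, Finset.sum_mul]
  calc _ ≤ ∫⁻ x : X, ∑ l, ‖hsConv (K1 l J) (hsDot (e l) F) x‖ₑ *
          (g x * ‖x‖ₑ ^ (-(lam * (((Module.finrank ℝ X : ℝ) - 1) / (Module.finrank ℝ X - lam))))) := by
        refine lintegral_mono fun x => ?_
        rw [← Finset.sum_mul, SchwartzMap.sum_apply]
        exact mul_le_mul' (enorm_sum_le _ _) le_rfl
    _ = ∑ l, ∫⁻ x : X, ‖hsConv (K1 l J) (hsDot (e l) F) x‖ₑ *
          (g x * ‖x‖ₑ ^ (-(lam * (((Module.finrank ℝ X : ℝ) - 1) / (Module.finrank ℝ X - lam))))) := by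
        refine lintegral_finsetSum _ fun l _ => ?_
        have := (hsConv (K1 l J) (hsDot (e l) F)).continuous.measurable
        fun_prop
    _ ≤ _ := Finset.sum_le_sum fun l _ => hl l

end L5


section L6
open FourierTransform LineDeriv
variable {X : Type} [NormedAddCommGroup X] [InnerProductSpace ℝ X] [FiniteDimensional ℝ X]
  [MeasurableSpace X] [BorelSpace X]

theorem hsConv_L1 (K F : SchwartzMap X ℂ) :
    ∫⁻ x, ‖hsConv K F x‖ₑ ≤ (∫⁻ x, ‖K x‖ₑ) * ∫⁻ x, ‖F x‖ₑ := by
  calc _ ≤ ∫⁻ x, ∫⁻ w, ‖K (x - w)‖ₑ * ‖F w‖ₑ := by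
        refine lintegral_mono fun x => ?_
        rw [hsConv_apply]
        refine (enorm_integral_le_lintegral_enorm _).trans (le_of_eq ?_)
        simp only [enorm_mul]
    _ = ∫⁻ w, ∫⁻ x, ‖K (x - w)‖ₑ * ‖F w‖ₑ := by
        refine lintegral_lintegral_swap ?_
        have h1 : Measurable (fun p : X × X => ‖K (p.1 - p.2)‖ₑ) :=
          (K.continuous.comp (continuous_fst.sub continuous_snd)).measurable.enorm
        have h2 : Measurable (fun p : X × X => ‖F p.2‖ₑ) := (F.continuous.comp continuous_snd).measurable.enorm
        exact (h1.mul h2).aemeasurable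
    _ = ∫⁻ w, (∫⁻ x, ‖K x‖ₑ) * ‖F w‖ₑ := by
        refine lintegral_congr fun w => ?_
        rw [lintegral_mul_const' _ _ (by simp), lintegral_sub_right_eq_self (fun x => ‖K x‖ₑ)]
    _ = _ := lintegral_const_mul _ F.continuous.measurable.enorm

theorem hs_lintegral_schwartz_ne_top (f : SchwartzMap X ℂ) : ∫⁻ x, ‖f x‖ₑ ≠ ⊤ := f.integrable.2.ne

/-- Inverse Fourier transform of the bump. -/
def hsGam (X : Type) [NormedAddCommGroup X] [InnerProductSpace ℝ X] [FiniteDimensional ℝ X]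
  [MeasurableSpace X] [BorelSpace X] : SchwartzMap X ℂ :=
  𝓕⁻ (HasCompactSupport.toSchwartzMap (f := fun ξ : X => (hsBump X ξ : ℂ))
    (HasCompactSupport.comp_left (g := fun t : ℝ => (t:ℂ)) (hsBump X).hasCompactSupport (by simp))
    (Complex.ofRealCLM.contDiff.comp hsBump_contDiff))

theorem hsGam_fourier (ξ : X) : 𝓕 (hsGam X) ξ = hsBump X ξ := by
  rw [hsGam, FourierTransform.fourier_fourierInv_eq]
  rfl

theorem hs_gam_dil (c : ℝˣ) (hc : 0 < (c:ℝ)) : ∃ γ : SchwartzMap X ℂ, (∀ ξ, 𝓕 γ ξ = hsBump X ((c:ℝ)⁻¹ • ξ)) ∧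
    ∫⁻ x, ‖γ x‖ₑ = ∫⁻ x, ‖hsGam X x‖ₑ := by
  have hcn : 0 < (c:ℝ) ^ Module.finrank ℝ X := by positivity
  refine ⟨(((c:ℝ) ^ Module.finrank ℝ X : ℝ) : ℂ) • hsDil c (hsGam X), fun ξ => ?_, ?_⟩
  · rw [hs_fourier_smul, hsDil_fourier, hsGam_fourier, ← mul_assoc, abs_of_pos (by positivity), ← Complex.ofReal_mul,
      mul_inv_cancel₀ hcn.ne']
    simp
  · simp only [SchwartzMap.smul_apply, smul_eq_mul, enorm_mul, hsDil_apply]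
    rw [lintegral_const_mul' _ _ (by simp), hs_lintegral_comp_smul (fun x => ‖hsGam X x‖ₑ) hc, ← mul_assoc]
    have : ‖(((c:ℝ) ^ Module.finrank ℝ X : ℝ) : ℂ)‖ₑ = ENNReal.ofReal ((c:ℝ) ^ Module.finrank ℝ X) := by
      rw [← ofReal_norm, Complex.norm_real, Real.norm_of_nonneg hcn.le]
    rw [this, ← ENNReal.ofReal_mul hcn.le, mul_inv_cancel₀ hcn.ne']
    simp

theorem hs_Psi : ∃ G : ℝ≥0, 0 < G ∧ ∀ J : ℕ, ∃ Ψ : SchwartzMap X ℂ, (∀ ξ, 𝓕 Ψ ξ = hsTheta J ξ) ∧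
    ∫⁻ x, ‖Ψ x‖ₑ ≤ G := by
  refine ⟨(2 * ∫⁻ x, ‖hsGam X x‖ₑ).toNNReal + 1, by positivity, fun J => ?_⟩
  obtain ⟨γ1, h1, h1'⟩ := hs_gam_dil (X := X) (hsTwo (J + 1)) (by simp [hsTwo]; positivity)
  obtain ⟨γ2, h2, h2'⟩ := hs_gam_dil (X := X) (hsTwo (-J)) (by simp [hsTwo])
  refine ⟨γ1 - γ2, fun ξ => ?_, ?_⟩
  · have : 𝓕 (γ1 - γ2) ξ = 𝓕 γ1 ξ - 𝓕 γ2 ξ := by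
      have := map_sub (fourierCLM ℂ (SchwartzMap X ℂ)) γ1 γ2
      exact congrArg (fun g : SchwartzMap X ℂ => g ξ) this
    rw [this, h1, h2, hsTheta_eq]
    have e1 : ((hsTwo (J + 1) : ℝˣ) : ℝ) = 2 ^ (J + 1) := by simp [hsTwo]; norm_cast
    have e2 : ((hsTwo (-J) : ℝˣ) : ℝ)⁻¹ = 2 ^ J := by simp [hsTwo]
    rw [e1, e2]
    push_cast
    rfl
  · have h3 : (2 * ∫⁻ x, ‖hsGam X x‖ₑ) ≠ ⊤ := ENNReal.mul_ne_top (by simp) (hs_lintegral_schwartz_ne_top _)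
    push_cast
    rw [ENNReal.coe_toNNReal h3]
    refine le_trans ?_ le_self_add
    calc _ ≤ ∫⁻ x, (‖γ1 x‖ₑ + ‖γ2 x‖ₑ) := lintegral_mono fun x => by
          exact enorm_sub_le
      _ = _ := by
          rw [lintegral_add_left γ1.continuous.measurable.enorm, h1', h2', two_mul]

theorem hsTheta_abs_le (J : ℕ) (ξ : X) : |hsTheta J ξ| ≤ 1 := by
  rw [hsTheta_eq, abs_le]
  have := (hsBump X).nonneg (x := (((2:ℝ) ^ (J + 1))⁻¹ • ξ))
  have := (hsBump X).nonneg (x := ((2:ℝ) ^ J • ξ))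
  have := (hsBump X).le_one (x := (((2:ℝ) ^ (J + 1))⁻¹ • ξ))
  have := (hsBump X).le_one (x := ((2:ℝ) ^ J • ξ))
  constructor <;> linarith

theorem hsTheta_eq_one {J : ℕ} {ξ : X} (h1 : 2 ≤ 2 ^ J * ‖ξ‖) (h2 : ‖ξ‖ ≤ 2 ^ (J + 1)) : hsTheta J ξ = 1 := by
  rw [hsTheta_eq, hsBump_one, hsBump_zero]
  · simp
  · rw [norm_smul]; simpa using h1
  · rw [norm_smul, norm_inv, norm_pow, Real.norm_ofNat, inv_mul_le_iff₀ (by positivity)]; simpa using h2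

theorem hsTheta_supp {J : ℕ} {ξ : X} (h : hsTheta J ξ ≠ 0) : hsTheta (J + 2) ξ = 1 := by
  have h1 : 1 < 2 ^ J * ‖ξ‖ := by
    by_contra! h'
    apply h
    rw [hsTheta_eq, hsBump_one, hsBump_one]
    · simp
    · rw [norm_smul]; simpa using h'
    · rw [norm_smul, norm_inv, norm_pow, Real.norm_ofNat, inv_mul_le_iff₀ (by positivity)]
      simp
      have h2J : (1:ℝ) ≤ 2 ^ J := one_le_pow₀ (by norm_num)
      have h3 : ‖ξ‖ ≤ 1 := by nlinarith [norm_nonneg ξ]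
      refine h3.trans (one_le_pow₀ (by norm_num))
  have h2 : ‖ξ‖ < 2 ^ (J + 2) := by
    by_contra! h'
    apply h
    have h2J : (1:ℝ) ≤ 2 ^ J := one_le_pow₀ (by norm_num)
    rw [hsTheta_eq, hsBump_zero, hsBump_zero]
    · simp
    · rw [norm_smul]; simp
      rw [pow_add] at h'
      nlinarith
    · rw [norm_smul, norm_inv, norm_pow, Real.norm_ofNat, le_inv_mul_iff₀ (by positivity)]
      rw [← pow_succ]; exact h'
  apply hsTheta_eq_one
  · rw [pow_add]; nlinarith
  · exact h2.le.trans (pow_le_pow_right₀ (by norm_num) (by omega))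

theorem hsTheta_tendsto {ξ : X} (hξ : ξ ≠ 0) : Filter.Tendsto (fun J => hsTheta J ξ) Filter.atTop (nhds 1) := by
  have hξn : 0 < ‖ξ‖ := norm_pos_iff.2 hξ
  have ht : Filter.Tendsto (fun J : ℕ => (2:ℝ) ^ J) Filter.atTop Filter.atTop := tendsto_pow_atTop_atTop_of_one_lt (by norm_num)
  refine tendsto_const_nhds.congr' ?_
  filter_upwards [ht.eventually_ge_atTop (2 / ‖ξ‖), ht.eventually_ge_atTop ‖ξ‖] with J h1 h2
  symm
  apply hsTheta_eq_one
  · rwa [div_le_iff₀ hξn] at h1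
  · exact h2.trans (pow_le_pow_right₀ (by norm_num) (by omega))

theorem hs_smooth_tendsto [Nontrivial X] (Ψ : ℕ → SchwartzMap X ℂ) (hΨ : ∀ J ξ, 𝓕 (Ψ J) ξ = hsTheta J ξ)
    (f : SchwartzMap X ℂ) (x : X) :
    Filter.Tendsto (fun J => hsConv (Ψ J) f x) Filter.atTop (nhds (f x)) := by
  have key : ∀ g : SchwartzMap X ℂ, g x = ∫ ξ, Real.fourierChar (inner ℝ ξ x) • 𝓕 g ξ := by
    intro g
    have : 𝓕⁻ (𝓕 g) = g := FourierTransform.fourierInv_fourier_eq g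
    conv_lhs => rw [← this]
    rw [SchwartzMap.fourierInv_coe, Real.fourierInv_eq]
  rw [key f]
  simp only [key (hsConv _ _), hsConv_fourier, hΨ]
  refine tendsto_integral_of_dominated_convergence (fun ξ => ‖𝓕 f ξ‖) ?_ ?_ ?_ ?_
  · intro J
    refine Continuous.aestronglyMeasurable ?_
    have : (fun ξ : X => ((hsTheta J ξ : ℝ) : ℂ) * 𝓕 f ξ) = fun ξ => 𝓕 (Ψ J) ξ * 𝓕 f ξ := by ext ξ; rw [hΨ]
    have h2 : Continuous (fun ξ : X => ((hsTheta J ξ : ℝ) : ℂ) * 𝓕 f ξ) := by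
      rw [this]; exact (𝓕 (Ψ J)).continuous.mul (𝓕 f).continuous
    exact (Real.continuous_fourierChar.comp (by fun_prop)).smul h2
  · exact (𝓕 f).integrable.norm
  · intro J
    refine Filter.Eventually.of_forall fun ξ => ?_
    rw [Circle.norm_smul, norm_mul, Complex.norm_real]
    exact mul_le_of_le_one_left (norm_nonneg _) (hsTheta_abs_le J ξ)
  · filter_upwards [hs_ae_ne_zero (Y := X)] with ξ hξ
    have h1 : Filter.Tendsto (fun J => ((hsTheta J ξ : ℝ) : ℂ)) Filter.atTop (nhds 1) := by
      have := (Complex.continuous_ofReal.tendsto 1).comp (hsTheta_tendsto hξ)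
      rw [Complex.ofReal_one] at this
      exact this
    have h2 := (h1.mul_const (𝓕 f ξ)).const_smul (Real.fourierChar (inner ℝ ξ x))
    simpa using h2

universe hsv hse
variable {V : Type hsv} {E : Type hse} [NormedAddCommGroup V] [InnerProductSpace ℝ V] [FiniteDimensional ℝ V]
    [NormedAddCommGroup E] [InnerProductSpace ℝ E] [FiniteDimensional ℝ E]

theorem HsRel.smul {k : ℕ} {A : DiffOperator X k V E} {U F} (h : HsRel A U F) (c : ℂ) :
    HsRel A (fun i => c • U i) (fun p => c • F p) := by
  intro p ξ
  simp only [hs_fourier_smul, h p ξ, Finset.mul_sum]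
  refine Finset.sum_congr rfl fun i _ => ?_
  ring

theorem HsRel.conv {k : ℕ} {A : DiffOperator X k V E} {U F} (h : HsRel A U F) (K : SchwartzMap X ℂ) :
    HsRel A (fun i => hsConv K (U i)) (fun p => hsConv K (F p)) := by
  intro p ξ
  simp only [hsConv_fourier, h p ξ, Finset.mul_sum]
  refine Finset.sum_congr rfl fun i _ => ?_
  ring

/-- Liminf argument -/
theorem hs_fatou {q lam : ℝ} (hq : 0 ≤ q) (C : ℝ≥0∞) (v : ℕ → X → ℂ) (hv : ∀ J, Measurable (v J)) (w : X → ℂ)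
    (ht : ∀ᵐ x, Filter.Tendsto (fun J => v J x) Filter.atTop (nhds (w x)))
    (hC : ∀ J, ∫⁻ x, ‖v J x‖ₑ ^ q * ‖x‖ₑ ^ (-lam) ≤ C) [Nontrivial X] :
    ∫⁻ x, ‖w x‖ₑ ^ q * ‖x‖ₑ ^ (-lam) ≤ C := by
  calc _ ≤ ∫⁻ x, Filter.liminf (fun J => ‖v J x‖ₑ ^ q * ‖x‖ₑ ^ (-lam)) Filter.atTop := by
        refine lintegral_mono_ae ?_
        filter_upwards [ht, hs_ae_ne_zero (Y := X)] with x hx hx0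
        apply le_of_eq
        symm
        apply Filter.Tendsto.liminf_eq
        refine ENNReal.Tendsto.mul_const ?_ (Or.inr ?_)
        · exact (ENNReal.continuous_rpow_const.tendsto _).comp ((continuous_enorm.tendsto _).comp hx)
        · have : ‖x‖ₑ ≠ 0 := by simpa using hx0
          exact ENNReal.rpow_ne_top_of_ne_zero this (by simp)
    _ ≤ Filter.liminf (fun J => ∫⁻ x, ‖v J x‖ₑ ^ q * ‖x‖ₑ ^ (-lam)) Filter.atTop := by
        refine lintegral_liminf_le fun J => ?_
        have := hv J
        fun_prop
    _ ≤ C := by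
        refine Filter.liminf_le_of_le (by isBoundedDefault) fun b hb => ?_
        obtain ⟨J, hJ⟩ := hb.exists
        exact hJ.trans (hC J)

/-- Normalised coordinate inequality. -/
def HsCSI {r : ℕ} (A : DiffOperator X (r + 1) V E) (lam : ℝ) : Prop :=
  ∀ (m : Fin r → X) (i : Fin (Module.finrank ℝ V)), ∃ C : ℝ≥0∞, C ≠ ⊤ ∧ ∀ U F, HsRel A U F →
      ∑ p, ∫⁻ w, ‖F p w‖ₑ ≤ 1 →
      ∫⁻ x, ‖(∂^{m} (U i) : SchwartzMap X ℂ) x‖ₑ ^ (((Module.finrank ℝ X : ℝ) - lam) / ((Module.finrank ℝ X : ℝ) - 1))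
        * ‖x‖ₑ ^ (-lam) ≤ C

theorem hs_L6 (hn : 2 ≤ Module.finrank ℝ X) {lam : ℝ} (h0 : 0 ≤ lam) (h1 : lam < 1) {r : ℕ}
    {A : DiffOperator X (r + 1) V E} (hA : A.IsElliptic) (hA' : A.IsCanceling) : HsCSI A lam := by
  intro m i
  haveI : Nontrivial X := Module.nontrivial_of_finrank_pos (R := ℝ) (by omega)
  have hn' : (2:ℝ) ≤ Module.finrank ℝ X := by exact_mod_cast hn
  obtain ⟨C, hC, H⟩ := hs_L5 hn h0 h1 hA hA' m i
  obtain ⟨G, hG, HG⟩ := hs_Psi (X := X)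
  choose Ψ hΨ hΨ1 using HG
  set q := (((Module.finrank ℝ X : ℝ) - lam) / ((Module.finrank ℝ X : ℝ) - 1)) with hq
  have hq0 : 0 ≤ q := div_nonneg (by linarith) (by linarith)
  have hGe : ‖((G:ℝ) : ℂ)‖ₑ = G := by
    rw [← ofReal_norm, Complex.norm_real, Real.norm_of_nonneg (by positivity)]; simp
  have hG0 : (G:ℝ≥0∞) ≠ 0 := by simpa using hG.ne'
  refine ⟨(G:ℝ≥0∞) ^ q * C, ENNReal.mul_ne_top (ENNReal.rpow_ne_top_of_nonneg hq0 (by simp)) hC, fun U F hUF hF => ?_⟩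
  refine hs_fatou hq0 _ (fun J => hsConv (Ψ J) (∂^{m} (U i) : SchwartzMap X ℂ)) (fun J => (hsConv _ _).continuous.measurable) _
    (Filter.Eventually.of_forall fun x => hs_smooth_tendsto Ψ hΨ _ x) fun J => ?_
  have hcomm : ∀ c : ℂ, (∂^{m} (c • hsConv (Ψ J) (U i)) : SchwartzMap X ℂ) = c • hsConv (Ψ J) (∂^{m} (U i) : SchwartzMap X ℂ) := by
    intro c
    apply hs_fourier_inj
    intro ξ
    rw [hs_fourier_iter, hs_fourier_smul, hs_fourier_smul, hsConv_fourier, hsConv_fourier, hs_fourier_iter]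
    ring
  have h := H (J + 2) _ _ ((hUF.conv (Ψ J)).smul (((G:ℝ) : ℂ)⁻¹)) ?_ ?_
  · simp only [hcomm, SchwartzMap.smul_apply, smul_eq_mul, enorm_mul, ENNReal.mul_rpow_of_nonneg _ _ hq0] at h
    simp only [mul_assoc] at h
    rw [lintegral_const_mul' _ _ (ENNReal.rpow_ne_top_of_nonneg hq0 (by simp)), enorm_inv, hGe, ENNReal.inv_rpow] at h
    · rw [ENNReal.inv_mul_le_iff] at h
      · exact h
      · exact (ENNReal.rpow_pos (pos_iff_ne_zero.2 hG0) (by simp)).ne'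
      · exact ENNReal.rpow_ne_top_of_nonneg hq0 (by simp)
    · simpa using hG.ne'
  · intro i ξ hξ
    apply hsTheta_supp
    rintro h0
    apply hξ
    rw [hs_fourier_smul, hsConv_fourier, hΨ, h0]
    simp
  · have : ∀ p, ∫⁻ w, ‖((((G:ℝ) : ℂ)⁻¹) • hsConv (Ψ J) (F p)) w‖ₑ ≤ ∫⁻ w, ‖F p w‖ₑ := by
      intro p
      simp only [SchwartzMap.smul_apply, smul_eq_mul, enorm_mul]
      rw [lintegral_const_mul' _ _ (by simp), enorm_inv (by simpa using hG.ne'), hGe, ENNReal.inv_mul_le_iff hG0 (by simp)]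
      exact (hsConv_L1 _ _).trans (mul_le_mul' (hΨ1 J) le_rfl)
    exact (Finset.sum_le_sum fun p _ => this p).trans hF

end L6


section L2
open FourierTransform LineDeriv
variable {X : Type} [NormedAddCommGroup X] [InnerProductSpace ℝ X] [FiniteDimensional ℝ X]
  [MeasurableSpace X] [BorelSpace X]
universe hsv hse
variable {V : Type hsv} {E : Type hse} [NormedAddCommGroup V] [InnerProductSpace ℝ V] [FiniteDimensional ℝ V]
    [NormedAddCommGroup E] [InnerProductSpace ℝ E] [FiniteDimensional ℝ E]

theorem hsPol_sum {k : ℕ} (A : DiffOperator X k V E) (w : Fin k → X) {ι : Type} [Fintype ι] (a : ι → ℝ) (v : ι → V) :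
    hsPol A w (∑ i, a i • v i) = ∑ i, a i • hsPol A w (v i) := by
  unfold hsPol
  simp only [← map_smul, ← map_sum]
  congr 1
  ext m
  simp only [ContinuousMultilinearMap.sum_apply, ContinuousMultilinearMap.smul_apply,
    ContinuousMultilinearMap.smulRight_apply, Finset.smul_sum]
  exact Finset.sum_congr rfl fun i _ => smul_comm _ _ _

theorem hs_cmm_expand {k : ℕ} {ι : Type} [Fintype ι] (b : OrthonormalBasis ι ℝ X)
    (T : ContinuousMultilinearMap ℝ (fun _ : Fin k => X) V) :
    T = ∑ c : Fin k → ι, (((ContinuousMultilinearMap.mkPiAlgebra ℝ (Fin k) ℝ).compContinuousLinearMap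
      (fun l => innerSL ℝ (b (c l)))).smulRight (T fun l => b (c l))) := by
  classical
  ext m
  have h1 : m = fun l => ∑ j, inner ℝ (b j) (m l) • b j := by
    ext1 l; exact (b.sum_repr' (m l)).symm
  conv_lhs => rw [h1]
  rw [ContinuousMultilinearMap.map_sum, ContinuousMultilinearMap.sum_apply]
  refine Finset.sum_congr rfl fun c _ => ?_
  rw [ContinuousMultilinearMap.map_smul_univ]
  simp

theorem hs_A_expand {k : ℕ} {ι : Type} [Fintype ι] (b : OrthonormalBasis ι ℝ X) (A : DiffOperator X k V E)
    (T : ContinuousMultilinearMap ℝ (fun _ : Fin k => X) V) :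
    A T = ∑ c : Fin k → ι, hsPol A (fun l => b (c l)) (T fun l => b (c l)) := by
  conv_lhs => rw [hs_cmm_expand b T]
  rw [map_sum]
  rfl

theorem hs_cmm_norm {k : ℕ} {ι : Type} [Fintype ι] (b : OrthonormalBasis ι ℝ X)
    (T : ContinuousMultilinearMap ℝ (fun _ : Fin k => X) V) :
    ‖T‖ ≤ ∑ c : Fin k → ι, ‖T fun l => b (c l)‖ := by
  refine ContinuousMultilinearMap.opNorm_le_bound (by positivity) fun m => ?_
  conv_lhs => rw [hs_cmm_expand b T]
  rw [ContinuousMultilinearMap.sum_apply, Finset.sum_mul]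
  refine (norm_sum_le _ _).trans (Finset.sum_le_sum fun c _ => ?_)
  simp only [ContinuousMultilinearMap.smulRight_apply, ContinuousMultilinearMap.compContinuousLinearMap_apply,
    ContinuousMultilinearMap.mkPiAlgebra_apply, innerSL_apply_apply, norm_smul]
  rw [mul_comm]
  refine mul_le_mul_of_nonneg_left ?_ (norm_nonneg _)
  rw [norm_prod]
  refine Finset.prod_le_prod (fun _ _ => norm_nonneg _) fun l _ => ?_
  refine (norm_inner_le_norm _ _).trans ?_
  simp

/-- The operator acting on tuples of Schwartz functions -/
def hsApp {k : ℕ} (A : DiffOperator X k V E) (U : Fin (Module.finrank ℝ V) → SchwartzMap X ℂ)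
    (p : Fin (Module.finrank ℝ E)) : SchwartzMap X ℂ :=
  ∑ c : Fin k → Fin (Module.finrank ℝ X), ∑ i,
    ((inner ℝ (stdOrthonormalBasis ℝ E p) (hsPol A (fun l => stdOrthonormalBasis ℝ X (c l)) (stdOrthonormalBasis ℝ V i)) : ℝ) : ℂ) •
      (∂^{fun l => stdOrthonormalBasis ℝ X (c l)} (U i) : SchwartzMap X ℂ)

theorem hsApp_rel {k : ℕ} (A : DiffOperator X k V E) (U : Fin (Module.finrank ℝ V) → SchwartzMap X ℂ) :
    HsRel A U (hsApp A U) := by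
  intro p ξ
  rw [hsApp, hs_fourier_sum]
  simp only [hs_fourier_sum, hs_fourier_smul, hs_fourier_iter]
  rw [Finset.sum_comm, Finset.mul_sum]
  refine Finset.sum_congr rfl fun i _ => ?_
  rw [hs_symbol_expand A (stdOrthonormalBasis ℝ X), inner_sum]
  simp only [inner_smul_right]
  push_cast
  rw [Finset.sum_mul, Finset.mul_sum]
  refine Finset.sum_congr rfl fun c _ => ?_
  ring

theorem HsRel.eq_hsApp {k : ℕ} {A : DiffOperator X k V E} {U F} (h : HsRel A U F) : F = hsApp A U := by
  ext1 p
  apply hs_fourier_inj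
  intro ξ
  rw [h p ξ, hsApp_rel A U p ξ]

/-- real vector valued function built from Schwartz functions -/
def hsVec (ρ : ℂ →L[ℝ] ℝ) (W : Fin (Module.finrank ℝ V) → SchwartzMap X ℂ) (x : X) : V :=
  ∑ i, ρ (W i x) • stdOrthonormalBasis ℝ V i

theorem hsVec_iter (ρ : ℂ →L[ℝ] ℝ) (W : Fin (Module.finrank ℝ V) → SchwartzMap X ℂ) {k : ℕ} (m : Fin k → X) (x : X) :
    iteratedFDeriv ℝ k (hsVec ρ W : X → V) x m =
      ∑ i, ρ ((∂^{m} (W i) : SchwartzMap X ℂ) x) • stdOrthonormalBasis ℝ V i := by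
  have e : (hsVec ρ W : X → V) = fun x => ∑ i, (⇑(ρ.smulRight (stdOrthonormalBasis ℝ V i)) ∘ (W i)) x := by
    ext x; simp [hsVec]
  rw [e]
  rw [iteratedFDeriv_fun_sum_apply (fun i _ => ((ρ.smulRight (stdOrthonormalBasis ℝ V i)).contDiff.comp ((W i).smooth k)).contDiffAt)]
  rw [ContinuousMultilinearMap.sum_apply]
  refine Finset.sum_congr rfl fun i _ => ?_
  rw [ContinuousLinearMap.iteratedFDeriv_comp_left _ ((W i).smooth k).contDiffAt le_rfl]
  rw [SchwartzMap.iteratedLineDerivOp_eq_iteratedFDeriv]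
  simp

theorem hsVec_app (ρ : ℂ →L[ℝ] ℝ) (W : Fin (Module.finrank ℝ V) → SchwartzMap X ℂ) {k : ℕ} (A : DiffOperator X k V E)
    (p : Fin (Module.finrank ℝ E)) (x : X) :
    inner ℝ (stdOrthonormalBasis ℝ E p) (A.app (hsVec ρ W) x) = ρ (hsApp A W p x) := by
  rw [DiffOperator.app, hs_A_expand (stdOrthonormalBasis ℝ X), inner_sum, hsApp, SchwartzMap.sum_apply, map_sum]
  refine Finset.sum_congr rfl fun c _ => ?_
  rw [SchwartzMap.sum_apply, map_sum, hsVec_iter, hsPol_sum, inner_sum]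
  refine Finset.sum_congr rfl fun i _ => ?_
  rw [inner_smul_right, SchwartzMap.smul_apply, smul_eq_mul, ← Complex.real_smul, map_smul, smul_eq_mul, mul_comm]

end L2


section L2b
open FourierTransform LineDeriv
variable {X : Type} [NormedAddCommGroup X] [InnerProductSpace ℝ X] [FiniteDimensional ℝ X]
  [MeasurableSpace X] [BorelSpace X]
universe hsv hse
variable {V : Type hsv} {E : Type hse} [NormedAddCommGroup V] [InnerProductSpace ℝ V] [FiniteDimensional ℝ V]
    [NormedAddCommGroup E] [InnerProductSpace ℝ E] [FiniteDimensional ℝ E]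

theorem hs_iter_smul {r : ℕ} (m : Fin r → X) (c : ℂ) (f : SchwartzMap X ℂ) :
    (∂^{m} (c • f) : SchwartzMap X ℂ) = c • (∂^{m} f : SchwartzMap X ℂ) := by
  apply hs_fourier_inj
  intro ξ
  simp only [hs_fourier_iter, hs_fourier_smul]
  ring

theorem hs_csi_hom (hn : 2 ≤ Module.finrank ℝ X) {lam : ℝ} (h1 : lam < 1) {r : ℕ}
    {A : DiffOperator X (r + 1) V E} (h : HsCSI A lam) (m : Fin r → X) (i : Fin (Module.finrank ℝ V)) :
    ∃ C : ℝ≥0∞, C ≠ ⊤ ∧ ∀ U F, HsRel A U F →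
      ∫⁻ x, ‖(∂^{m} (U i) : SchwartzMap X ℂ) x‖ₑ ^ (((Module.finrank ℝ X : ℝ) - lam) / ((Module.finrank ℝ X : ℝ) - 1))
        * ‖x‖ₑ ^ (-lam) ≤ C * (∑ p, ∫⁻ w, ‖F p w‖ₑ) ^ (((Module.finrank ℝ X : ℝ) - lam) / ((Module.finrank ℝ X : ℝ) - 1)) := by
  obtain ⟨C, hC, H⟩ := h m i
  refine ⟨C, hC, fun U F hUF => ?_⟩
  have hn' : (2:ℝ) ≤ Module.finrank ℝ X := by exact_mod_cast hn
  have hq : 0 ≤ ((Module.finrank ℝ X : ℝ) - lam) / ((Module.finrank ℝ X : ℝ) - 1) :=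
    div_nonneg (by linarith) (by linarith)
  set q := ((Module.finrank ℝ X : ℝ) - lam) / ((Module.finrank ℝ X : ℝ) - 1) with hqdef
  clear_value q
  set S := ∑ p, ∫⁻ w, ‖F p w‖ₑ with hS
  have hSt : S ≠ ⊤ := by
    rw [hS]; exact (ENNReal.sum_ne_top).2 fun p _ => hs_lintegral_schwartz_ne_top _
  have key : ∀ s : ℝ, S.toReal < s → ∫⁻ x, ‖(∂^{m} (U i) : SchwartzMap X ℂ) x‖ₑ ^ q * ‖x‖ₑ ^ (-lam) ≤
      C * ENNReal.ofReal s ^ q := by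
    intro s hs
    have hs0 : 0 < s := lt_of_le_of_lt ENNReal.toReal_nonneg hs
    have hes : ‖((s⁻¹ : ℝ) : ℂ)‖ₑ = (ENNReal.ofReal s)⁻¹ := by
      rw [← ofReal_norm, Complex.norm_real, Real.norm_of_nonneg (by positivity), ENNReal.ofReal_inv_of_pos hs0]
    have hse0 : ENNReal.ofReal s ≠ 0 := by simpa using hs0
    have h2 := H _ _ (hUF.smul ((s⁻¹ : ℝ) : ℂ)) (by
      simp only [SchwartzMap.smul_apply, smul_eq_mul, enorm_mul, hes]
      simp only [lintegral_const_mul' _ _ (ENNReal.inv_ne_top.2 hse0)]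
      rw [← Finset.mul_sum, mul_comm, ← div_eq_mul_inv]
      refine ENNReal.div_le_of_le_mul ?_
      rw [one_mul]
      exact (ENNReal.le_ofReal_iff_toReal_le hSt hs0.le).2 hs.le)
    simp only [hs_iter_smul, SchwartzMap.smul_apply, smul_eq_mul, enorm_mul, hes, ENNReal.mul_rpow_of_nonneg _ _ hq,
      mul_assoc] at h2
    rw [lintegral_const_mul' _ _ (ENNReal.rpow_ne_top_of_nonneg hq (ENNReal.inv_ne_top.2 hse0)),
      ENNReal.inv_rpow, mul_comm, ← div_eq_mul_inv] at h2
    rwa [ENNReal.div_le_iff_le_mul (Or.inl _) (Or.inl _)] at h2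
    · exact (ENNReal.rpow_pos (pos_iff_ne_zero.2 hse0) (by simp)).ne'
    · exact ENNReal.rpow_ne_top_of_nonneg hq (by simp)
  have ht : Filter.Tendsto (fun s : ℝ => C * ENNReal.ofReal s ^ q) (nhdsWithin S.toReal (Set.Ioi S.toReal))
      (nhds (C * S ^ q)) := by
    refine ENNReal.Tendsto.const_mul ?_ (Or.inr hC)
    have : Filter.Tendsto (fun s : ℝ => ENNReal.ofReal s ^ q) (nhds S.toReal) (nhds (ENNReal.ofReal S.toReal ^ q)) :=
      ((ENNReal.continuous_rpow_const).comp ENNReal.continuous_ofReal).continuousAt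
    rw [ENNReal.ofReal_toReal hSt] at this
    exact this.mono_left nhdsWithin_le_nhds
  exact ge_of_tendsto ht (by filter_upwards [self_mem_nhdsWithin] with s hs using key s hs)

theorem hs_ineq_of_csi (hn : 2 ≤ Module.finrank ℝ X) {lam : ℝ} (h1 : lam < 1) {r : ℕ}
    {A : DiffOperator X (r + 1) V E} (h : HsCSI A lam) :
    ∃ C : ℝ≥0∞, C ≠ ⊤ ∧ ∀ u : X → V, IsTestFun u →
      ∫⁻ x, ‖iteratedFDeriv ℝ r u x‖ₑ ^ (((Module.finrank ℝ X : ℝ) - lam) / ((Module.finrank ℝ X : ℝ) - 1))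
        * ‖x‖ₑ ^ (-lam) ≤ C * (∫⁻ x, ‖A.app u x‖ₑ) ^ (((Module.finrank ℝ X : ℝ) - lam) / ((Module.finrank ℝ X : ℝ) - 1)) := by
  have h2 := fun m i => hs_csi_hom hn h1 h m i
  choose C hC H using h2
  have hn' : (2:ℝ) ≤ Module.finrank ℝ X := by exact_mod_cast hn
  have hq1 : 1 ≤ ((Module.finrank ℝ X : ℝ) - lam) / ((Module.finrank ℝ X : ℝ) - 1) := by
    rw [le_div_iff₀ (by linarith)]; linarith
  set q := ((Module.finrank ℝ X : ℝ) - lam) / ((Module.finrank ℝ X : ℝ) - 1) with hqdef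
  clear_value q
  have hq : 0 ≤ q := by linarith
  set bX := stdOrthonormalBasis ℝ X
  set M : ℝ≥0∞ := ((Finset.univ : Finset ((Fin r → Fin (Module.finrank ℝ X)) × Fin (Module.finrank ℝ V))).card : ℝ≥0∞) ^ (q - 1)
  have hM : M ≠ ⊤ := ENNReal.rpow_ne_top_of_nonneg (by linarith) (ENNReal.natCast_ne_top _)
  set T : ℝ≥0∞ := ∑ j : (Fin r → Fin (Module.finrank ℝ X)) × Fin (Module.finrank ℝ V), C (fun l => bX (j.1 l)) j.2
  have hT : T ≠ ⊤ := ENNReal.sum_ne_top.2 fun _ _ => hC _ _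
  refine ⟨M * T * (Module.finrank ℝ E : ℝ≥0∞) ^ q, ENNReal.mul_ne_top (ENNReal.mul_ne_top hM hT)
    (ENNReal.rpow_ne_top_of_nonneg hq (by simp)), fun u hu => ?_⟩
  let W : Fin (Module.finrank ℝ V) → SchwartzMap X ℂ := fun i =>
    HasCompactSupport.toSchwartzMap (f := fun x => ((inner ℝ (stdOrthonormalBasis ℝ V i) (u x) : ℝ) : ℂ))
      (HasCompactSupport.comp_left (g := fun v : V => ((inner ℝ (stdOrthonormalBasis ℝ V i) v : ℝ) : ℂ)) hu.2 (by simp))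
      (Complex.ofRealCLM.contDiff.comp ((innerSL ℝ (stdOrthonormalBasis ℝ V i)).contDiff.comp hu.1))
  have hWa : ∀ i x, W i x = ((inner ℝ (stdOrthonormalBasis ℝ V i) (u x) : ℝ) : ℂ) := fun i x => rfl
  clear_value W
  have hre : hsVec Complex.reCLM W = u := by
    ext x
    simp only [hsVec, hWa, Complex.reCLM_apply, Complex.ofReal_re]
    exact (stdOrthonormalBasis ℝ V).sum_repr' (u x)
  have him : (hsVec Complex.imCLM W : X → V) = fun _ => 0 := by
    ext x
    simp [hsVec, hWa]
  have hF : ∀ p x, hsApp A W p x = ((inner ℝ (stdOrthonormalBasis ℝ E p) (A.app u x) : ℝ) : ℂ) := by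
    intro p x
    have e1 := hsVec_app Complex.reCLM W A p x
    have e2 := hsVec_app Complex.imCLM W A p x
    rw [hre] at e1
    rw [him, DiffOperator.app, iteratedFDeriv_zero_fun] at e2
    apply Complex.ext
    · rw [Complex.ofReal_re, e1]; rfl
    · rw [Complex.ofReal_im]; simpa using e2.symm
  have hFn : ∑ p, ∫⁻ w, ‖hsApp A W p w‖ₑ ≤ Module.finrank ℝ E * ∫⁻ x, ‖A.app u x‖ₑ := by
    calc _ ≤ ∑ p : Fin (Module.finrank ℝ E), ∫⁻ x, ‖A.app u x‖ₑ := by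
          refine Finset.sum_le_sum fun p _ => lintegral_mono fun x => ?_
          rw [hF, ← ofReal_norm, ← ofReal_norm, Complex.norm_real]
          refine ENNReal.ofReal_le_ofReal ((norm_inner_le_norm _ _).trans ?_)
          simp
      _ = _ := by simp
  have hpt : ∀ x, ‖iteratedFDeriv ℝ r u x‖ₑ ≤ ∑ j : (Fin r → Fin (Module.finrank ℝ X)) × Fin (Module.finrank ℝ V),
      ‖(∂^{fun l => bX (j.1 l)} (W j.2) : SchwartzMap X ℂ) x‖ₑ := by
    intro x
    have : ‖iteratedFDeriv ℝ r u x‖ ≤ ∑ j : (Fin r → Fin (Module.finrank ℝ X)) × Fin (Module.finrank ℝ V),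
        ‖(∂^{fun l => bX (j.1 l)} (W j.2) : SchwartzMap X ℂ) x‖ := by
      refine (hs_cmm_norm bX _).trans ?_
      rw [Fintype.sum_prod_type]
      refine Finset.sum_le_sum fun c _ => ?_
      rw [← hre, hsVec_iter]
      refine (norm_sum_le _ _).trans (Finset.sum_le_sum fun i _ => ?_)
      rw [norm_smul, OrthonormalBasis.norm_eq_one, mul_one]
      exact Complex.abs_re_le_norm _
    rw [← ofReal_norm]
    refine (ENNReal.ofReal_le_ofReal this).trans ?_
    rw [ENNReal.ofReal_sum_of_nonneg (fun _ _ => norm_nonneg _)]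
    simp only [ofReal_norm, le_refl]
  calc _ ≤ ∫⁻ x, M * ∑ j : (Fin r → Fin (Module.finrank ℝ X)) × Fin (Module.finrank ℝ V),
        ‖(∂^{fun l => bX (j.1 l)} (W j.2) : SchwartzMap X ℂ) x‖ₑ ^ q * ‖x‖ₑ ^ (-lam) := by
        refine lintegral_mono fun x => ?_
        simp only []
        rw [← Finset.sum_mul, ← mul_assoc]
        refine mul_le_mul' ((ENNReal.rpow_le_rpow (hpt x) hq).trans ?_) le_rfl
        exact ENNReal.rpow_sum_le_const_mul_sum_rpow _ _ hq1
    _ = M * ∑ j : (Fin r → Fin (Module.finrank ℝ X)) × Fin (Module.finrank ℝ V),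
        ∫⁻ x, ‖(∂^{fun l => bX (j.1 l)} (W j.2) : SchwartzMap X ℂ) x‖ₑ ^ q * ‖x‖ₑ ^ (-lam) := by
        rw [lintegral_const_mul' _ _ hM, lintegral_finsetSum _ (fun p _ => ?_)]
        exact ((SchwartzMap.continuous _).measurable.enorm.pow_const q).mul (measurable_enorm.pow_const _)
    _ ≤ M * ∑ j : (Fin r → Fin (Module.finrank ℝ X)) × Fin (Module.finrank ℝ V),
        C (fun l => bX (j.1 l)) j.2 * (Module.finrank ℝ E * ∫⁻ x, ‖A.app u x‖ₑ) ^ q := by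
        refine mul_le_mul' le_rfl (Finset.sum_le_sum fun j _ => ?_)
        refine (H _ _ W _ (hsApp_rel A W)).trans ?_
        exact mul_le_mul' le_rfl (ENNReal.rpow_le_rpow hFn hq)
    _ = _ := by
        rw [← Finset.sum_mul, ENNReal.mul_rpow_of_nonneg _ _ hq]; ring

end L2b


section L1
open FourierTransform LineDeriv
variable {X : Type} [NormedAddCommGroup X] [InnerProductSpace ℝ X] [FiniteDimensional ℝ X]
  [MeasurableSpace X] [BorelSpace X]
universe hsv hse
variable {V : Type hsv} {E : Type hse} [NormedAddCommGroup V] [InnerProductSpace ℝ V] [FiniteDimensional ℝ V]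
    [NormedAddCommGroup E] [InnerProductSpace ℝ E] [FiniteDimensional ℝ E]

/-- Multiplication by a dilated cutoff. -/
def hsCut (c : ℝˣ) (χ f : SchwartzMap X ℂ) : SchwartzMap X ℂ :=
  SchwartzMap.pairing (ContinuousLinearMap.mul ℂ ℂ) (hsDil c χ) f

theorem hsCut_apply (c : ℝˣ) (χ f : SchwartzMap X ℂ) (x : X) : hsCut c χ f x = χ ((c:ℝ) • x) * f x := by
  rw [hsCut, SchwartzMap.pairing_apply_apply, hsDil_apply]; rfl

theorem hsCut_deriv (c : ℝˣ) (χ f : SchwartzMap X ℂ) (m : X) :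
    (∂_{m} (hsCut c χ f) : SchwartzMap X ℂ) =
      ((c:ℝ) : ℂ) • hsCut c (∂_{m} χ) f + hsCut c χ (∂_{m} f) := by
  ext x
  rw [SchwartzMap.add_apply, SchwartzMap.smul_apply, hsCut_apply, hsCut_apply]
  simp only [SchwartzMap.lineDerivOp_apply_eq_fderiv]
  have e : (hsCut c χ f : X → ℂ) = fun x => χ ((c:ℝ) • x) * f x := by ext x; exact hsCut_apply _ _ _ _
  rw [e]
  have h1 : HasFDerivAt (fun x : X => χ ((c:ℝ) • x)) ((fderiv ℝ χ ((c:ℝ) • x)).comp ((c:ℝ) • ContinuousLinearMap.id ℝ X)) x :=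
    ((χ.differentiableAt (x := (c:ℝ) • x)).hasFDerivAt).comp x ((hasFDerivAt_id x).const_smul (c:ℝ))
  have h2 := h1.mul (f.differentiableAt (x := x)).hasFDerivAt
  rw [HasFDerivAt.fderiv (f := fun x => χ ((c:ℝ) • x) * f x) h2]
  simp
  ring

theorem hs_iter_add {r : ℕ} (m : Fin r → X) (f g : SchwartzMap X ℂ) :
    (∂^{m} (f + g) : SchwartzMap X ℂ) = (∂^{m} f : SchwartzMap X ℂ) + (∂^{m} g : SchwartzMap X ℂ) :=
  iteratedLineDerivOp_add m f g

theorem hs_cut_limit {r : ℕ} : ∀ (m : Fin r → X) (χ f : SchwartzMap X ℂ),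
    (∀ x, Filter.Tendsto (fun N : ℕ => (∂^{m} (hsCut (hsTwo (-(N:ℤ))) χ f) : SchwartzMap X ℂ) x) Filter.atTop
      (nhds (χ 0 * (∂^{m} f : SchwartzMap X ℂ) x))) ∧
    ∃ g : X → ℝ≥0∞, Measurable g ∧ ∫⁻ x, g x ≠ ⊤ ∧ ∀ (N : ℕ) x,
      ‖(∂^{m} (hsCut (hsTwo (-(N:ℤ))) χ f) : SchwartzMap X ℂ) x‖ₑ ≤ g x := by
  have htwo : ∀ N : ℕ, ((hsTwo (-(N:ℤ)) : ℝˣ) : ℝ) = (1/2) ^ N := by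
    intro N
    change (2:ℝ) ^ (-(N:ℤ)) = _
    rw [zpow_neg, zpow_natCast, one_div, inv_pow]
  have ht0 : Filter.Tendsto (fun N : ℕ => ((1/2:ℝ) ^ N)) Filter.atTop (nhds 0) :=
    tendsto_pow_atTop_nhds_zero_of_lt_one (by norm_num) (by norm_num)
  induction r with
  | zero =>
    intro m χ f
    simp only [iteratedLineDerivOp_fin_zero, hsCut_apply, htwo]
    refine ⟨fun x => ?_, ?_⟩
    · refine Filter.Tendsto.mul_const _ ?_
      have : Filter.Tendsto (fun N : ℕ => ((1/2:ℝ) ^ N) • x) Filter.atTop (nhds 0) := by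
        simpa using ht0.smul_const x
      exact (χ.continuous.tendsto 0).comp this
    · obtain ⟨B, hB1, hB2⟩ := χ.decay 0 0
      refine ⟨fun x => ENNReal.ofReal B * ‖f x‖ₑ, by fun_prop, ?_, fun N x => ?_⟩
      · rw [lintegral_const_mul' _ _ (by simp)]
        exact ENNReal.mul_ne_top (by simp) (hs_lintegral_schwartz_ne_top _)
      · rw [enorm_mul]
        refine mul_le_mul' ?_ le_rfl
        rw [← ofReal_norm]
        exact ENNReal.ofReal_le_ofReal (by simpa using hB2 (((1/2:ℝ) ^ N) • x))
  | succ r ih =>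
    intro m χ f
    simp only [iteratedLineDerivOp_succ_right, hsCut_deriv, hs_iter_add, hs_iter_smul, SchwartzMap.add_apply,
      SchwartzMap.smul_apply, smul_eq_mul, htwo]
    obtain ⟨a1, g1, b1, c1, d1⟩ := ih (Fin.init m) (∂_{m (Fin.last r)} χ) f
    obtain ⟨a2, g2, b2, c2, d2⟩ := ih (Fin.init m) χ (∂_{m (Fin.last r)} f)
    refine ⟨fun x => ?_, fun x => g1 x + g2 x, b1.add b2, ?_, fun N x => ?_⟩
    · have := (((Complex.continuous_ofReal.tendsto 0).comp ht0).mul (a1 x)).add (a2 x)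
      simpa using this
    · rw [lintegral_add_left b1]; exact ENNReal.add_ne_top.2 ⟨c1, c2⟩
    · refine (enorm_add_le _ _).trans (add_le_add ?_ (d2 N x))
      rw [enorm_mul]
      refine (mul_le_mul' (b := 1) ?_ (d1 N x)).trans (by simp)
      rw [← ofReal_norm, Complex.norm_real, Real.norm_of_nonneg (by positivity)]
      rw [← ENNReal.ofReal_one]
      exact ENNReal.ofReal_le_ofReal (pow_le_one₀ (by norm_num) (by norm_num))

theorem hs_cut_app {k : ℕ} (A : DiffOperator X k V E) (χ : SchwartzMap X ℂ) (hχ : χ 0 = 1)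
    (U : Fin (Module.finrank ℝ V) → SchwartzMap X ℂ) (p : Fin (Module.finrank ℝ E)) :
    Filter.Tendsto (fun N : ℕ => ∫⁻ x, ‖hsApp A (fun i => hsCut (hsTwo (-(N:ℤ))) χ (U i)) p x‖ₑ) Filter.atTop
      (nhds (∫⁻ x, ‖hsApp A U p x‖ₑ)) := by
  have h := fun (c : Fin k → Fin (Module.finrank ℝ X)) i =>
    hs_cut_limit (fun l => stdOrthonormalBasis ℝ X (c l)) χ (U i)
  choose h1 g h2 h3 h4 using h
  refine tendsto_lintegral_of_dominated_convergence
    (fun x => ∑ c, ∑ i, ‖((inner ℝ (stdOrthonormalBasis ℝ E p) (hsPol A (fun l => stdOrthonormalBasis ℝ X (c l))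
      (stdOrthonormalBasis ℝ V i)) : ℝ) : ℂ)‖ₑ * g c i x) (fun N => (SchwartzMap.continuous _).measurable.enorm) ?_ ?_ ?_
  · intro N
    refine Filter.Eventually.of_forall fun x => ?_
    simp only [hsApp, SchwartzMap.sum_apply, SchwartzMap.smul_apply, smul_eq_mul]
    refine (enorm_sum_le _ _).trans (Finset.sum_le_sum fun c _ => (enorm_sum_le _ _).trans (Finset.sum_le_sum fun i _ => ?_))
    rw [enorm_mul]
    exact mul_le_mul' le_rfl (h4 c i N x)
  · rw [lintegral_finsetSum _ (fun c _ => Finset.measurable_sum _ fun i _ => (h2 c i).const_mul _)]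
    refine ENNReal.sum_ne_top.2 fun c _ => ?_
    rw [lintegral_finsetSum _ (fun i _ => (h2 c i).const_mul _)]
    refine ENNReal.sum_ne_top.2 fun i _ => ?_
    rw [lintegral_const_mul' _ _ (by simp)]
    exact ENNReal.mul_ne_top (by simp) (h3 c i)
  · refine Filter.Eventually.of_forall fun x => ?_
    refine (continuous_enorm.tendsto _).comp ?_
    simp only [hsApp, SchwartzMap.sum_apply, SchwartzMap.smul_apply, smul_eq_mul]
    refine tendsto_finsetSum _ fun c _ => tendsto_finsetSum _ fun i _ => Filter.Tendsto.const_mul _ ?_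
    have := h1 c i x
    rwa [hχ, one_mul] at this

/-- The Hardy-Sobolev inequality in a homogeneous form -/
def HsIneq {r : ℕ} (A : DiffOperator X (r + 1) V E) (lam : ℝ) : Prop :=
    ∃ C : ℝ≥0∞, C ≠ ⊤ ∧ ∀ u : X → V, IsTestFun u →
      ∫⁻ x, ‖iteratedFDeriv ℝ r u x‖ₑ ^ (((Module.finrank ℝ X : ℝ) - lam) / ((Module.finrank ℝ X : ℝ) - 1))
        * ‖x‖ₑ ^ (-lam) ≤ C * (∫⁻ x, ‖A.app u x‖ₑ) ^ (((Module.finrank ℝ X : ℝ) - lam) / ((Module.finrank ℝ X : ℝ) - 1))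

theorem hsVec_test (ρ : ℂ →L[ℝ] ℝ) (W : Fin (Module.finrank ℝ V) → SchwartzMap X ℂ)
    (hW : ∀ i, HasCompactSupport (W i)) : IsTestFun (hsVec ρ W : X → V) := by
  refine ⟨ContDiff.sum fun i _ => ((ρ.contDiff.comp ((W i).smooth _)).smul contDiff_const), ?_⟩
  have : (hsVec ρ W : X → V) = ∑ i, fun x => ρ (W i x) • stdOrthonormalBasis ℝ V i := by
    ext x; simp [hsVec]
  rw [this]
  refine Finset.sum_induction _ HasCompactSupport (fun a b => HasCompactSupport.add) HasCompactSupport.zero fun i _ => ?_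
  exact (hW i).comp_left (g := fun z => ρ z • stdOrthonormalBasis ℝ V i) (by simp)

theorem hsVec_L1 {k : ℕ} (A : DiffOperator X k V E) (ρ : ℂ →L[ℝ] ℝ) (hρ : ∀ z, ‖ρ z‖ ≤ ‖z‖)
    (W : Fin (Module.finrank ℝ V) → SchwartzMap X ℂ) :
    ∫⁻ x, ‖A.app (hsVec ρ W) x‖ₑ ≤ ∑ p, ∫⁻ x, ‖hsApp A W p x‖ₑ := by
  rw [← lintegral_finsetSum _ (fun p _ => (SchwartzMap.continuous _).measurable.enorm)]
  refine lintegral_mono fun x => ?_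
  simp only [← ofReal_norm]
  rw [← ENNReal.ofReal_sum_of_nonneg (fun _ _ => norm_nonneg _)]
  refine ENNReal.ofReal_le_ofReal ?_
  conv_lhs => rw [← (stdOrthonormalBasis ℝ E).sum_repr' (A.app (hsVec ρ W) x)]
  refine (norm_sum_le _ _).trans (Finset.sum_le_sum fun p _ => ?_)
  rw [hsVec_app, norm_smul, OrthonormalBasis.norm_eq_one, mul_one]
  exact hρ _

theorem hsVec_coord (ρ : ℂ →L[ℝ] ℝ) (W : Fin (Module.finrank ℝ V) → SchwartzMap X ℂ) {k : ℕ} (m : Fin k → X) (x : X)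
    (i : Fin (Module.finrank ℝ V)) :
    ‖ρ ((∂^{m} (W i) : SchwartzMap X ℂ) x)‖ₑ ≤
      ENNReal.ofReal (∏ l, ‖m l‖) * ‖iteratedFDeriv ℝ k (hsVec ρ W : X → V) x‖ₑ := by
  rw [← ofReal_norm, ← ofReal_norm, ← ENNReal.ofReal_mul (by positivity)]
  refine ENNReal.ofReal_le_ofReal ?_
  have : ρ ((∂^{m} (W i) : SchwartzMap X ℂ) x) = inner ℝ (stdOrthonormalBasis ℝ V i) (iteratedFDeriv ℝ k (hsVec ρ W : X → V) x m) := by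
    rw [hsVec_iter]
    exact ((stdOrthonormalBasis ℝ V).orthonormal.inner_right_fintype
      (fun i => ρ ((∂^{m} (W i) : SchwartzMap X ℂ) x)) i).symm
  rw [this, mul_comm]
  refine (norm_inner_le_norm _ _).trans ?_
  rw [OrthonormalBasis.norm_eq_one, one_mul]
  exact ContinuousMultilinearMap.le_opNorm _ _

theorem hs_csi_of_ineq (hn : 2 ≤ Module.finrank ℝ X) {lam : ℝ} (h1 : lam < 1) {r : ℕ}
    {A : DiffOperator X (r + 1) V E} (h : HsIneq A lam) : HsCSI A lam := by
  intro m i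
  haveI : Nontrivial X := Module.nontrivial_of_finrank_pos (R := ℝ) (by omega)
  obtain ⟨C, hC, H⟩ := h
  have hn' : (2:ℝ) ≤ Module.finrank ℝ X := by exact_mod_cast hn
  have hq1 : 1 ≤ ((Module.finrank ℝ X : ℝ) - lam) / ((Module.finrank ℝ X : ℝ) - 1) := by
    rw [le_div_iff₀ (by linarith)]; linarith
  set q := ((Module.finrank ℝ X : ℝ) - lam) / ((Module.finrank ℝ X : ℝ) - 1) with hqdef
  clear_value q
  have hq : 0 ≤ q := by linarith
  set M : ℝ≥0∞ := ENNReal.ofReal (∏ l, ‖m l‖)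
  have hMq : M ^ q ≠ ⊤ := ENNReal.rpow_ne_top_of_nonneg hq (by simp [M])
  have h2q : (2:ℝ≥0∞) ^ (q - 1) ≠ ⊤ := ENNReal.rpow_ne_top_of_nonneg (by linarith) (by simp)
  refine ⟨2 ^ (q - 1) * (M ^ q * (C * 2 ^ q) + M ^ q * (C * 2 ^ q)), ?_, fun U F hUF hF => ?_⟩
  · have : (2:ℝ≥0∞) ^ q ≠ ⊤ := ENNReal.rpow_ne_top_of_nonneg (by linarith) (by simp)
    have h3 := ENNReal.mul_ne_top hMq (ENNReal.mul_ne_top hC this)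
    exact ENNReal.mul_ne_top h2q (ENNReal.add_ne_top.2 ⟨h3, h3⟩)
  have hF' := hUF.eq_hsApp
  let χ : SchwartzMap X ℂ := HasCompactSupport.toSchwartzMap (f := fun ξ : X => (hsBump X ξ : ℂ))
    (HasCompactSupport.comp_left (g := fun t : ℝ => (t:ℂ)) (hsBump X).hasCompactSupport (by simp))
    (Complex.ofRealCLM.contDiff.comp (hsBump X).contDiff)
  have hχa : ∀ x, χ x = (hsBump X x : ℂ) := fun x => rfl
  have hχc : HasCompactSupport χ := 
    HasCompactSupport.comp_left (g := fun t : ℝ => (t:ℂ)) (hsBump X).hasCompactSupport (by simp)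
  have hχ0 : χ 0 = 1 := by
    rw [hχa, hsBump_one (by simp)]; simp
  clear_value χ
  have hlim : Filter.Tendsto (fun N : ℕ => ∑ p, ∫⁻ x, ‖hsApp A (fun i => hsCut (hsTwo (-(N:ℤ))) χ (U i)) p x‖ₑ) Filter.atTop
      (nhds (∑ p, ∫⁻ w, ‖F p w‖ₑ)) := by
    rw [hF']
    exact tendsto_finsetSum _ fun p _ => hs_cut_app A χ hχ0 U p
  have hev := hlim.eventually_le_const (lt_of_le_of_lt hF (show (1:ℝ≥0∞) < 2 by norm_num))
  obtain ⟨N0, hN0⟩ := Filter.eventually_atTop.1 hev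
  refine hs_fatou hq _ (fun N x => (∂^{m} (hsCut (hsTwo (-((N + N0 : ℕ):ℤ))) χ (U i)) : SchwartzMap X ℂ) x)
    (fun N => (SchwartzMap.continuous _).measurable) _ (Filter.Eventually.of_forall fun x => ?_) fun N => ?_
  · have := (hs_cut_limit m χ (U i)).1 x
    rw [hχ0, one_mul] at this
    exact this.comp (Filter.tendsto_add_atTop_nat N0)
  set W : Fin (Module.finrank ℝ V) → SchwartzMap X ℂ := fun i => hsCut (hsTwo (-((N + N0 : ℕ):ℤ))) χ (U i) with hW
  have hWc : ∀ i, HasCompactSupport (W i) := by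
    intro i
    have e : (W i : X → ℂ) = fun x => χ (((hsTwo (-((N + N0 : ℕ):ℤ)) : ℝˣ) : ℝ) • x) * U i x := by
      ext x; exact hsCut_apply _ _ _ _
    rw [e]
    exact HasCompactSupport.mul_right (hχc.comp_homeomorph (Homeomorph.smul (hsTwo (-((N + N0 : ℕ):ℤ)))))
  have hWb := hN0 (N + N0) (by omega)
  have hmain : ∀ ρ : ℂ →L[ℝ] ℝ, (∀ z, ‖ρ z‖ ≤ ‖z‖) →
      ∫⁻ x, (M * ‖iteratedFDeriv ℝ r (hsVec ρ W : X → V) x‖ₑ) ^ q * ‖x‖ₑ ^ (-lam) ≤ M ^ q * (C * 2 ^ q) := by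
    intro ρ hρ
    simp only [ENNReal.mul_rpow_of_nonneg _ _ hq, mul_assoc]
    rw [lintegral_const_mul' _ _ hMq]
    refine mul_le_mul' le_rfl ((H _ (hsVec_test ρ W hWc)).trans (mul_le_mul' le_rfl (ENNReal.rpow_le_rpow ?_ hq)))
    exact (hsVec_L1 A ρ hρ W).trans hWb
  have hm1 := hmain Complex.reCLM (fun z => Complex.abs_re_le_norm z)
  have hm2 := hmain Complex.imCLM (fun z => Complex.abs_im_le_norm z)
  have hme : Measurable fun x => (M * ‖iteratedFDeriv ℝ r (hsVec Complex.reCLM W : X → V) x‖ₑ) ^ q * ‖x‖ₑ ^ (-lam) := by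
    have : Continuous fun x => iteratedFDeriv ℝ r (hsVec Complex.reCLM W : X → V) x :=
      (hsVec_test Complex.reCLM W hWc).1.continuous_iteratedFDeriv (by exact_mod_cast le_top)
    exact ((this.enorm.measurable.const_mul _).pow_const _).mul (measurable_enorm.pow_const _)
  refine le_trans ?_ (mul_le_mul' le_rfl (add_le_add hm1 hm2))
  rw [← lintegral_add_left hme, ← lintegral_const_mul' _ _ h2q]
  refine lintegral_mono fun x => ?_
  simp only []
  rw [← add_mul, ← mul_assoc]
  refine mul_le_mul' ?_ le_rfl
  refine le_trans (ENNReal.rpow_le_rpow ?_ hq) (ENNReal.rpow_add_le_mul_rpow_add_rpow _ _ hq1)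
  refine le_trans ?_ (add_le_add (hsVec_coord Complex.reCLM W m x i) (hsVec_coord Complex.imCLM W m x i))
  set z := (∂^{m} (W i) : SchwartzMap X ℂ) x
  change ‖z‖ₑ ≤ _
  rw [← ofReal_norm, ← ofReal_norm, ← ofReal_norm, ← ENNReal.ofReal_add (norm_nonneg _) (norm_nonneg _)]
  exact ENNReal.ofReal_le_ofReal (Complex.norm_le_abs_re_add_abs_im z)

end L1


section L3
open FourierTransform LineDeriv
variable {X : Type} [NormedAddCommGroup X] [InnerProductSpace ℝ X] [FiniteDimensional ℝ X]
  [MeasurableSpace X] [BorelSpace X]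

/-- Dilation by `t` in direction `ω`. -/
def hsAniL (ω : X) (t : ℝ) : X →L[ℝ] X :=
  ContinuousLinearMap.id ℝ X + (t - 1) • (innerSL ℝ ω).smulRight ω

theorem hsAniL_apply (ω : X) (t : ℝ) (x : X) : hsAniL ω t x = x + ((t - 1) * inner ℝ ω x) • ω := by
  simp [hsAniL, smul_smul]

theorem hsAniL_inv (ω : X) (hω : ‖ω‖ = 1) {s t : ℝ} (h : s * t = 1) (x : X) : hsAniL ω s (hsAniL ω t x) = x := by
  have hw : inner ℝ ω ω = (1:ℝ) := by rw [real_inner_self_eq_norm_sq, hω]; norm_num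
  simp only [hsAniL_apply, inner_add_right, inner_smul_right, hw]
  rw [add_assoc, ← add_smul]
  have : (t - 1) * inner ℝ ω x + (s - 1) * (inner ℝ ω x + (t - 1) * inner ℝ ω x * 1) = 0 := by
    linear_combination inner ℝ ω x * h
  rw [this]; simp

/-- Dilation by `t` in direction `ω`, as an equivalence. -/
def hsAni (ω : X) (hω : ‖ω‖ = 1) (t : ℝˣ) : X ≃L[ℝ] X :=
  ContinuousLinearEquiv.equivOfInverse (hsAniL ω t) (hsAniL ω (t⁻¹ : ℝˣ))
    (fun x => hsAniL_inv ω hω (by simp) x) (fun x => hsAniL_inv ω hω (by simp) x)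

theorem hsAni_apply (ω : X) (hω : ‖ω‖ = 1) (t : ℝˣ) (x : X) :
    hsAni ω hω t x = x + (((t:ℝ) - 1) * inner ℝ ω x) • ω := hsAniL_apply _ _ _

theorem hsAni_lintegral (ω : X) (hω : ‖ω‖ = 1) (t : ℝˣ) (ht : 0 < (t:ℝ)) (f : X → ℝ≥0∞) :
    ∫⁻ x, f (hsAni ω hω t x) = (ENNReal.ofReal t)⁻¹ * ∫⁻ x, f x := by
  have hw : inner ℝ ω ω = (1:ℝ) := by rw [real_inner_self_eq_norm_sq, hω]; norm_num
  let L : X →ₗ[ℝ] X := LinearMap.transvection (((t:ℝ) - 1) • (innerSL ℝ ω).toLinearMap) ω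
  have hL : ∀ x, L x = hsAni ω hω t x := by
    intro x
    rw [hsAni_apply]
    simp [L, LinearMap.transvection.apply]
  have hdet : LinearMap.det L = t := by
    rw [LinearMap.transvection.det]
    simp [hω]
  have h1 := Measure.map_linearMap_addHaar_eq_smul_addHaar (volume : Measure X) (f := L) (by rw [hdet]; exact ht.ne')
  have h2 : Measure.map (hsAni ω hω t) (volume : Measure X) = (ENNReal.ofReal t)⁻¹ • volume := by
    have : (hsAni ω hω t : X → X) = L := by ext x; rw [hL]
    rw [this, h1, hdet, abs_of_pos (by positivity), ENNReal.ofReal_inv_of_pos ht]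
  have h3 : ∫⁻ x, f (hsAni ω hω t x) = ∫⁻ y, f y ∂(Measure.map (hsAni ω hω t) (volume : Measure X)) :=
    (lintegral_map_equiv f (hsAni ω hω t).toHomeomorph.toMeasurableEquiv).symm
  rw [h3, h2, lintegral_smul_measure]; rfl

theorem hs_iter_comp (L : X ≃L[ℝ] X) (f : SchwartzMap X ℂ) {r : ℕ} (m : Fin r → X) :
    (∂^{m} (SchwartzMap.compCLMOfContinuousLinearEquiv ℂ L f) : SchwartzMap X ℂ) =
      SchwartzMap.compCLMOfContinuousLinearEquiv ℂ L (∂^{fun l => L (m l)} f) := by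
  induction r generalizing f with
  | zero => simp [iteratedLineDerivOp_fin_zero]
  | succ r ih =>
    rw [iteratedLineDerivOp_succ_right, SchwartzMap.lineDerivOp_compCLMOfContinuousLinearEquiv, ih,
      iteratedLineDerivOp_succ_right]
    rfl

theorem hs_iter_smul_univ {r : ℕ} (a : Fin r → ℝ) (m : Fin r → X) (f : SchwartzMap X ℂ) :
    (∂^{fun l => a l • m l} f : SchwartzMap X ℂ) = ((∏ l, a l : ℝ) : ℂ) • (∂^{m} f : SchwartzMap X ℂ) := by
  apply hs_fourier_inj
  intro ξ
  rw [hs_fourier_smul, hs_fourier_iter, hs_fourier_iter]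
  simp only [inner_smul_right]
  push_cast
  rw [Finset.prod_mul_distrib]
  ring

theorem hs_weight_zero [Nontrivial X] (f : X → ℂ) (hf : Measurable f) {q lam : ℝ} (hq : 0 < q)
    (h : ∫⁻ x, ‖f x‖ₑ ^ q * ‖x‖ₑ ^ (-lam) = 0) : f =ᵐ[volume] 0 := by
  have hm : Measurable fun x => ‖f x‖ₑ ^ q * ‖x‖ₑ ^ (-lam) := (hf.enorm.pow_const q).mul (measurable_enorm.pow_const _)
  rw [lintegral_eq_zero_iff hm] at h
  filter_upwards [h, hs_ae_ne_zero (Y := X)] with x hx hx0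
  have h1 : ‖f x‖ₑ ^ q * ‖x‖ₑ ^ (-lam) = 0 := hx
  rcases mul_eq_zero.1 h1 with h2 | h2
  · simpa [hq] using (ENNReal.rpow_eq_zero_iff_of_pos hq).1 h2
  · exfalso
    rcases ENNReal.rpow_eq_zero_iff.1 h2 with ⟨h3, -⟩ | ⟨h3, -⟩
    · exact hx0 (by simpa using h3)
    · simp at h3

universe hsv hse
variable {V : Type hsv} {E : Type hse} [NormedAddCommGroup V] [InnerProductSpace ℝ V] [FiniteDimensional ℝ V]
    [NormedAddCommGroup E] [InnerProductSpace ℝ E] [FiniteDimensional ℝ E]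

/-- The relation for a scalar function times a vector. -/
theorem hs_rel_vec {k : ℕ} (A : DiffOperator X k V E) (v : V) (g : SchwartzMap X ℂ) {ι : Type} [Fintype ι]
    (b : OrthonormalBasis ι ℝ X) :
    HsRel A (fun i => ((inner ℝ (stdOrthonormalBasis ℝ V i) v : ℝ) : ℂ) • g)
      (fun p => ∑ c : Fin k → ι, ((inner ℝ (stdOrthonormalBasis ℝ E p) (hsPol A (fun l => b (c l)) v) : ℝ) : ℂ) •
        (∂^{fun l => b (c l)} g : SchwartzMap X ℂ)) := by
  classical
  intro p ξ
  rw [hs_fourier_sum]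
  simp only [hs_fourier_smul, hs_fourier_iter]
  have h1 : ∑ i, ((inner ℝ (stdOrthonormalBasis ℝ E p) (A.symbol ξ (stdOrthonormalBasis ℝ V i)) : ℝ) : ℂ) *
      (((inner ℝ (stdOrthonormalBasis ℝ V i) v : ℝ) : ℂ) * 𝓕 g ξ) =
      ((inner ℝ (stdOrthonormalBasis ℝ E p) (A.symbol ξ v) : ℝ) : ℂ) * 𝓕 g ξ := by
    conv_rhs => rw [← (stdOrthonormalBasis ℝ V).sum_repr' v, map_sum, inner_sum]
    simp only [map_smul, inner_smul_right]
    push_cast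
    rw [Finset.sum_mul]
    exact Finset.sum_congr rfl fun i _ => by ring
  rw [h1, hs_symbol_expand A b, inner_sum]
  simp only [inner_smul_right]
  push_cast
  rw [Finset.sum_mul, Finset.mul_sum]
  exact Finset.sum_congr rfl fun c _ => by ring

theorem hs_csi_elliptic (hn : 2 ≤ Module.finrank ℝ X) {lam : ℝ} (h0 : 0 ≤ lam) (h1 : lam < 1) {r : ℕ}
    {A : DiffOperator X (r + 1) V E} (h : HsCSI A lam) : A.IsElliptic := by
  classical
  haveI : Nontrivial X := Module.nontrivial_of_finrank_pos (R := ℝ) (by omega)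
  have hn' : (2:ℝ) ≤ Module.finrank ℝ X := by exact_mod_cast hn
  intro ξ hξ
  rw [injective_iff_map_eq_zero]
  intro v hv
  by_contra hv0
  obtain ⟨ω, hω, hωv⟩ : ∃ ω : X, ‖ω‖ = 1 ∧ A.symbol ω v = 0 := by
    refine ⟨‖ξ‖⁻¹ • ξ, norm_smul_inv_norm hξ, ?_⟩
    rw [hs_symbol_smul, ContinuousLinearMap.smul_apply, hv, smul_zero]
  obtain ⟨b, i0, hb⟩ := hs_onb (X := X) (by omega) ω hω
  obtain ⟨i, hi⟩ : ∃ i, inner ℝ (stdOrthonormalBasis ℝ V i) v ≠ 0 := by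
    by_contra! hc
    apply hv0
    rw [← (stdOrthonormalBasis ℝ V).sum_repr' v]
    exact Finset.sum_eq_zero fun i _ => by rw [hc i, zero_smul]
  obtain ⟨C, hC, H⟩ := hs_csi_hom hn h1 h (fun _ => ω) i
  have hq1 : 1 < ((Module.finrank ℝ X : ℝ) - lam) / ((Module.finrank ℝ X : ℝ) - 1) := by
    rw [lt_div_iff₀ (by linarith)]; linarith
  set q := ((Module.finrank ℝ X : ℝ) - lam) / ((Module.finrank ℝ X : ℝ) - 1) with hqdef
  clear_value q
  have hq : 0 ≤ q := by linarith
  set g := hsGam X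
  set G : SchwartzMap X ℂ := ∂^{fun _ : Fin r => ω} g with hG
  set I := ∫⁻ x, ‖G x‖ₑ ^ q * ‖x‖ₑ ^ (-lam) with hI
  have hI0 : I ≠ 0 := by
    intro hz
    have h2 := hs_weight_zero (X := X) G G.continuous.measurable (by linarith : 0 < q) hz
    have h3 : (G : X → ℂ) = 0 := (Continuous.ae_eq_iff_eq volume G.continuous continuous_zero).1 h2
    have h4 : G = 0 := by ext x; rw [h3]; rfl
    have h5 := hs_fourier_iter (fun _ : Fin r => ω) g ω
    rw [← hG, h4, hsGam_fourier, hsBump_one hω.le] at h5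
    have h6 : 𝓕 (0 : SchwartzMap X ℂ) ω = 0 := by
      have := hs_fourier_smul (0:ℂ) (0 : SchwartzMap X ℂ) ω
      simpa using this
    rw [h6] at h5
    have h7 : ((2 * Real.pi * Complex.I : ℂ)) ^ r ≠ 0 := pow_ne_zero _ hs_two_pi_ne
    apply h7
    simpa [hω] using h5.symm
  set coef : Fin (Module.finrank ℝ E) → (Fin (r+1) → Fin (Module.finrank ℝ X)) → ℂ := fun p c =>
    ((inner ℝ (stdOrthonormalBasis ℝ E p) (hsPol A (fun l => b (c l)) v) : ℝ) : ℂ) with hcoef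
  set D : ℝ≥0∞ := ∑ p, ∑ c, ‖coef p c‖ₑ * ∫⁻ x, ‖(∂^{fun l => b (c l)} g : SchwartzMap X ℂ) x‖ₑ with hD
  have hDt : D ≠ ⊤ := ENNReal.sum_ne_top.2 fun p _ => ENNReal.sum_ne_top.2 fun c _ =>
    ENNReal.mul_ne_top (by simp) (hs_lintegral_schwartz_ne_top _)
  set vi : ℝ≥0∞ := ‖((inner ℝ (stdOrthonormalBasis ℝ V i) v : ℝ) : ℂ)‖ₑ with hvi
  have hvi0 : vi ≠ 0 := by simpa [hvi] using hi
  have key : ∀ t : ℝ, 1 ≤ t → (vi ^ q * I) * ENNReal.ofReal t ^ (q - 1) ≤ C * D ^ q := by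
    intro t ht
    have ht0 : 0 < t := by linarith
    set T := ENNReal.ofReal t with hT
    have hT1 : 1 ≤ T := by rw [hT, ← ENNReal.ofReal_one]; exact ENNReal.ofReal_le_ofReal ht
    have hT0 : T ≠ 0 := (lt_of_lt_of_le one_pos hT1).ne'
    have hTt : T ≠ ⊤ := by simp [hT]
    set L := hsAni ω hω (Units.mk0 t ht0.ne') with hL
    have hLint : ∀ f : X → ℝ≥0∞, ∫⁻ x, f (L x) = T⁻¹ * ∫⁻ x, f x := fun f =>
      hsAni_lintegral ω hω (Units.mk0 t ht0.ne') (by simpa using ht0) f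
    have hLb : ∀ j, L (b j) = (if j = i0 then t else 1) • b j := by
      intro j
      rw [hL, hsAni_apply, ← hb, OrthonormalBasis.inner_eq_ite]
      by_cases hj : i0 = j
      · subst hj; simp [sub_smul]
      · rw [if_neg hj, if_neg (Ne.symm hj)]; simp
    have hLω : L ω = t • ω := by have := hLb i0; rw [hb] at this; simpa using this
    have hLn : ∀ x, ‖x‖ₑ ≤ ‖L x‖ₑ := by
      intro x
      rw [← ofReal_norm, ← ofReal_norm]
      refine ENNReal.ofReal_le_ofReal ?_
      refine le_of_sq_le_sq ?_ (norm_nonneg _)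
      rw [hL, hsAni_apply, ← real_inner_self_eq_norm_sq, ← real_inner_self_eq_norm_sq]
      simp only [inner_add_left, inner_add_right, inner_smul_left, inner_smul_right]
      have hw : inner ℝ ω ω = (1:ℝ) := by rw [real_inner_self_eq_norm_sq, hω]; norm_num
      rw [hw, real_inner_comm ω x]
      simp only [Units.val_mk0, conj_trivial]
      nlinarith [mul_nonneg (sub_nonneg.2 ht) (sq_nonneg (inner ℝ ω x : ℝ)), sq_nonneg ((t-1) * inner ℝ ω x : ℝ)]
    set gL := SchwartzMap.compCLMOfContinuousLinearEquiv ℂ L g with hgL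
    have hit : ∀ (c : Fin (r+1) → Fin (Module.finrank ℝ X)) x, (∂^{fun l => b (c l)} gL : SchwartzMap X ℂ) x =
        ((∏ l, (if c l = i0 then t else 1) : ℝ) : ℂ) * (∂^{fun l => b (c l)} g : SchwartzMap X ℂ) (L x) := by
      intro c x
      rw [hgL, hs_iter_comp]
      simp only [hLb]
      rw [hs_iter_smul_univ]
      simp [SchwartzMap.compCLMOfContinuousLinearEquiv_apply]
    have hiG : ∀ x, (∂^{fun _ : Fin r => ω} gL : SchwartzMap X ℂ) x = ((t ^ r : ℝ) : ℂ) * G (L x) := by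
      intro x
      rw [hgL, hs_iter_comp]
      simp only [hLω]
      rw [hs_iter_smul_univ]
      simp [SchwartzMap.compCLMOfContinuousLinearEquiv_apply, hG]
    have hup : ∑ p, ∫⁻ w, ‖(∑ c, coef p c • (∂^{fun l => b (c l)} gL : SchwartzMap X ℂ)) w‖ₑ ≤ T ^ r * T⁻¹ * D := by
      rw [hD, Finset.mul_sum]
      refine Finset.sum_le_sum fun p _ => ?_
      calc _ ≤ ∫⁻ w, ∑ c, ‖coef p c‖ₑ * ‖(∂^{fun l => b (c l)} gL : SchwartzMap X ℂ) w‖ₑ := by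
            refine lintegral_mono fun w => ?_
            rw [SchwartzMap.sum_apply]
            refine (enorm_sum_le _ _).trans (Finset.sum_le_sum fun c _ => ?_)
            rw [SchwartzMap.smul_apply, smul_eq_mul, enorm_mul]
        _ = ∑ c, ‖coef p c‖ₑ * ∫⁻ w, ‖(∂^{fun l => b (c l)} gL : SchwartzMap X ℂ) w‖ₑ := by
            rw [lintegral_finsetSum _ (fun c _ => ((SchwartzMap.continuous _).measurable.enorm).const_mul _)]
            exact Finset.sum_congr rfl fun c _ => lintegral_const_mul' _ _ (by simp)
        _ ≤ _ := by
            rw [Finset.mul_sum]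
            refine Finset.sum_le_sum fun c _ => ?_
            by_cases hc : ∀ l, c l = i0
            · have : coef p c = 0 := by
                simp only [hcoef, hc, hb]
                rw [← hsPol_symbol, hωv]; simp
              rw [this]; simp
            push Not at hc
            obtain ⟨l0, hl0⟩ := hc
            have hpr : ‖((∏ l, (if c l = i0 then t else 1) : ℝ) : ℂ)‖ₑ ≤ T ^ r := by
              rw [Complex.ofReal_prod, ← Finset.mul_prod_erase _ _ (Finset.mem_univ l0), if_neg hl0, Complex.ofReal_one,
                one_mul, ← ofReal_norm, norm_prod, ENNReal.ofReal_prod_of_nonneg (fun _ _ => norm_nonneg _)]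
              refine (Finset.prod_le_pow_card _ _ T fun l _ => ?_).trans (le_of_eq (by simp))
              rw [Complex.norm_real]
              split_ifs
              · rw [Real.norm_of_nonneg ht0.le]
              · simpa using hT1
            simp only [hit, enorm_mul]
            rw [lintegral_const_mul' _ _ (by simp),
              hLint (fun x => ‖(∂^{fun l => b (c l)} g : SchwartzMap X ℂ) x‖ₑ)]
            calc _ ≤ ‖coef p c‖ₑ * (T ^ r * (T⁻¹ * ∫⁻ x, ‖(∂^{fun l => b (c l)} g : SchwartzMap X ℂ) x‖ₑ)) :=
                  mul_le_mul' le_rfl (mul_le_mul' hpr le_rfl)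
              _ = _ := by ring
    have hmain := H _ _ (hs_rel_vec A v gL b)
    simp only [hs_iter_smul, SchwartzMap.smul_apply, smul_eq_mul, hiG, enorm_mul] at hmain
    have hTr : ‖((t ^ r : ℝ) : ℂ)‖ₑ = T ^ r := by
      rw [← ofReal_norm, Complex.norm_real, Real.norm_of_nonneg (by positivity), ENNReal.ofReal_pow ht0.le]
    rw [hTr, ← hvi] at hmain
    have hTrt : T ^ r ≠ ⊤ := ENNReal.pow_ne_top hTt
    have hlow : (vi * T ^ r) ^ q * (T⁻¹ * I) ≤
        ∫⁻ x, (vi * (T ^ r * ‖G (L x)‖ₑ)) ^ q * ‖x‖ₑ ^ (-lam) := by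
      rw [← hLint (fun x => ‖G x‖ₑ ^ q * ‖x‖ₑ ^ (-lam)), ← lintegral_const_mul' _ _
        (ENNReal.rpow_ne_top_of_nonneg hq (ENNReal.mul_ne_top (by simp [hvi]) hTrt))]
      refine lintegral_mono fun x => ?_
      simp only []
      rw [← mul_assoc vi, ENNReal.mul_rpow_of_nonneg (vi * T ^ r) _ hq, mul_assoc]
      exact mul_le_mul' le_rfl (mul_le_mul' le_rfl (hs_ennreal_rpow_le_neg (hLn x) (by linarith)))
    have h9 := (hlow.trans hmain).trans (mul_le_mul' le_rfl (ENNReal.rpow_le_rpow hup hq))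
    have hTrq0 : (T ^ r) ^ q ≠ 0 := (ENNReal.rpow_pos (pos_iff_ne_zero.2 (pow_ne_zero _ hT0)) hTrt).ne'
    have hTrqt : (T ^ r) ^ q ≠ ⊤ := ENNReal.rpow_ne_top_of_nonneg hq hTrt
    simp only [ENNReal.mul_rpow_of_nonneg _ _ hq] at h9
    have h10 : (T ^ r) ^ q * (vi ^ q * T⁻¹ * I) ≤ (T ^ r) ^ q * (C * (T⁻¹ ^ q * D ^ q)) := by
      calc _ = vi ^ q * (T ^ r) ^ q * (T⁻¹ * I) := by ring
        _ ≤ _ := h9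
        _ = _ := by ring
    have h11 := (ENNReal.mul_le_mul_iff_right hTrq0 hTrqt).1 h10
    have h12 := mul_le_mul' (le_refl (T ^ q)) h11
    have e1 : T ^ q * T⁻¹ = T ^ (q - 1) := by
      rw [ENNReal.rpow_sub _ _ hT0 hTt, ENNReal.rpow_one, div_eq_mul_inv]
    have e2 : T ^ q * T⁻¹ ^ q = 1 := by
      rw [← ENNReal.mul_rpow_of_nonneg _ _ hq, ENNReal.mul_inv_cancel hT0 hTt, ENNReal.one_rpow]
    calc _ = (vi ^ q * I) * (T ^ q * T⁻¹) := by rw [e1]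
      _ = T ^ q * (vi ^ q * T⁻¹ * I) := by ring
      _ ≤ _ := h12
      _ = C * ((T ^ q * T⁻¹ ^ q) * D ^ q) := by ring
      _ = _ := by rw [e2, one_mul]
  have ha : vi ^ q * I ≠ 0 := mul_ne_zero (ENNReal.rpow_pos (pos_iff_ne_zero.2 hvi0) (by simp [hvi])).ne' hI0
  have hB : C * D ^ q ≠ ⊤ := ENNReal.mul_ne_top hC (ENNReal.rpow_ne_top_of_nonneg hq hDt)
  obtain ⟨N, hN⟩ := ENNReal.exists_nat_mul_gt ha hB
  have h13 := key (((N:ℝ) + 1) ^ (1 / (q - 1))) (Real.one_le_rpow (by linarith [N.cast_nonneg (α := ℝ)])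
    (div_nonneg zero_le_one (by linarith)))
  rw [ENNReal.ofReal_rpow_of_nonneg (by positivity) (by linarith), ← Real.rpow_mul (by positivity),
    one_div_mul_cancel (by linarith), Real.rpow_one] at h13
  have h14 : (N : ℝ≥0∞) ≤ ENNReal.ofReal ((N:ℝ) + 1) := by
    rw [← ENNReal.ofReal_natCast]; exact ENNReal.ofReal_le_ofReal (by linarith)
  have h15 := lt_of_lt_of_le hN (mul_le_mul' h14 (le_refl (vi ^ q * I)))
  rw [mul_comm (ENNReal.ofReal _)] at h15
  exact absurd h13 (not_le.2 h15)

end L3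


section L4
open FourierTransform LineDeriv
variable {X : Type} [NormedAddCommGroup X] [InnerProductSpace ℝ X] [FiniteDimensional ℝ X]
  [MeasurableSpace X] [BorelSpace X]

theorem hs_hom_zero [Nontrivial X] (hn : 2 ≤ Module.finrank ℝ X) {lam : ℝ} (h1 : lam < 1)
    (K : X → ℂ) (hK : Measurable K)
    (hhom : ∀ x, ((2:ℝ) ^ (Module.finrank ℝ X - 1)) • K ((2:ℝ) • x) = K x)
    (hI : ∫⁻ x, ‖K x‖ₑ ^ (((Module.finrank ℝ X : ℝ) - lam) / ((Module.finrank ℝ X : ℝ) - 1)) * ‖x‖ₑ ^ (-lam) ≠ ⊤) :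
    K =ᵐ[volume] 0 := by
  set n := Module.finrank ℝ X with hn'
  set q := ((n : ℝ) - lam) / ((n : ℝ) - 1) with hq
  have hnR : (2:ℝ) ≤ n := by exact_mod_cast hn
  have hq0 : 0 < q := div_pos (by linarith) (by linarith)
  refine hs_weight_zero (lam := lam) K hK hq0 ?_
  set f : X → ℝ≥0∞ := fun x => ‖K x‖ₑ ^ q * ‖x‖ₑ ^ (-lam) with hf
  have hf2 : ∀ x, ENNReal.ofReal ((2:ℝ) ^ n) * f ((2:ℝ) • x) = f x := by
    intro x
    have e2 : ‖(2:ℝ)‖ₑ = 2 := by simp [enorm_eq_nnnorm]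
    have e1 : ‖K x‖ₑ = (2:ℝ≥0∞) ^ ((n:ℝ) - 1) * ‖K ((2:ℝ) • x)‖ₑ := by
      rw [← hhom x, enorm_smul, enorm_pow, e2, ← ENNReal.rpow_natCast]
      congr 2
      push_cast [Nat.cast_sub (show 1 ≤ n by omega)]; rfl
    simp only [hf]
    rw [e1, ENNReal.mul_rpow_of_nonneg _ _ hq0.le, ← ENNReal.rpow_mul, enorm_smul, e2,
      ENNReal.mul_rpow_of_ne_top (by simp) (by simp), ENNReal.ofReal_pow (by norm_num), ENNReal.ofReal_ofNat]
    have e3 : ((n:ℝ) - 1) * q = n + -lam := by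
      rw [hq]; field_simp [show (n:ℝ) - 1 ≠ 0 by linarith]; ring
    rw [e3, ENNReal.rpow_add _ _ (by simp) (by simp), ENNReal.rpow_natCast]
    ring
  have hhalf : ∀ R : ℝ, ∫⁻ x in Metric.ball (0:X) R, f x = ∫⁻ x in Metric.ball (0:X) (R / 2), f x := by
    intro R
    have e := hs_lintegral_comp_smul ((Metric.ball (0:X) R).indicator f) (R := 2) two_pos
    have e' : ∀ y : X, (Metric.ball (0:X) (R/2)).indicator f y
        = ENNReal.ofReal ((2:ℝ) ^ n) * (Metric.ball (0:X) R).indicator f ((2:ℝ) • y) := by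
      intro y
      have hiff : (2:ℝ) • y ∈ Metric.ball (0:X) R ↔ y ∈ Metric.ball (0:X) (R/2) := by
        simp only [mem_ball_zero_iff, norm_smul, Real.norm_ofNat]
        constructor <;> intro h <;> linarith
      by_cases hy : y ∈ Metric.ball (0:X) (R/2)
      · rw [Set.indicator_of_mem hy, Set.indicator_of_mem (hiff.2 hy), hf2]
      · rw [Set.indicator_of_notMem hy, Set.indicator_of_notMem (fun h => hy (hiff.1 h)), mul_zero]
    rw [← lintegral_indicator measurableSet_ball, ← lintegral_indicator measurableSet_ball]
    simp_rw [e']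
    rw [lintegral_const_mul' _ _ (by simp), e, ← mul_assoc, ← ENNReal.ofReal_mul (by positivity), ← hn',
      mul_inv_cancel₀ (by positivity)]
    simp
  have hpow : ∀ (R : ℝ) (N : ℕ), ∫⁻ x in Metric.ball (0:X) R, f x = ∫⁻ x in Metric.ball (0:X) (R * (1/2) ^ N), f x := by
    intro R N
    induction N with
    | zero => simp
    | succ N ih =>
      rw [ih, hhalf]; congr 4; rw [pow_succ]; ring
  have hzero : ∀ R : ℝ, 0 < R → ∫⁻ x in Metric.ball (0:X) R, f x = 0 := by
    intro R hR
    have hv : Filter.Tendsto (fun N : ℕ => volume (Metric.ball (0:X) (R * (1/2) ^ N))) Filter.atTop (nhds 0) := by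
      have : ∀ N : ℕ, volume (Metric.ball (0:X) (R * (1/2) ^ N))
          = ENNReal.ofReal ((R * (1/2) ^ N) ^ n) * volume (Metric.ball (0:X) 1) := by
        intro N
        rw [Measure.addHaar_ball _ _ (by positivity)]
      simp_rw [this]
      have h0 : Filter.Tendsto (fun N : ℕ => ((R * (1/2:ℝ) ^ N) ^ n)) Filter.atTop (nhds 0) := by
        have := ((tendsto_pow_atTop_nhds_zero_of_lt_one (r := (1/2:ℝ)) (by norm_num) (by norm_num)).const_mul R).pow n
        simpa [show n ≠ 0 by omega] using this
      have h2 := ENNReal.Tendsto.mul_const (b := volume (Metric.ball (0:X) 1)) (ENNReal.tendsto_ofReal h0)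
        (Or.inr measure_ball_lt_top.ne)
      simpa using h2
    have h3 := tendsto_setLIntegral_zero (μ := volume) (f := f) hI hv
    have h4 : (fun N : ℕ => ∫⁻ x in Metric.ball (0:X) (R * (1/2) ^ N), f x) = fun _ => ∫⁻ x in Metric.ball (0:X) R, f x := by
      funext N; exact (hpow R N).symm
    have h5 : Filter.Tendsto (fun N : ℕ => ∫⁻ x in Metric.ball (0:X) (R * (1/2) ^ N), f x) Filter.atTop (nhds 0) := h3
    rw [h4] at h5
    exact tendsto_nhds_unique tendsto_const_nhds h5
  have hU : (⋃ N : ℕ, Metric.ball (0:X) (N + 1)) = Set.univ := by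
    refine Set.eq_univ_of_forall fun x => Set.mem_iUnion.2 ?_
    obtain ⟨N, hN⟩ := exists_nat_gt ‖x‖
    exact ⟨N, by rw [mem_ball_zero_iff]; linarith⟩
  have h6 := lintegral_iUnion_le (μ := volume) (fun N : ℕ => Metric.ball (0:X) (N + 1)) f
  rw [hU, setLIntegral_univ] at h6
  refine le_antisymm (h6.trans ?_) bot_le
  rw [ENNReal.tsum_eq_zero.2 fun N : ℕ => hzero (N + 1) (by positivity)]

theorem hs_kernel_formula (hn : 2 ≤ Module.finrank ℝ X) {μ : X → ℂ} (hμ : HsMul μ) {κ : SchwartzMap X ℂ}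
    (hκ : ∀ ξ, 𝓕 κ ξ = hsTh ξ * μ ξ) (J : ℕ) :
    ∃ K : SchwartzMap X ℂ, (K : X → ℂ) = hsDS (Finset.Icc (-(J:ℤ)) J) (Module.finrank ℝ X - 1) κ ∧
      ∀ ξ, 𝓕 K ξ = hsTheta J ξ * μ ξ := by
  set d := Module.finrank ℝ X - 1 with hd
  have hd1 : 1 ≤ d := by omega
  set S := Finset.Icc (-(J:ℤ)) J with hS
  set K : SchwartzMap X ℂ := ∑ j ∈ S, (((2:ℝ) ^ j) ^ d) • hsDil (hsTwo j) κ with hK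
  have hKa : (K : X → ℂ) = hsDS S d κ := by
    ext x
    rw [hK, SchwartzMap.sum_apply, hsDS]
    refine Finset.sum_congr rfl fun j _ => ?_
    rw [SchwartzMap.smul_apply, hsDil_apply]; rfl
  refine ⟨K, hKa, fun ξ => ?_⟩
  have hF : 𝓕 K ξ = ∑ j ∈ S, ((((2:ℝ) ^ j) ^ d : ℝ) : ℂ) * 𝓕 (hsDil (hsTwo j) κ) ξ := by
    have : 𝓕 K = ∑ j ∈ S, ((((2:ℝ) ^ j) ^ d : ℝ) : ℂ) • 𝓕 (hsDil (hsTwo j) κ) := by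
      have e := map_sum (fourierCLM ℂ (SchwartzMap X ℂ)) (fun j => ((((2:ℝ) ^ j) ^ d : ℝ) : ℂ) • hsDil (hsTwo j) κ) S
      simp only [map_smul] at e
      exact e
    rw [this, SchwartzMap.sum_apply]
    rfl
  rw [hF, hsTheta]
  push_cast
  rw [Finset.sum_mul]
  refine Finset.sum_congr rfl fun j _ => ?_
  rw [hsDil_fourier, hκ]
  have ht : ((hsTwo j : ℝˣ) : ℝ) = 2 ^ j := rfl
  rw [ht]
  have hpos : (0:ℝ) < 2 ^ j := by positivity
  have hfr : Module.finrank ℝ X = d + 1 := by omega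
  rw [hfr, abs_of_pos (by positivity)]
  by_cases hξ : ξ = 0
  · subst hξ; rw [smul_zero, hsTh_zero_near (by simp)]; simp
  · rw [hμ.2 _ ξ (by positivity) hξ]
    have : ((2:ℂ) ^ j) ≠ 0 := zpow_ne_zero _ two_ne_zero
    push_cast
    field_simp
    ring

theorem hs_limit_kernel (κ : SchwartzMap X ℂ) (hodd : ∀ x, κ (-x) = -κ x) (d : ℕ) (hd : 1 ≤ d) :
    ∃ K : X → ℂ, Measurable K ∧
      (∀ x, Filter.Tendsto (fun J : ℕ => hsDS (Finset.Icc (-(J:ℤ)) J) d κ x) Filter.atTop (nhds (K x))) ∧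
      ∀ x, ((2:ℝ) ^ d) • K ((2:ℝ) • x) = K x := by
  have h0 : κ 0 = 0 := by
    have := hodd 0
    rw [neg_zero] at this
    exact self_eq_neg.1 this
  obtain ⟨C, hC⟩ := hs_dyadic_sum
  obtain ⟨D, hD1, hD2⟩ := hs_schwartz_decay κ (d + 1)
  have hsum : ∀ x, Summable fun j : ℤ => ((2:ℝ) ^ j) ^ d • κ ((2:ℝ) ^ j • x) := by
    intro x
    by_cases hx : x = 0
    · subst hx; simp [h0, summable_zero]
    · apply Summable.of_enorm
      have hb : ∑' j : ℤ, ‖((2:ℝ) ^ j) ^ d • κ ((2:ℝ) ^ j • x)‖ₑ ≤ C * D * ‖x‖ₑ ^ (-(d:ℝ)) := by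
        rw [ENNReal.tsum_eq_iSup_sum]
        refine iSup_le fun S => ?_
        refine le_trans (le_of_eq ?_) (hC κ d hd D hD1 hD2 S x hx)
        refine Finset.sum_congr rfl fun j _ => ?_
        rw [enorm_smul, enorm_pow, hs_enorm_two_zpow, hs_two_zpow_mul]
      refine ne_top_of_le_ne_top ?_ hb
      refine ENNReal.mul_ne_top (ENNReal.mul_ne_top (by simp) (by simp)) ?_
      rw [ENNReal.rpow_neg]
      simp [hx]
  have hat : Filter.Tendsto (fun J : ℕ => Finset.Icc (-(J:ℤ)) J) Filter.atTop Filter.atTop := by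
    refine Filter.tendsto_atTop_finset_of_monotone ?_ ?_
    · intro a b hab
      refine Finset.Icc_subset_Icc ?_ ?_
      · simpa using hab
      · simpa using hab
    · intro j
      exact ⟨j.natAbs, by rw [Finset.mem_Icc]; omega⟩
  have htend : ∀ x, Filter.Tendsto (fun J : ℕ => hsDS (Finset.Icc (-(J:ℤ)) J) d κ x) Filter.atTop
      (nhds (∑' j : ℤ, ((2:ℝ) ^ j) ^ d • κ ((2:ℝ) ^ j • x))) := fun x => (hsum x).hasSum.comp hat
  refine ⟨fun x => ∑' j : ℤ, ((2:ℝ) ^ j) ^ d • κ ((2:ℝ) ^ j • x), ?_, htend, fun x => ?_⟩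
  · refine measurable_of_tendsto_metrizable (f := fun J : ℕ => hsDS (Finset.Icc (-(J:ℤ)) J) d κ) (fun J => ?_) (tendsto_pi_nhds.2 htend)
    refine Continuous.measurable ?_
    unfold hsDS
    have := κ.continuous
    fun_prop
  · simp only []
    rw [← (hsum ((2:ℝ) • x)).tsum_const_smul]
    rw [← (Equiv.addRight (1:ℤ)).tsum_eq (fun j : ℤ => ((2:ℝ) ^ j) ^ d • κ ((2:ℝ) ^ j • x))]
    refine tsum_congr fun j => ?_
    simp only [Equiv.coe_addRight]
    rw [zpow_add_one₀ two_ne_zero, smul_smul, smul_smul, mul_pow, mul_comm]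

end L4


section L4b
open FourierTransform LineDeriv
variable {X : Type} [NormedAddCommGroup X] [InnerProductSpace ℝ X] [FiniteDimensional ℝ X]
  [MeasurableSpace X] [BorelSpace X]

theorem hs_mu_zero [Nontrivial X] (hn : 2 ≤ Module.finrank ℝ X) {μ : X → ℂ} {κ : SchwartzMap X ℂ}
    (hodd : ∀ x, κ (-x) = -κ x)
    (hκ : ∀ ξ, 𝓕 κ ξ = hsTh ξ * μ ξ) (K : ℕ → SchwartzMap X ℂ) (hK : ∀ J ξ, 𝓕 (K J) ξ = hsTheta J ξ * μ ξ)
    (B : ℝ≥0) (hB : ∀ J x, ‖K J x‖ₑ ≤ B * ‖x‖ₑ ^ (-((Module.finrank ℝ X - 1 : ℕ) : ℝ)))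
    (ht : ∀ᵐ x, Filter.Tendsto (fun J => K J x) Filter.atTop (nhds 0)) (ξ : X) :
    (hsTh ξ : ℂ) * μ ξ * μ ξ = 0 := by
  set d := Module.finrank ℝ X - 1 with hd
  have hconst : ∀ J : ℕ, 1 ≤ J → ∀ ξ, 𝓕 (hsConv κ (K J)) ξ = (hsTh ξ : ℂ) * μ ξ * μ ξ := by
    intro J hJ ξ
    rw [hsConv_fourier, hκ, hK]
    by_cases h : hsTh ξ = 0
    · simp [h]
    · have h1 : 1 < ‖ξ‖ := by
        by_contra! h'; exact h (hsTh_zero_near h')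
      have h2 : ‖ξ‖ < 4 := by
        by_contra! h'; exact h (hsTh_zero_far h')
      have h3 : (2:ℝ) ^ 1 ≤ 2 ^ J := pow_le_pow_right₀ (by norm_num) hJ
      rw [hsTheta_eq_one]
      · push_cast; ring
      · nlinarith
      · rw [pow_succ]; linarith
  have heq : ∀ J : ℕ, 1 ≤ J → hsConv κ (K J) = hsConv κ (K 1) := by
    intro J hJ
    apply hs_fourier_inj
    intro ξ
    rw [hconst J hJ, hconst 1 le_rfl]
  have hzero : hsConv κ (K 1) = 0 := by
    ext x
    have hfin : ∫⁻ w, ‖κ (x - w)‖ₑ * ((B:ℝ≥0∞) * ‖w‖ₑ ^ (-(d:ℝ))) ≠ ⊤ := by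
      have e : ∀ w, ‖κ (x - w)‖ₑ * ((B:ℝ≥0∞) * ‖w‖ₑ ^ (-(d:ℝ)))
          = B * (‖SchwartzMap.compSubConstCLM ℂ x κ w‖ₑ ^ (1:ℝ) * ‖w‖ₑ ^ (-(d:ℝ))) := by
        intro w
        rw [ENNReal.rpow_one, SchwartzMap.compSubConstCLM_apply, ← neg_sub, hodd, enorm_neg]
        ring
      simp_rw [e]
      rw [lintegral_const_mul' _ _ (by simp)]
      refine ENNReal.mul_ne_top (by simp) (hs_schwartz_weight _ le_rfl ?_ (by positivity))
      exact_mod_cast (by omega : d < Module.finrank ℝ X)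
    have hlim : Filter.Tendsto (fun J : ℕ => ∫⁻ w, ‖κ (x - w)‖ₑ * ‖K J w‖ₑ) Filter.atTop (nhds (∫⁻ w : X, 0)) := by
      refine tendsto_lintegral_of_dominated_convergence (fun w => ‖κ (x - w)‖ₑ * ((B:ℝ≥0∞) * ‖w‖ₑ ^ (-(d:ℝ))))
        (fun J => ?_) (fun J => ?_) hfin ?_
      · have h1 := κ.continuous
        have h2 := (K J).continuous
        exact ((h1.comp (by fun_prop)).measurable.enorm).mul h2.measurable.enorm
      · exact Filter.Eventually.of_forall fun w => mul_le_mul' le_rfl (hB J w)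
      · filter_upwards [ht] with w hw
        have h1 := (continuous_enorm.tendsto _).comp hw
        have h2 := ENNReal.Tendsto.const_mul (a := ‖κ (x - w)‖ₑ) h1 (Or.inr (by simp))
        simpa using h2
    rw [lintegral_zero] at hlim
    have hle : ∀ᶠ J : ℕ in Filter.atTop, ‖hsConv κ (K 1) x‖ₑ ≤ ∫⁻ w, ‖κ (x - w)‖ₑ * ‖K J w‖ₑ := by
      filter_upwards [Filter.eventually_ge_atTop 1] with J hJ
      rw [← heq J hJ, hsConv_apply]
      refine (enorm_integral_le_lintegral_enorm _).trans (le_of_eq ?_)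
      simp_rw [enorm_mul]
    have := ge_of_tendsto hlim hle
    simpa using this
  rw [← hconst 1 le_rfl ξ, hzero]
  have := map_zero (fourierCLM ℂ (SchwartzMap X ℂ))
  exact congrArg (fun g : SchwartzMap X ℂ => g ξ) this

universe hsv hse
variable {V : Type hsv} {E : Type hse} [NormedAddCommGroup V] [InnerProductSpace ℝ V] [FiniteDimensional ℝ V]
  [NormedAddCommGroup E] [InnerProductSpace ℝ E] [FiniteDimensional ℝ E]

theorem hs_pot {k : ℕ} {A : DiffOperator X k V E} (hA : A.IsElliptic) (v : V) (e : E) (J : ℕ) (c : ℂ) :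
    ∃ U : SchwartzMap X ℂ, ∀ ξ, 𝓕 U ξ = c * ((hsTheta J ξ : ℂ) * ((inner ℝ v (hsPinv A ξ e) : ℝ) : ℂ)) := by
  have hth : ContDiff ℝ (⊤ : ℕ∞) (fun ξ : X => hsTheta J ξ) := by
    unfold hsTheta
    exact ContDiff.sum fun j _ => hsTh_contDiff.comp (contDiff_const.smul contDiff_id)
  have hsm : ContDiff ℝ (⊤ : ℕ∞) (fun ξ : X => c * ((hsTheta J ξ : ℂ) * ((inner ℝ v (hsPinv A ξ e) : ℝ) : ℂ))) := by
    rw [contDiff_iff_contDiffAt]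
    intro ξ
    by_cases h : ξ = 0
    · have : (fun ξ : X => c * ((hsTheta J ξ : ℂ) * ((inner ℝ v (hsPinv A ξ e) : ℝ) : ℂ))) =ᶠ[nhds ξ] fun _ => 0 := by
        subst h
        filter_upwards [Metric.ball_mem_nhds (0:X) (show (0:ℝ) < (2 ^ J)⁻¹ by positivity)] with x hx
        have hx1 : ‖x‖ ≤ (2 ^ J)⁻¹ := by simpa using (Metric.mem_ball.1 hx).le
        have h2J : (1:ℝ) ≤ 2 ^ J := one_le_pow₀ (by norm_num)
        have hx2 : ‖x‖ ≤ 1 := hx1.trans (inv_le_one_of_one_le₀ h2J)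
        have : hsTheta J x = 0 := by
          rw [hsTheta_eq, hsBump_one, hsBump_one]
          · simp
          · rw [norm_smul, norm_pow, Real.norm_ofNat]
            calc (2:ℝ) ^ J * ‖x‖ ≤ 2 ^ J * (2 ^ J)⁻¹ := by gcongr
              _ = 1 := mul_inv_cancel₀ (by positivity)
          · rw [norm_smul, norm_inv, norm_pow, Real.norm_ofNat, inv_mul_le_iff₀ (by positivity), mul_one]
            exact hx2.trans (one_le_pow₀ (by norm_num))
        rw [this]; simp
      exact contDiffAt_const.congr_of_eventuallyEq this
    · refine contDiffAt_const.mul ((Complex.ofRealCLM.contDiff.comp hth).contDiffAt.mul ?_)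
      refine Complex.ofRealCLM.contDiff.contDiffAt.comp ξ (contDiffAt_const.inner ℝ ?_)
      exact (hsPinv_contDiffAt hA h).clm_apply contDiffAt_const
  have hcs : HasCompactSupport (fun ξ : X => c * ((hsTheta J ξ : ℂ) * ((inner ℝ v (hsPinv A ξ e) : ℝ) : ℂ))) := by
    refine HasCompactSupport.intro (isCompact_closedBall (0:X) (2 ^ (J + 2))) fun x hx => ?_
    have hx1 : (2:ℝ) ^ (J + 2) < ‖x‖ := by simpa using hx
    have h2J : (1:ℝ) ≤ 2 ^ J := one_le_pow₀ (by norm_num)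
    have : hsTheta J x = 0 := by
      rw [hsTheta_eq, hsBump_zero, hsBump_zero]
      · simp
      · rw [norm_smul, norm_pow, Real.norm_ofNat]
        rw [pow_add] at hx1
        nlinarith
      · rw [norm_smul, norm_inv, norm_pow, Real.norm_ofNat, le_inv_mul_iff₀ (by positivity)]
        rw [pow_succ] at hx1
        exact hx1.le
    rw [this]; simp
  refine ⟨𝓕⁻ (hcs.toSchwartzMap hsm), fun ξ => ?_⟩
  rw [fourier_fourierInv_eq]
  rfl

theorem hs_csi_mu (hn : 2 ≤ Module.finrank ℝ X) {lam : ℝ} (h0 : 0 ≤ lam) (h1 : lam < 1) {r : ℕ}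
    {A : DiffOperator X (r + 1) V E} (hA : A.IsElliptic)
    (h : HsCSI A lam) {e : E} (he : ∀ ξ, ξ ≠ 0 → e ∈ Set.range (A.symbol ξ)) (m : Fin r → X)
    (i : Fin (Module.finrank ℝ V)) :
    ∃ C : ℝ≥0∞, C ≠ ⊤ ∧ ∀ (J : ℕ) (K : SchwartzMap X ℂ),
      (∀ ξ, 𝓕 K ξ = hsTheta J ξ * hsMu A m (stdOrthonormalBasis ℝ V i) e ξ) →
      ∫⁻ x, ‖K x‖ₑ ^ (((Module.finrank ℝ X : ℝ) - lam) / ((Module.finrank ℝ X : ℝ) - 1)) * ‖x‖ₑ ^ (-lam) ≤ C := by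
  have hnR : (2:ℝ) ≤ Module.finrank ℝ X := by exact_mod_cast hn
  obtain ⟨C, hCt, hC⟩ := hs_csi_hom hn h1 h m i
  obtain ⟨G, hG, hPsi⟩ := hs_Psi (X := X)
  set q := ((Module.finrank ℝ X : ℝ) - lam) / ((Module.finrank ℝ X : ℝ) - 1) with hq
  have hq0 : 0 ≤ q := (div_pos (by linarith) (by linarith)).le
  set T : ℝ≥0∞ := ∑ p : Fin (Module.finrank ℝ E), ‖((inner ℝ (stdOrthonormalBasis ℝ E p) e : ℝ) : ℂ)‖ₑ * G with hT
  refine ⟨C * T ^ q, ENNReal.mul_ne_top hCt (ENNReal.rpow_ne_top_of_nonneg hq0 ?_), fun J K hK => ?_⟩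
  · rw [hT]; exact ENNReal.sum_ne_top.2 fun p _ => ENNReal.mul_ne_top (by simp) (by simp)
  obtain ⟨Ψ, hΨ1, hΨ2⟩ := hPsi J
  have hpi : (2 * Real.pi * Complex.I : ℂ) ≠ 0 := hs_two_pi_ne
  choose U hU using fun i => hs_pot hA (stdOrthonormalBasis ℝ V i) e J ((2 * Real.pi * Complex.I : ℂ) ^ (r + 1))⁻¹
  have hrel : HsRel A U (fun p => ((inner ℝ (stdOrthonormalBasis ℝ E p) e : ℝ) : ℂ) • Ψ) := by
    intro p ξ
    rw [hs_fourier_smul, hΨ1]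
    simp_rw [hU]
    by_cases hξ : ξ = 0
    · subst hξ; simp [hsTheta_zero]
    · obtain ⟨w, hw⟩ := he ξ hξ
      have hw2 : hsPinv A ξ e = w := by rw [← hw, hsPinv_symbol hA hξ]
      rw [hw2]
      have hexp : inner ℝ (stdOrthonormalBasis ℝ E p) e
          = ∑ i, inner ℝ (stdOrthonormalBasis ℝ E p) (A.symbol ξ (stdOrthonormalBasis ℝ V i)) * inner ℝ (stdOrthonormalBasis ℝ V i) w := by
        conv_lhs => rw [← hw, ← (stdOrthonormalBasis ℝ V).sum_repr' w]
        rw [map_sum, inner_sum]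
        refine Finset.sum_congr rfl fun i _ => ?_
        rw [map_smul, inner_smul_right, mul_comm]
      rw [hexp]
      push_cast
      rw [Finset.sum_mul, Finset.mul_sum]
      refine Finset.sum_congr rfl fun i _ => ?_
      field_simp
  have hKU : (∂^{m} (U i) : SchwartzMap X ℂ) = K := by
    apply hs_fourier_inj
    intro ξ
    rw [hs_fourier_iter, hU, hK, hsMu]
    field_simp
    rw [pow_succ]
    ring
  have := hC U _ hrel
  rw [hKU] at this
  refine this.trans (mul_le_mul' le_rfl (ENNReal.rpow_le_rpow ?_ hq0))
  rw [hT]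
  refine Finset.sum_le_sum fun p _ => ?_
  simp only [SchwartzMap.smul_apply, enorm_smul]
  rw [lintegral_const_mul' _ _ (by simp)]
  exact mul_le_mul' le_rfl hΨ2

theorem hs_csi_canceling (hn : 2 ≤ Module.finrank ℝ X) {lam : ℝ} (h0 : 0 ≤ lam) (h1 : lam < 1) {r : ℕ}
    {A : DiffOperator X (r + 1) V E} (hA : A.IsElliptic) (h : HsCSI A lam) : A.IsCanceling := by
  have hnt : Nontrivial X := Module.nontrivial_of_finrank_pos (R := ℝ) (by omega)
  have hnR : (2:ℝ) ≤ Module.finrank ℝ X := by exact_mod_cast hn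
  refine Set.eq_singleton_iff_unique_mem.2 ⟨?_, fun e he' => ?_⟩
  · simp only [Set.mem_iInter]
    exact fun ξ _ => ⟨0, map_zero _⟩
  have he : ∀ ξ, ξ ≠ 0 → e ∈ Set.range (A.symbol ξ) := by
    intro ξ hξ
    simp only [Set.mem_iInter] at he'
    exact he' ξ hξ
  obtain ⟨ξ0, hξ0⟩ := exists_norm_eq X (show (0:ℝ) ≤ 2 by norm_num)
  have hξ0n : ξ0 ≠ 0 := by
    intro h; rw [h, norm_zero] at hξ0; norm_num at hξ0
  set m : Fin r → X := fun _ => ξ0 with hm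
  have key : ∀ i : Fin (Module.finrank ℝ V), inner ℝ (stdOrthonormalBasis ℝ V i) (hsPinv A ξ0 e) = (0:ℝ) := by
    intro i
    have hμ := hsMu_HsMul hA m (stdOrthonormalBasis ℝ V i) e
    obtain ⟨κ, hodd, hκ⟩ := hs_kerpiece hμ
    choose K hK1 hK2 using hs_kernel_formula hn hμ hκ
    obtain ⟨C, hCt, hC⟩ := hs_csi_mu hn h0 h1 hA h he m i
    obtain ⟨Ki, hKm, hKt, hKh⟩ := hs_limit_kernel κ hodd (Module.finrank ℝ X - 1) (by omega)
    obtain ⟨C', hC'⟩ := hs_dyadic_sum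
    obtain ⟨B, hB, hBd⟩ := hsDS_bound hC' κ (Module.finrank ℝ X - 1) (by omega)
    have hKt' : ∀ x, Filter.Tendsto (fun J => K J x) Filter.atTop (nhds (Ki x)) := by
      intro x
      simp_rw [hK1]
      exact hKt x
    have hI := hs_fatou (lam := lam) (q := ((Module.finrank ℝ X : ℝ) - lam) / ((Module.finrank ℝ X : ℝ) - 1))
      (div_nonneg (by linarith) (by linarith)) C (fun J => K J) (fun J => (K J).continuous.measurable) Ki
      (Filter.Eventually.of_forall hKt') (fun J => hC J (K J) (hK2 J))
    have hz := hs_hom_zero hn h1 Ki hKm hKh (ne_top_of_le_ne_top hCt hI)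
    have hzz := hs_mu_zero hn hodd hκ K hK2 B (fun J x => by rw [hK1]; exact hBd _ x)
      (by
        filter_upwards [hz] with x hx
        have := hKt' x
        rwa [hx] at this) ξ0
    have hth : hsTh ξ0 = 1 := by
      rw [hsTh, hsBump_one, hsBump_zero]
      · simp
      · exact hξ0.ge
      · rw [norm_smul, hξ0]; norm_num
    rw [hth, hsMu] at hzz
    have hin : inner ℝ ξ0 ξ0 = (4:ℝ) := by rw [real_inner_self_eq_norm_sq, hξ0]; norm_num
    simp only [hm, hin] at hzz
    have hpi : (2 * Real.pi * Complex.I : ℂ) ≠ 0 := hs_two_pi_ne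
    simpa using hzz
  have hw0 : hsPinv A ξ0 e = 0 := by
    rw [← (stdOrthonormalBasis ℝ V).sum_repr' (hsPinv A ξ0 e)]
    simp [key]
  obtain ⟨w, hw⟩ := he ξ0 hξ0n
  have hw2 : hsPinv A ξ0 e = w := by rw [← hw, hsPinv_symbol hA hξ0n]
  rw [← hw, ← hw2, hw0, map_zero]
end L4b

/-- Theorem: Hardy–Sobolev inequality characterizes elliptic canceling
operators. For a homogeneous operator `A(D)` of order `k` on `ℝⁿ` (`n ≥ 2`) and
`λ ∈ [0, 1)`, the estimate
`(∫ |D^{k−1}u|^{(n−λ)/(n−1)} / |x|^λ dx)^{(n−1)/(n−λ)} ≤ C ∫ |A(D)u|`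
holds for all `u ∈ C_c^∞(ℝⁿ; V)` iff `A(D)` is elliptic and canceling. -/
theorem statement3
    {V E : Type*} [NormedAddCommGroup V] [InnerProductSpace ℝ V] [FiniteDimensional ℝ V]
    [NormedAddCommGroup E] [InnerProductSpace ℝ E] [FiniteDimensional ℝ E]
    {n k : ℕ} (hn : 2 ≤ n) (hk : 0 < k)
    (A : DiffOperator (EuclideanSpace ℝ (Fin n)) k V E)
    (lam : ℝ) (hlam0 : 0 ≤ lam) (hlam1 : lam < 1) :
    (∃ C : ℝ, 0 < C ∧ ∀ u : EuclideanSpace ℝ (Fin n) → V, IsTestFun u →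
        (∫⁻ x, (‖iteratedFDeriv ℝ (k - 1) u x‖₊ : ℝ≥0∞) ^ (((n : ℝ) - lam) / ((n : ℝ) - 1))
              / (‖x‖₊ : ℝ≥0∞) ^ lam)
            ^ (((n : ℝ) - 1) / ((n : ℝ) - lam))
          ≤ ENNReal.ofReal C * ∫⁻ x, (‖A.app u x‖₊ : ℝ≥0∞))
      ↔ (A.IsElliptic ∧ A.IsCanceling) := by
  obtain ⟨r, rfl⟩ : ∃ r, k = r + 1 := ⟨k - 1, by omega⟩
  have hfr : Module.finrank ℝ (EuclideanSpace ℝ (Fin n)) = n := finrank_euclideanSpace_fin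
  have hn' : 2 ≤ Module.finrank ℝ (EuclideanSpace ℝ (Fin n)) := by rw [hfr]; exact hn
  have hnR : (2:ℝ) ≤ n := by exact_mod_cast hn
  have hq0 : 0 < ((n : ℝ) - lam) / ((n : ℝ) - 1) := div_pos (by linarith) (by linarith)
  have hqi : ((n : ℝ) - 1) / ((n : ℝ) - lam) = (((n : ℝ) - lam) / ((n : ℝ) - 1))⁻¹ := (inv_div _ _).symm
  have hconv : ∀ u : EuclideanSpace ℝ (Fin n) → V,
      (∫⁻ x, (‖iteratedFDeriv ℝ (r + 1 - 1) u x‖₊ : ℝ≥0∞) ^ (((n : ℝ) - lam) / ((n : ℝ) - 1))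
              / (‖x‖₊ : ℝ≥0∞) ^ lam) =
      ∫⁻ x, ‖iteratedFDeriv ℝ r u x‖ₑ ^ (((n : ℝ) - lam) / ((n : ℝ) - 1)) * ‖x‖ₑ ^ (-lam) := by
    intro u
    refine lintegral_congr fun x => ?_
    rw [ENNReal.rpow_neg, ← div_eq_mul_inv]
    rfl
  rw [hqi]
  simp_rw [hconv]
  constructor
  · rintro ⟨C, hC, H⟩
    have hI : HsIneq A lam := by
      refine ⟨ENNReal.ofReal C ^ (((n : ℝ) - lam) / ((n : ℝ) - 1)),
        ENNReal.rpow_ne_top_of_nonneg hq0.le (by simp), fun u hu => ?_⟩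
      rw [hfr, ← ENNReal.mul_rpow_of_nonneg _ _ hq0.le]
      exact (ENNReal.rpow_inv_le_iff hq0).1 (H u hu)
    have hcsi := hs_csi_of_ineq hn' hlam1 hI
    have hell := hs_csi_elliptic hn' hlam0 hlam1 hcsi
    exact ⟨hell, hs_csi_canceling hn' hlam0 hlam1 hell hcsi⟩
  · rintro ⟨hell, hcan⟩
    obtain ⟨C, hC, H⟩ := hs_ineq_of_csi hn' hlam1 (hs_L6 hn' hlam0 hlam1 hell hcan)
    rw [hfr] at H
    have hCt : C ^ (((n : ℝ) - lam) / ((n : ℝ) - 1))⁻¹ ≠ ⊤ :=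
      ENNReal.rpow_ne_top_of_nonneg (inv_nonneg.2 hq0.le) hC
    refine ⟨(C ^ (((n : ℝ) - lam) / ((n : ℝ) - 1))⁻¹).toReal + 1, by positivity, fun u hu => ?_⟩
    have h1 : C ^ (((n : ℝ) - lam) / ((n : ℝ) - 1))⁻¹ ≤
        ENNReal.ofReal ((C ^ (((n : ℝ) - lam) / ((n : ℝ) - 1))⁻¹).toReal + 1) := by
      rw [ENNReal.ofReal_add (by positivity) (by norm_num), ENNReal.ofReal_toReal hCt]
      exact le_self_add
    refine le_trans ?_ (mul_le_mul' h1 le_rfl)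
    refine (ENNReal.rpow_le_rpow (H u hu) (inv_nonneg.2 hq0.le)).trans (le_of_eq ?_)
    rw [ENNReal.mul_rpow_of_nonneg _ _ (inv_nonneg.2 hq0.le), ENNReal.rpow_rpow_inv hq0.ne']
    rfl
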